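/- (The slightly subcritical two-point function, two-sided bound.) Suppose d ≥ 1, 0 < α < d and α < 1. Then there are constants 0 < c₁ ≤ C₁ < ∞ (depending only on d, α, c, C) such that for every β with β_c/2 ≤ β ≤ β_c and every x ∈ ℤ^d \ {0}: c₁ ‖x‖^{−d+α} (1 ∨ ‖x‖/ξ(β))^{−2α} ≤ ℙ_β(0 ↔ x) ≤ C₁ ‖x‖^{−d+α} (1 ∨ ‖x‖/ξ(β))^{−2α}. -/

import Mathlib

open MeasureTheory ENNReal

namespace LRP

/-- The vertex set `ℤ^d`. -/
abbrev V (d : ℕ) : Type := Fin d → ℤ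

/-- The `ℓ^∞` norm of a lattice point, as a natural number. -/
def normInf {d : ℕ} (x : V d) : ℕ := Finset.univ.sup fun i => (x i).natAbs

/-- A percolation configuration: each (unordered) pair of vertices is open or closed. -/
abbrev Config (d : ℕ) : Type := Sym2 (V d) → Bool

/-- The probability `1 - exp (-β J(x,y))` that the edge `e = {x,y}` is open
(the symmetrization `(J x y + J y x)/2` equals `J x y` for symmetric `J`). -/
noncomputable def edgeProb {d : ℕ} (J : V d → V d → ℝ) (β : ℝ) (e : Sym2 (V d)) : ℝ≥0∞ :=
  ENNReal.ofReal (1 - Real.exp (-β *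
    Sym2.lift ⟨fun x y => (J x y + J y x) / 2, fun x y => by dsimp only; rw [add_comm]⟩ e))

/-- `IsLRP J P` asserts that for each `β`, `P β` is the law of long-range percolation on `ℤ^d`
with kernel `J` at inverse temperature `β`: distinct edges are open independently, edge `{x,y}`
being open with probability `1 - exp (-β J(x,y))`.  This is expressed by prescribing the
probability of every finite cylinder event, which characterizes the measure uniquely. -/
def IsLRP {d : ℕ} (J : V d → V d → ℝ) (P : ℝ → Measure (Config d)) : Prop :=
  ∀ (β : ℝ) (s : Finset (Sym2 (V d))) (f : Sym2 (V d) → Bool),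
    P β {ω | ∀ e ∈ s, ω e = f e} =
      ∏ e ∈ s, (if f e then edgeProb J β e else 1 - edgeProb J β e)

/-- Two vertices are adjacent if they are distinct and the edge between them is open. -/
def adj {d : ℕ} (ω : Config d) (x y : V d) : Prop := x ≠ y ∧ ω s(x, y) = true

/-- `x ↔ y`: the vertices are connected by a path of open edges. -/
def conn {d : ℕ} (ω : Config d) (x y : V d) : Prop := Relation.ReflTransGen (adj ω) x y

/-- `x ↔ y` inside `A`: connected by an open path all of whose vertices lie in `A`. -/
def connIn {d : ℕ} (ω : Config d) (A : Set (V d)) (x y : V d) : Prop :=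
  x ∈ A ∧ y ∈ A ∧ Relation.ReflTransGen (fun a b => a ∈ A ∧ b ∈ A ∧ adj ω a b) x y

/-- The cluster of `x`. -/
def cluster {d : ℕ} (ω : Config d) (x : V d) : Set (V d) := {y | conn ω x y}

/-- The critical point `β_c`. -/
noncomputable def betaC {d : ℕ} (P : ℝ → Measure (Config d)) : ℝ :=
  sInf {β : ℝ | 0 ≤ β ∧ 0 < P β {ω | ∃ x, (cluster ω x).Infinite}}

/-- The two-point function `ℙ_β(x ↔ y)`. -/
noncomputable def twoPoint {d : ℕ} (P : ℝ → Measure (Config d)) (β : ℝ) (x y : V d) : ℝ≥0∞ :=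
  P β {ω | conn ω x y}

/-- The susceptibility `χ(β) = Σ_x ℙ_β(0 ↔ x)`. -/
noncomputable def chi {d : ℕ} (P : ℝ → Measure (Config d)) (β : ℝ) : ℝ≥0∞ :=
  ∑' x : V d, twoPoint P β 0 x

/-- `Σ_{x ∈ [-n,n]^d} ℙ_β(0 ↔ x)`. -/
noncomputable def boxSum {d : ℕ} (P : ℝ → Measure (Config d)) (β : ℝ) (n : ℕ) : ℝ≥0∞ :=
  ∑' x : V d, if normInf x ≤ n then twoPoint P β 0 x else 0

/-- The correlation length `ξ(β) = inf {r ≥ 1 : Σ_{x ∈ [-r,r]^d} ℙ_β(0↔x) ≥ χ(β)/2}`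
(`= ∞` if no such `r` exists). -/
noncomputable def xi {d : ℕ} (P : ℝ → Measure (Config d)) (β : ℝ) : ℝ≥0∞ :=
  sInf {r : ℝ≥0∞ | ∃ n : ℕ, r = (n : ℝ≥0∞) ∧ 1 ≤ n ∧ chi P β ≤ 2 * boxSum P β n}

/-- The triangle diagram `∇_β`. -/
noncomputable def triangle {d : ℕ} (P : ℝ → Measure (Config d)) (β : ℝ) : ℝ≥0∞ :=
  ∑' x : V d, ∑' y : V d, twoPoint P β 0 x * twoPoint P β x y * twoPoint P β y 0

/-- The standing assumptions on the kernel `J`: symmetric, integrable, translation-invariant,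
with `c ‖x-y‖^{-d-α} ≤ J(x,y) ≤ C ‖x-y‖^{-d-α}` for distinct `x, y`, where `0 < α < d`. -/
structure KernelHyp (d : ℕ) (J : V d → V d → ℝ) (α c C : ℝ) : Prop where
  d_pos : 1 ≤ d
  symm : ∀ x y, J x y = J y x
  transInv : ∀ x y z : V d, J (x + z) (y + z) = J x y
  nonneg : ∀ x y, 0 ≤ J x y
  integrable : Summable fun x : V d => J 0 x
  alpha_pos : 0 < α
  alpha_lt_d : α < (d : ℝ)
  c_pos : 0 < c
  c_le_C : c ≤ C
  lower : ∀ x y : V d, x ≠ y → c * (normInf (x - y) : ℝ) ^ (-(d : ℝ) - α) ≤ J x y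
  upper : ∀ x y : V d, x ≠ y → J x y ≤ C * (normInf (x - y) : ℝ) ^ (-(d : ℝ) - α)

set_option linter.unusedSectionVars false

section Prob
variable {ι : Type*} [DecidableEq ι]

/-- Expectation of `f` over a random subset of `s`. -/
noncomputable def Ex (p : ι → ℝ) (s : Finset ι) (f : Finset ι → ℝ) : ℝ :=
  ∑ ω ∈ s.powerset, ((∏ e ∈ ω, p e) * ∏ e ∈ s \ ω, (1 - p e)) * f ω

open Classical in
/-- Indicator of a proposition. -/
noncomputable def ind (A : Prop) : ℝ := if A then 1 else 0

lemma ind_true {A : Prop} (h : A) : ind A = 1 := by simp [ind, h]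
lemma ind_false {A : Prop} (h : ¬ A) : ind A = 0 := by simp [ind, h]
lemma ind_nonneg (A : Prop) : 0 ≤ ind A := by
  unfold ind; split_ifs <;> norm_num
lemma ind_le_one (A : Prop) : ind A ≤ 1 := by
  unfold ind; split_ifs <;> norm_num
lemma ind_mono {A B : Prop} (h : A → B) : ind A ≤ ind B := by
  by_cases hA : A
  · rw [ind_true hA, ind_true (h hA)]
  · rw [ind_false hA]; exact ind_nonneg B
lemma ind_congr {A B : Prop} (h : A ↔ B) : ind A = ind B :=
  le_antisymm (ind_mono h.1) (ind_mono h.2)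
lemma ind_not (A : Prop) : ind (¬ A) = 1 - ind A := by
  by_cases hA : A
  · rw [ind_true hA, ind_false (not_not.2 hA)]; norm_num
  · rw [ind_false hA, ind_true hA]; norm_num
lemma ind_and (A B : Prop) : ind (A ∧ B) = ind A * ind B := by
  by_cases hA : A <;> by_cases hB : B <;> simp [ind, hA, hB]
lemma ind_or_le (A B : Prop) : ind (A ∨ B) ≤ ind A + ind B := by
  by_cases hA : A <;> by_cases hB : B <;> simp [ind, hA, hB]

/-- Probability. -/
noncomputable def Pr (p : ι → ℝ) (s : Finset ι) (A : Finset ι → Prop) : ℝ :=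
  Ex p s (fun ω => ind (A ω))

/-- Probabilities lie in `[0,1]`. -/
def PP (p : ι → ℝ) : Prop := ∀ e, 0 ≤ p e ∧ p e ≤ 1

variable {p : ι → ℝ} {s t : Finset ι} {f g : Finset ι → ℝ}

lemma Ex_empty (f : Finset ι → ℝ) : Ex p ∅ f = f ∅ := by simp [Ex]

lemma Ex_insert {a : ι} (ha : a ∉ s) (f : Finset ι → ℝ) :
    Ex p (insert a s) f =
      (1 - p a) * Ex p s f + p a * Ex p s (fun ω => f (insert a ω)) := by
  unfold Ex
  rw [Finset.sum_powerset_insert ha, Finset.mul_sum, Finset.mul_sum]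
  congr 1
  · refine Finset.sum_congr rfl fun ω hω => ?_
    have hω' := Finset.mem_powerset.1 hω
    have haω : a ∉ ω := fun h => ha (hω' h)
    rw [Finset.insert_sdiff_of_notMem _ haω, Finset.prod_insert (by simp [ha])]
    ring
  · refine Finset.sum_congr rfl fun ω hω => ?_
    have hω' := Finset.mem_powerset.1 hω
    have haω : a ∉ ω := fun h => ha (hω' h)
    have : insert a s \ insert a ω = s \ ω := by
      ext e; simp only [Finset.mem_sdiff, Finset.mem_insert]
      constructor
      · rintro ⟨h1 | h1, h2⟩
        · exact absurd (Or.inl h1) h2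
        · exact ⟨h1, fun h => h2 (Or.inr h)⟩
      · rintro ⟨h1, h2⟩
        refine ⟨Or.inr h1, ?_⟩
        rintro (h | h)
        · exact ha (h ▸ h1)
        · exact h2 h
    rw [this, Finset.prod_insert haω]
    ring

lemma Ex_congr (h : ∀ ω ⊆ s, f ω = g ω) : Ex p s f = Ex p s g := by
  unfold Ex
  refine Finset.sum_congr rfl fun ω hω => ?_
  rw [h ω (Finset.mem_powerset.1 hω)]

lemma Ex_mono (hp : PP p) (h : ∀ ω ⊆ s, f ω ≤ g ω) : Ex p s f ≤ Ex p s g := by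
  unfold Ex
  refine Finset.sum_le_sum fun ω hω => ?_
  refine mul_le_mul_of_nonneg_left (h ω (Finset.mem_powerset.1 hω)) ?_
  exact mul_nonneg (Finset.prod_nonneg fun e _ => (hp e).1)
    (Finset.prod_nonneg fun e _ => by linarith [(hp e).2])

lemma Ex_add (f g : Finset ι → ℝ) : Ex p s (fun ω => f ω + g ω) = Ex p s f + Ex p s g := by
  unfold Ex; rw [← Finset.sum_add_distrib]
  exact Finset.sum_congr rfl fun _ _ => by ring
lemma Ex_sub (f g : Finset ι → ℝ) : Ex p s (fun ω => f ω - g ω) = Ex p s f - Ex p s g := by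
  unfold Ex; rw [← Finset.sum_sub_distrib]
  exact Finset.sum_congr rfl fun _ _ => by ring
lemma Ex_mul (c : ℝ) (f : Finset ι → ℝ) : Ex p s (fun ω => c * f ω) = c * Ex p s f := by
  unfold Ex; rw [Finset.mul_sum]
  exact Finset.sum_congr rfl fun _ _ => by ring
lemma Ex_sum {κ : Type*} (u : Finset κ) (F : κ → Finset ι → ℝ) :
    Ex p s (fun ω => ∑ k ∈ u, F k ω) = ∑ k ∈ u, Ex p s (F k) := by
  unfold Ex; rw [Finset.sum_comm]
  exact Finset.sum_congr rfl fun _ _ => by rw [Finset.mul_sum]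
lemma Ex_const (c : ℝ) : Ex p s (fun _ => c) = c := by
  induction s using Finset.induction_on with
  | empty => simp [Ex]
  | insert a s ha ih => rw [Ex_insert ha, ih]; ring
lemma Ex_nonneg (hp : PP p) (h : ∀ ω ⊆ s, 0 ≤ f ω) : 0 ≤ Ex p s f := by
  have := Ex_mono hp (f := fun _ => 0) h
  rwa [Ex_const] at this
lemma Ex_mul_right (c : ℝ) (f : Finset ι → ℝ) : Ex p s (fun ω => f ω * c) = Ex p s f * c := by
  rw [mul_comm, ← Ex_mul]; congr 1; ext; ring

lemma Ex_union (h : Disjoint s t) (f : Finset ι → ℝ) :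
    Ex p (s ∪ t) f = Ex p s (fun ω => Ex p t (fun η => f (ω ∪ η))) := by
  induction s using Finset.induction_on generalizing f with
  | empty => simp [Ex_empty]
  | insert a s ha ih =>
    rw [Finset.disjoint_insert_left] at h
    rw [Finset.insert_union, Ex_insert (by simp [ha, h.1]), Ex_insert ha, ih h.2, ih h.2]
    congr 2
    refine Ex_congr fun ω _ => Ex_congr fun η _ => ?_
    rw [Finset.insert_union]

lemma Ex_marg (h : s ⊆ t) (f : Finset ι → ℝ) :
    Ex p t (fun ω => f (ω ∩ s)) = Ex p s f := by
  have h1 : t = s ∪ (t \ s) := (Finset.union_sdiff_of_subset h).symm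
  rw [h1, Ex_union Finset.disjoint_sdiff]
  refine Ex_congr fun ω hω => ?_
  rw [← Ex_const (p := p) (s := t \ s) (f ω)]
  refine Ex_congr fun η hη => ?_
  congr 1
  ext e
  simp only [Finset.mem_inter, Finset.mem_union]
  constructor
  · rintro ⟨h1 | h1, h2⟩
    · exact h1
    · exact absurd h2 (Finset.mem_sdiff.1 (hη h1)).2
  · exact fun h => ⟨Or.inl h, hω h⟩

lemma Pr_nonneg (hp : PP p) (A : Finset ι → Prop) : 0 ≤ Pr p s A :=
  Ex_nonneg hp fun _ _ => ind_nonneg _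
lemma Pr_le_one (hp : PP p) (A : Finset ι → Prop) : Pr p s A ≤ 1 := by
  rw [← Ex_const (p := p) (s := s) 1]; exact Ex_mono hp fun _ _ => ind_le_one _
lemma Pr_mono (hp : PP p) {A B : Finset ι → Prop} (h : ∀ ω ⊆ s, A ω → B ω) :
    Pr p s A ≤ Pr p s B := Ex_mono hp fun ω hω => ind_mono (h ω hω)
lemma Pr_congr {A B : Finset ι → Prop} (h : ∀ ω ⊆ s, A ω ↔ B ω) :
    Pr p s A = Pr p s B := Ex_congr fun ω hω => ind_congr (h ω hω)
lemma Pr_not (A : Finset ι → Prop) : Pr p s (fun ω => ¬ A ω) = 1 - Pr p s A := by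
  unfold Pr; rw [← Ex_const (p := p) (s := s) 1, ← Ex_sub]
  exact Ex_congr fun ω _ => ind_not _
lemma Pr_or_le (hp : PP p) (A B : Finset ι → Prop) :
    Pr p s (fun ω => A ω ∨ B ω) ≤ Pr p s A + Pr p s B := by
  unfold Pr; rw [← Ex_add]; exact Ex_mono hp fun ω _ => ind_or_le _ _
lemma Pr_exists_le (hp : PP p) {κ : Type*} (u : Finset κ) (A : κ → Finset ι → Prop) :
    Pr p s (fun ω => ∃ k ∈ u, A k ω) ≤ ∑ k ∈ u, Pr p s (A k) := by
  unfold Pr; rw [← Ex_sum]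
  refine Ex_mono hp fun ω _ => ?_
  by_cases h : ∃ k ∈ u, A k ω
  · obtain ⟨k, hk, hA⟩ := h
    calc ind (∃ k ∈ u, A k ω) ≤ 1 := ind_le_one _
      _ = ind (A k ω) := (ind_true hA).symm
      _ ≤ _ := Finset.single_le_sum (f := fun k => ind (A k ω)) (fun _ _ => ind_nonneg _) hk
  · rw [ind_false h]; exact Finset.sum_nonneg fun _ _ => ind_nonneg _

/-- increasing events have larger probability in larger sets -/
lemma Pr_mono_set (hp : PP p) (h : s ⊆ t) {A : Finset ι → Prop}
    (hA : ∀ ω η : Finset ι, ω ⊆ η → A ω → A η) : Pr p s A ≤ Pr p t A := by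
  unfold Pr
  rw [← Ex_marg h]
  exact Ex_mono hp fun ω _ => ind_mono (hA _ _ Finset.inter_subset_left)

lemma Pr_mem {a : ι} (ha : a ∈ s) : Pr p s (fun ω => a ∈ ω) = p a := by
  have h1 : Ex p s (fun ω => ind (a ∈ ω)) = Ex p s (fun ω => (fun η => ind (a ∈ η)) (ω ∩ {a})) := by
    refine Ex_congr fun ω _ => ind_congr ?_
    simp
  unfold Pr
  rw [h1, Ex_marg (Finset.singleton_subset_iff.2 ha) (fun η => ind (a ∈ η))]
  rw [← insert_empty_eq, Ex_insert (by simp), Ex_empty, Ex_empty]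
  rw [ind_false (by simp), ind_true (by simp)]; ring

lemma Pr_disj {F : Finset ι} (hF : F ⊆ s) :
    Pr p s (fun ω => Disjoint F ω) = ∏ e ∈ F, (1 - p e) := by
  have h1 : Ex p s (fun ω => ind (Disjoint F ω)) =
      Ex p s (fun ω => (fun η => ind (Disjoint F η)) (ω ∩ F)) := by
    refine Ex_congr fun ω _ => ind_congr ?_
    simp only [Finset.disjoint_left, Finset.mem_inter]
    tauto
  unfold Pr
  rw [h1, Ex_marg hF (fun η => ind (Disjoint F η))]
  clear h1 hF
  induction F using Finset.induction_on with
  | empty => simp [Ex_empty, ind]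
  | insert a F ha ih =>
    rw [Ex_insert ha, Finset.prod_insert ha, ← ih]
    have : Ex p F (fun ω => ind (Disjoint (insert a F) (insert a ω))) = 0 := by
      rw [← Ex_const (p := p) (s := F) 0]
      exact Ex_congr fun ω _ => ind_false (by simp)
    rw [this, mul_zero, add_zero]
    congr 1
    refine Ex_congr fun ω hω => ind_congr ?_
    rw [Finset.disjoint_insert_left]
    exact ⟨fun h => h.2, fun h => ⟨fun h' => ha (hω h'), h⟩⟩

/-- van den Berg-Kesten, general pair form. -/
lemma bk_aux (hp : PP p) (s : Finset ι) : ∀ W : Finset ι → Finset ι → Prop,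
    Pr p s (fun ω => ∃ I J, W I J ∧ Disjoint I J ∧ I ⊆ ω ∧ J ⊆ ω) ≤
      Ex p s (fun ω => Pr p s (fun η => ∃ I J, W I J ∧ I ⊆ ω ∧ J ⊆ η)) := by
  induction s using Finset.induction_on with
  | empty =>
    intro W
    simp only [Pr, Ex_empty]
    refine ind_mono ?_
    rintro ⟨I, J, h1, h2, h3, h4⟩
    exact ⟨I, J, h1, h3, h4⟩
  | insert a s ha ih =>
    intro W
    set S : (Finset ι → Finset ι → Prop) → ℝ := fun W =>
      Ex p s (fun ω => Pr p s (fun η => ∃ I J, W I J ∧ I ⊆ ω ∧ J ⊆ η)) with hS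
    set W0 : Finset ι → Finset ι → Prop := W
    set W1 : Finset ι → Finset ι → Prop := fun I J => W I J ∨ W (insert a I) J
    set W2 : Finset ι → Finset ι → Prop := fun I J => W I J ∨ W I (insert a J)
    set W3 : Finset ι → Finset ι → Prop := fun I J => W1 I J ∨ W2 I J
    set W4 : Finset ι → Finset ι → Prop := fun I J => W3 I J ∨ W (insert a I) (insert a J)
    have hmono : ∀ U U' : Finset ι → Finset ι → Prop, (∀ I J, U I J → U' I J) → S U ≤ S U' := by
      intro U U' h
      refine Ex_mono hp fun ω _ => Pr_mono hp fun η _ => ?_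
      rintro ⟨I, J, h1, h2⟩
      exact ⟨I, J, h _ _ h1, h2⟩
    have hunion : S W3 ≤ S W1 + S W2 - S W0 := by
      simp only [hS, Pr]
      rw [← Ex_add, ← Ex_sub]
      refine Ex_mono hp fun ω _ => ?_
      rw [← Ex_add, ← Ex_sub]
      refine Ex_mono hp fun η _ => ?_
      by_cases h0 : ∃ I J, W0 I J ∧ I ⊆ ω ∧ J ⊆ η
      · have h1 : ∃ I J, W1 I J ∧ I ⊆ ω ∧ J ⊆ η := by
          obtain ⟨I, J, h, h'⟩ := h0; exact ⟨I, J, Or.inl h, h'⟩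
        have h2 : ∃ I J, W2 I J ∧ I ⊆ ω ∧ J ⊆ η := by
          obtain ⟨I, J, h, h'⟩ := h0; exact ⟨I, J, Or.inl h, h'⟩
        rw [ind_true h0, ind_true h1, ind_true h2]
        linarith [ind_le_one (∃ I J, W3 I J ∧ I ⊆ ω ∧ J ⊆ η)]
      · rw [ind_false h0, sub_zero]
        refine le_trans (ind_mono ?_) (ind_or_le _ _)
        rintro ⟨I, J, h | h, h'⟩
        · exact Or.inl ⟨I, J, h, h'⟩
        · exact Or.inr ⟨I, J, h, h'⟩
    have hL : Pr p (insert a s) (fun ω => ∃ I J, W I J ∧ Disjoint I J ∧ I ⊆ ω ∧ J ⊆ ω) ≤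
        (1 - p a) * S W0 + p a * S W3 := by
      unfold Pr
      rw [Ex_insert ha]
      refine add_le_add (mul_le_mul_of_nonneg_left (ih W0) (by linarith [(hp a).2]))
        (mul_le_mul_of_nonneg_left ?_ (hp a).1)
      refine le_trans (Ex_mono hp fun ω hω => ind_mono ?_) (ih W3)
      rintro ⟨I, J, h, hd, hI, hJ⟩
      have haω : a ∉ ω := fun h => ha (hω h)
      by_cases h1 : a ∈ I
      · have h2 : a ∉ J := Finset.disjoint_left.1 hd h1
        refine ⟨I.erase a, J, Or.inl (Or.inr ?_), ?_, ?_, ?_⟩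
        · rwa [Finset.insert_erase h1]
        · exact Finset.disjoint_of_subset_left (Finset.erase_subset _ _) hd
        · rw [← Finset.subset_insert_iff]; exact hI
        · exact (Finset.subset_insert_iff_of_notMem h2).1 hJ
      · by_cases h2 : a ∈ J
        · refine ⟨I, J.erase a, Or.inr (Or.inr ?_), ?_, ?_, ?_⟩
          · rwa [Finset.insert_erase h2]
          · exact Finset.disjoint_of_subset_right (Finset.erase_subset _ _) hd
          · exact (Finset.subset_insert_iff_of_notMem h1).1 hI
          · rw [← Finset.subset_insert_iff]; exact hJ
        · exact ⟨I, J, Or.inl (Or.inl h), hd, (Finset.subset_insert_iff_of_notMem h1).1 hI,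
            (Finset.subset_insert_iff_of_notMem h2).1 hJ⟩
    have hR : (1 - p a) * ((1 - p a) * S W0 + p a * S W2) +
        p a * ((1 - p a) * S W1 + p a * S W4) ≤
        Ex p (insert a s) (fun ω => Pr p (insert a s)
          (fun η => ∃ I J, W I J ∧ I ⊆ ω ∧ J ⊆ η)) := by
      have q0 := (hp a).1
      have q1 : 0 ≤ 1 - p a := by linarith [(hp a).2]
      have key : ∀ I J ω : Finset ι, a ∉ ω → True := fun _ _ _ _ => trivial
      rw [Ex_insert ha]
      simp only [Pr, Ex_insert ha]
      simp only [Ex_add, Ex_mul]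
      refine add_le_add (mul_le_mul_of_nonneg_left (add_le_add (mul_le_mul_of_nonneg_left
        le_rfl q1) (mul_le_mul_of_nonneg_left ?_ q0)) q1)
        (mul_le_mul_of_nonneg_left (add_le_add (mul_le_mul_of_nonneg_left
        ?_ q1) (mul_le_mul_of_nonneg_left ?_ q0)) q0)
      · refine Ex_mono hp fun ω _ => Ex_mono hp fun η _ => ind_mono ?_
        rintro ⟨I, J, h | h, hI, hJ⟩
        · exact ⟨I, J, h, hI, hJ.trans (Finset.subset_insert _ _)⟩
        · exact ⟨I, insert a J, h, hI, Finset.insert_subset_insert _ hJ⟩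
      · refine Ex_mono hp fun ω _ => Ex_mono hp fun η _ => ind_mono ?_
        rintro ⟨I, J, h | h, hI, hJ⟩
        · exact ⟨I, J, h, hI.trans (Finset.subset_insert _ _), hJ⟩
        · exact ⟨insert a I, J, h, Finset.insert_subset_insert _ hI, hJ⟩
      · refine Ex_mono hp fun ω _ => Ex_mono hp fun η _ => ind_mono ?_
        rintro ⟨I, J, ((h | h) | (h | h)) | h, hI, hJ⟩
        · exact ⟨I, J, h, hI.trans (Finset.subset_insert _ _), hJ.trans (Finset.subset_insert _ _)⟩
        · exact ⟨insert a I, J, h, Finset.insert_subset_insert _ hI,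
            hJ.trans (Finset.subset_insert _ _)⟩
        · exact ⟨I, J, h, hI.trans (Finset.subset_insert _ _), hJ.trans (Finset.subset_insert _ _)⟩
        · exact ⟨I, insert a J, h, hI.trans (Finset.subset_insert _ _),
            Finset.insert_subset_insert _ hJ⟩
        · exact ⟨insert a I, insert a J, h, Finset.insert_subset_insert _ hI,
            Finset.insert_subset_insert _ hJ⟩
    refine hL.trans (le_trans ?_ hR)
    have h34 : S W3 ≤ S W4 := hmono _ _ fun I J h => Or.inl h
    have q0 := (hp a).1
    have q1 : 0 ≤ 1 - p a := by linarith [(hp a).2]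
    nlinarith [mul_le_mul_of_nonneg_left hunion (mul_nonneg q0 q1),
      mul_le_mul_of_nonneg_left h34 (mul_nonneg q0 q0)]

/-- van den Berg-Kesten inequality for increasing events. -/
lemma bk (hp : PP p) {A B E : Finset ι → Prop}
    (hA : ∀ ω η : Finset ι, ω ⊆ η → A ω → A η) (hB : ∀ ω η : Finset ι, ω ⊆ η → B ω → B η)
    (h : ∀ ω ⊆ s, E ω → ∃ I J, A I ∧ B J ∧ Disjoint I J ∧ I ⊆ ω ∧ J ⊆ ω) :
    Pr p s E ≤ Pr p s A * Pr p s B := by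
  calc Pr p s E ≤ Pr p s (fun ω => ∃ I J, (A I ∧ B J) ∧ Disjoint I J ∧ I ⊆ ω ∧ J ⊆ ω) := by
        refine Pr_mono hp fun ω hω hE => ?_
        obtain ⟨I, J, h1, h2, h3⟩ := h ω hω hE
        exact ⟨I, J, ⟨h1, h2⟩, h3⟩
    _ ≤ _ := bk_aux hp s (fun I J => A I ∧ B J)
    _ ≤ Ex p s (fun ω => Pr p s (fun η => A ω ∧ B η)) := by
        refine Ex_mono hp fun ω _ => Pr_mono hp fun η _ => ?_
        rintro ⟨I, J, ⟨h1, h2⟩, h3, h4⟩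
        exact ⟨hA _ _ h3 h1, hB _ _ h4 h2⟩
    _ = _ := by
        unfold Pr
        rw [← Ex_mul_right]
        refine Ex_congr fun ω _ => ?_
        rw [← Ex_mul]
        exact Ex_congr fun η _ => ind_and _ _

lemma Ex_map {κ : Type*} [DecidableEq κ] (e : ι ≃ κ) (q : κ → ℝ) (s : Finset ι)
    (f : Finset κ → ℝ) :
    Ex q (s.map e.toEmbedding) f = Ex (fun i => q (e i)) s (fun ω => f (ω.map e.toEmbedding)) := by
  induction s using Finset.induction_on generalizing f with
  | empty => simp [Ex_empty]
  | insert a s ha ih =>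
    rw [Finset.map_insert, Ex_insert (by simpa using ha), Ex_insert ha, ih, ih]
    simp only [Finset.map_insert, Equiv.coe_toEmbedding]

lemma Ex_prod_two (hs : Disjoint s t) (f : Finset ι → Finset ι → ℝ) {r : Finset ι}
    (hsr : s ⊆ r) (htr : t ⊆ r) :
    Ex p r (fun ω => f (ω ∩ s) (ω ∩ t)) = Ex p s (fun ω => Ex p t (fun η => f ω η)) := by
  have h1 : Ex p r (fun ω => f (ω ∩ s) (ω ∩ t)) =
      Ex p r (fun ω => (fun η => f (η ∩ s) (η ∩ t)) (ω ∩ (s ∪ t))) := by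
    refine Ex_congr fun ω _ => ?_
    dsimp only
    congr 1 <;> · ext; simp <;> tauto
  rw [h1, Ex_marg (Finset.union_subset hsr htr) (fun η => f (η ∩ s) (η ∩ t)), Ex_union hs]
  refine Ex_congr fun ω hω => Ex_congr fun η hη => ?_
  have hd := Finset.disjoint_left.1 hs
  congr 1
  · ext e; simp only [Finset.mem_inter, Finset.mem_union]
    constructor
    · rintro ⟨h | h, h'⟩
      · exact h
      · exact absurd (hη h) (hd h')
    · exact fun h => ⟨Or.inl h, hω h⟩
  · ext e; simp only [Finset.mem_inter, Finset.mem_union]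
    constructor
    · rintro ⟨h | h, h'⟩
      · exact absurd h' (hd (hω h))
      · exact h
    · exact fun h => ⟨Or.inr h, hη h⟩

end Prob

section Graph
variable {W : Type*} [DecidableEq W]

/-- Connectivity via a finite set of open edges. -/
def Cn (ω : Finset (Sym2 W)) (x y : W) : Prop :=
  Relation.ReflTransGen (fun a b => s(a, b) ∈ ω) x y

lemma Cn.mono {ω η : Finset (Sym2 W)} (h : ω ⊆ η) {x y : W} (hc : Cn ω x y) : Cn η x y :=
  Relation.ReflTransGen.mono (fun _ _ hab => h hab) _ _ hc
lemma Cn.refl (ω : Finset (Sym2 W)) (x : W) : Cn ω x x := Relation.ReflTransGen.refl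
lemma Cn.trans {ω : Finset (Sym2 W)} {x y z : W} (h : Cn ω x y) (h' : Cn ω y z) : Cn ω x z :=
  Relation.ReflTransGen.trans h h'
lemma Cn.edge {ω : Finset (Sym2 W)} {x y : W} (h : s(x, y) ∈ ω) : Cn ω x y :=
  Relation.ReflTransGen.single h
lemma Cn.symm {ω : Finset (Sym2 W)} {x y : W} (h : Cn ω x y) : Cn ω y x := by
  induction h with
  | refl => exact Cn.refl _ _
  | tail _ hbc ih => exact (Cn.edge (by rwa [Sym2.eq_swap])).trans ih

open Classical in
/-- Cluster within `D`. -/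
noncomputable def cl (D : Finset W) (ω : Finset (Sym2 W)) (x : W) : Finset W :=
  D.filter (fun y => Cn ω x y)

lemma mem_cl {D : Finset W} {ω : Finset (Sym2 W)} {x y : W} :
    y ∈ cl D ω x ↔ y ∈ D ∧ Cn ω x y := by simp [cl]

/-- Cluster size within `D`. -/
noncomputable def cs (D : Finset W) (ω : Finset (Sym2 W)) (x : W) : ℕ := (cl D ω x).card

lemma cs_mono {D : Finset W} {ω η : Finset (Sym2 W)} (h : ω ⊆ η) (x : W) :
    cs D ω x ≤ cs D η x := by
  refine Finset.card_le_card fun y hy => ?_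
  rw [mem_cl] at *
  exact ⟨hy.1, hy.2.mono h⟩

lemma cs_mono_dom {D E : Finset W} {ω : Finset (Sym2 W)} (h : D ⊆ E) (x : W) :
    cs D ω x ≤ cs E ω x := by
  refine Finset.card_le_card fun y hy => ?_
  rw [mem_cl] at *
  exact ⟨h hy.1, hy.2⟩

lemma cs_le_card (D : Finset W) (ω : Finset (Sym2 W)) (x : W) : cs D ω x ≤ D.card :=
  Finset.card_le_card fun _ hy => (mem_cl.1 hy).1

lemma one_le_cs {D : Finset W} (ω : Finset (Sym2 W)) {x : W} (hx : x ∈ D) : 1 ≤ cs D ω x :=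
  Finset.card_pos.2 ⟨x, mem_cl.2 ⟨hx, Cn.refl _ _⟩⟩

/-- Two-point function in `D`. -/
noncomputable def tau (p : Sym2 W → ℝ) (D : Finset W) (x y : W) : ℝ :=
  Pr p D.sym2 (fun ω => Cn ω x y)

variable {p : Sym2 W → ℝ}

lemma tau_nonneg (hp : PP p) (D : Finset W) (x y : W) : 0 ≤ tau p D x y := Pr_nonneg hp _
lemma tau_le_one (hp : PP p) (D : Finset W) (x y : W) : tau p D x y ≤ 1 := Pr_le_one hp _
lemma tau_mono (hp : PP p) {D E : Finset W} (h : D ⊆ E) (x y : W) : tau p D x y ≤ tau p E x y :=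
  Pr_mono_set hp (Finset.sym2_mono h) fun _ _ hω hc => hc.mono hω
lemma tau_symm (D : Finset W) (x y : W) : tau p D x y = tau p D y x :=
  Pr_congr fun _ _ => ⟨Cn.symm, Cn.symm⟩

lemma Ex_cs (D : Finset W) (x : W) :
    Ex p D.sym2 (fun ω => (cs D ω x : ℝ)) = ∑ y ∈ D, tau p D x y := by
  unfold tau Pr
  rw [← Ex_sum]
  refine Ex_congr fun ω _ => ?_
  classical
  simp [cs, cl, ind]

lemma Cn_out {D : Finset W} {ω : Finset (Sym2 W)} (hω : ω ⊆ D.sym2) {x y : W} (hx : x ∈ D)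
    (h : Cn ω x y) : y ∈ D := by
  induction h with
  | refl => exact hx
  | tail _ hbc _ => exact (Finset.mk_mem_sym2_iff.1 (hω hbc)).2

lemma tau_out {D : Finset W} {x y : W} (hx : x ∈ D) (hy : y ∉ D) : tau p D x y = 0 := by
  unfold tau Pr
  rw [← Ex_const (p := p) (s := D.sym2) 0]
  exact Ex_congr fun ω hω => ind_false fun h => hy (Cn_out hω hx h)

lemma exit_comb {T ω : Finset (Sym2 W)} {x y : W} (h : Cn ω x y) :
    Cn (ω ∩ T) x y ∨ ∃ u v, Cn (ω ∩ T) x u ∧ ¬ Cn (ω ∩ T) x v ∧ s(u, v) ∈ ω ∧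
      ∃ J ⊆ ω, Cn J v y ∧ ∀ e ∈ J, ∀ z ∈ e, ¬ Cn (ω ∩ T) x z := by
  classical
  set J := ω.filter (fun e => ∀ z ∈ e, ¬ Cn (ω ∩ T) x z)
  suffices H : Cn (ω ∩ T) x y ∨ ∃ u v, Cn (ω ∩ T) x u ∧ ¬ Cn (ω ∩ T) x v ∧ s(u, v) ∈ ω ∧
      Cn J v y by
    rcases H with H | ⟨u, v, h1, h2, h3, h4⟩
    · exact Or.inl H
    · exact Or.inr ⟨u, v, h1, h2, h3, J, Finset.filter_subset _ _, h4,
        fun e he => (Finset.mem_filter.1 he).2⟩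
  induction h with
  | refl => exact Or.inl (Cn.refl _ _)
  | @tail z w hz hzw ih =>
    by_cases hw : Cn (ω ∩ T) x w
    · exact Or.inl hw
    · right
      by_cases hz' : Cn (ω ∩ T) x z
      · exact ⟨z, w, hz', hw, hzw, Cn.refl _ _⟩
      · rcases ih with ih | ⟨u, v, h1, h2, h3, h4⟩
        · exact absurd ih hz'
        · refine ⟨u, v, h1, h2, h3, h4.trans (Cn.edge ?_)⟩
          refine Finset.mem_filter.2 ⟨hzw, ?_⟩
          intro a ha
          rcases Sym2.mem_iff.1 ha with rfl | rfl
          · exact hz'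
          · exact hw

lemma Cn_touch {ω J : Finset (Sym2 W)} {x u : W} (hJ : ∀ e ∈ J, ∀ z ∈ e, ¬ Cn ω x z)
    (h : Cn ω x u) : Cn (ω \ J) x u := by
  induction h with
  | refl => exact Cn.refl _ _
  | @tail a b hab hb ih =>
    refine ih.trans (Cn.edge (Finset.mem_sdiff.2 ⟨hb, fun h => ?_⟩))
    exact hJ _ h a (Sym2.mem_mk_left _ _) hab

lemma exit_ineq (hp : PP p) {D S : Finset W} {x : W} (y : W) (hx : x ∈ D) (hxS : x ∈ S) :
    tau p D x y ≤ tau p (D ∩ S) x y +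
      ∑ u ∈ D ∩ S, ∑ v ∈ D \ S, tau p (D ∩ S) x u * p s(u, v) * tau p D v y := by
  set T := (D ∩ S).sym2
  have hTD : T ⊆ D.sym2 := Finset.sym2_mono Finset.inter_subset_left
  have hmarg : ∀ u, Pr p D.sym2 (fun ω => Cn (ω ∩ T) x u) = tau p (D ∩ S) x u := by
    intro u
    unfold Pr tau Pr
    exact Ex_marg hTD (fun ω => ind (Cn ω x u))
  set B : W × W → Finset (Sym2 W) → Prop := fun q J =>
    ∃ I2 J2, s(q.1, q.2) ∈ I2 ∧ Cn J2 q.2 y ∧ Disjoint I2 J2 ∧ I2 ⊆ J ∧ J2 ⊆ J with hB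
  set E : W × W → Finset (Sym2 W) → Prop := fun q ω =>
    ∃ I J, Cn (I ∩ T) x q.1 ∧ B q J ∧ Disjoint I J ∧ I ⊆ ω ∧ J ⊆ ω with hE
  have hPB : ∀ q ∈ (D ∩ S) ×ˢ (D \ S), Pr p D.sym2 (B q) ≤ p s(q.1, q.2) * tau p D q.2 y := by
    intro q hq
    have hq1 := (Finset.mem_product.1 hq).1
    have hq2 := (Finset.mem_product.1 hq).2
    have hmem : s(q.1, q.2) ∈ D.sym2 := Finset.mk_mem_sym2_iff.2
      ⟨(Finset.mem_inter.1 hq1).1, (Finset.mem_sdiff.1 hq2).1⟩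
    rw [← Pr_mem (p := p) hmem]
    refine bk hp (A := fun ω => s(q.1, q.2) ∈ ω) (B := fun ω => Cn ω q.2 y)
      (fun _ _ h h' => h h') (fun _ _ h h' => h'.mono h) ?_
    rintro ω _ ⟨I2, J2, h⟩
    exact ⟨I2, J2, h⟩
  have hPE : ∀ q ∈ (D ∩ S) ×ˢ (D \ S), Pr p D.sym2 (E q) ≤
      tau p (D ∩ S) x q.1 * p s(q.1, q.2) * tau p D q.2 y := by
    intro q hq
    rw [mul_assoc]
    calc Pr p D.sym2 (E q) ≤ Pr p D.sym2 (fun ω => Cn (ω ∩ T) x q.1) * Pr p D.sym2 (B q) := by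
          refine bk hp (A := fun ω => Cn (ω ∩ T) x q.1) (B := B q) ?_ ?_ ?_
          · exact fun _ _ h h' => h'.mono (Finset.inter_subset_inter_right h)
          · rintro ω η h ⟨I2, J2, h1, h2, h3, h4, h5⟩
            exact ⟨I2, J2, h1, h2, h3, h4.trans h, h5.trans h⟩
          · exact fun ω _ h => h
      _ ≤ _ := by
          rw [hmarg]
          exact mul_le_mul_of_nonneg_left (hPB q hq) (tau_nonneg hp _ _ _)
  calc tau p D x y ≤ Pr p D.sym2 (fun ω => Cn (ω ∩ T) x y ∨ ∃ q ∈ (D ∩ S) ×ˢ (D \ S), E q ω) := by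
        refine Pr_mono hp fun ω hω h => ?_
        rcases exit_comb (T := T) h with h | ⟨u, v, h1, h2, h3, J, hJ, h4, h5⟩
        · exact Or.inl h
        · right
          have huDS : u ∈ D ∩ S := Cn_out (ω := ω ∩ T) Finset.inter_subset_right
            (Finset.mem_inter.2 ⟨hx, hxS⟩) h1
          have hvD : v ∈ D := (Finset.mk_mem_sym2_iff.1 (hω h3)).2
          have hvS : v ∉ S := by
            intro hv
            refine h2 (h1.trans (Cn.edge (Finset.mem_inter.2 ⟨h3, ?_⟩)))
            exact Finset.mk_mem_sym2_iff.2 ⟨huDS, Finset.mem_inter.2 ⟨hvD, hv⟩⟩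
          refine ⟨(u, v), Finset.mem_product.2 ⟨huDS, Finset.mem_sdiff.2 ⟨hvD, hvS⟩⟩, ?_⟩
          have hnJ : s(u, v) ∉ J := fun h => h5 _ h u (Sym2.mem_mk_left _ _) h1
          have hnT : s(u, v) ∉ T := fun h =>
            hvS (Finset.mem_inter.1 (Finset.mk_mem_sym2_iff.1 h).2).2
          refine ⟨(ω ∩ T) \ J, insert s(u, v) J, ?_, ?_, ?_, ?_, ?_⟩
          · refine (Cn_touch h5 h1).mono fun e he => ?_
            have := Finset.mem_sdiff.1 he
            exact Finset.mem_inter.2 ⟨he, (Finset.mem_inter.1 this.1).2⟩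
          · refine ⟨{s(u, v)}, J, by simp, h4, by simpa using hnJ, by simp, by simp⟩
          · rw [Finset.disjoint_insert_right]
            exact ⟨fun h => hnT (Finset.mem_inter.1 (Finset.mem_sdiff.1 h).1).2,
              Finset.sdiff_disjoint⟩
          · exact Finset.sdiff_subset.trans Finset.inter_subset_left
          · exact Finset.insert_subset h3 hJ
    _ ≤ _ := Pr_or_le hp _ _
    _ ≤ _ := by
        refine add_le_add (hmarg y).le ((Pr_exists_le hp _ _).trans ?_)
        rw [← Finset.sum_product']
        exact Finset.sum_le_sum hPE

lemma decomp (D : Finset W) {m : ℕ} (hm : 1 ≤ m) (J : Finset (Sym2 W)) : ∀ v, m ≤ cs D J v →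
    ∃ J1 J2 u, J1 ⊆ J ∧ J2 ⊆ J ∧ Disjoint J1 J2 ∧ Cn J1 v u ∧ m ≤ cs D J2 u ∧
      cs D J2 u < 2 * m ∧ cl D J v ⊆ cl D J1 v ∪ cl D J2 u := by
  classical
  induction J using Finset.strongInduction with
  | H J ih =>
  intro v hv
  by_cases hlt : cs D J v < 2 * m
  · exact ⟨∅, J, v, by simp, subset_rfl, by simp, Cn.refl _ _, hv, hlt,
      Finset.subset_union_right⟩
  push Not at hlt
  have h2 : 1 < (cl D J v).card := by unfold cs at hlt; omega
  obtain ⟨y, hy, hyv⟩ := Finset.exists_mem_ne h2 v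
  have hc : ∃ c, s(v, c) ∈ J := by
    rcases Relation.ReflTransGen.cases_head (mem_cl.1 hy).2 with h | ⟨c, hc, _⟩
    · exact absurd h.symm hyv
    · exact ⟨c, hc⟩
  obtain ⟨c, hc⟩ := hc
  set J' := J.erase s(v, c) with hJ'
  have hJ'J : J' ⊆ J := Finset.erase_subset _ _
  have hJ'ss : J' ⊂ J := Finset.erase_ssubset hc
  have hcov : ∀ z, Cn J v z → Cn J' v z ∨ Cn J' c z := by
    intro z hz
    induction hz with
    | refl => exact Or.inl (Cn.refl _ _)
    | @tail a b _ hab ih =>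
      by_cases he : s(a, b) = s(v, c)
      · rcases Sym2.eq_iff.1 he with ⟨_, rfl⟩ | ⟨_, rfl⟩
        · exact Or.inr (Cn.refl _ _)
        · exact Or.inl (Cn.refl _ _)
      · have : s(a, b) ∈ J' := Finset.mem_erase.2 ⟨he, hab⟩
        rcases ih with h | h
        · exact Or.inl (h.trans (Cn.edge this))
        · exact Or.inr (h.trans (Cn.edge this))
  by_cases hvc : Cn J' v c
  · have hcl : cl D J v ⊆ cl D J' v := by
      intro z hz
      rw [mem_cl] at *
      refine ⟨hz.1, ?_⟩
      rcases hcov z hz.2 with h | h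
      · exact h
      · exact hvc.trans h
    obtain ⟨J1, J2, u, h1, h2, h3, h4, h5, h6, h7⟩ := ih J' hJ'ss v
      (hv.trans (Finset.card_le_card hcl))
    exact ⟨J1, J2, u, h1.trans hJ'J, h2.trans hJ'J, h3, h4, h5, h6, hcl.trans h7⟩
  · -- separate components
    have main : ∀ a b : W, ¬ Cn J' a b → s(v, c) = s(a, b) → m ≤ cs D J' a →
        ∃ J1 J2 u, J1 ⊆ J ∧ J2 ⊆ J ∧ Disjoint J1 J2 ∧ Cn J1 a u ∧ s(v, c) ∈ J1 ∧
          (∀ z, Cn J' b z → Cn J1 b z) ∧ m ≤ cs D J2 u ∧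
          cs D J2 u < 2 * m ∧ cl D J' a ⊆ cl D J1 a ∪ cl D J2 u := by
      intro a b hab hsab hma
      set JA := J'.filter (fun e => ∃ z ∈ e, Cn J' a z) with hJA
      set JD := J' \ JA with hJD
      have hJA' : JA ⊆ J' := Finset.filter_subset _ _
      have hA : ∀ z, Cn J' a z → Cn JA a z := by
        intro z hz
        induction hz with
        | refl => exact Cn.refl _ _
        | @tail p q hp hq ih =>
          exact ih.trans (Cn.edge (Finset.mem_filter.2 ⟨hq, p, Sym2.mem_mk_left _ _, hp⟩))
      have hclA : cl D J' a = cl D JA a := by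
        ext z; rw [mem_cl, mem_cl]
        exact ⟨fun h => ⟨h.1, hA z h.2⟩, fun h => ⟨h.1, h.2.mono hJA'⟩⟩
      have hDD : ∀ z, Cn J' b z → Cn JD b z := by
        intro z hz
        induction hz with
        | refl => exact Cn.refl _ _
        | @tail p q hp hq ih =>
          refine ih.trans (Cn.edge (Finset.mem_sdiff.2 ⟨hq, fun h => ?_⟩))
          obtain ⟨w, hw, haw⟩ := (Finset.mem_filter.1 h).2
          rcases Sym2.mem_iff.1 hw with rfl | rfl
          · exact hab (Cn.trans haw (Cn.symm hp))
          · exact hab (Cn.trans haw (Cn.symm (Cn.trans hp (Cn.edge hq))))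
      obtain ⟨J1, J2, u, h1, h2, h3, h4, h5, h6, h7⟩ := ih JA
        (lt_of_le_of_lt hJA' hJ'ss) a (by unfold cs; rw [← hclA]; exact hma)
      have hsub1 : J1 ⊆ insert s(v, c) (J1 ∪ JD) :=
        Finset.subset_union_left.trans (Finset.subset_insert _ _)
      refine ⟨insert s(v, c) (J1 ∪ JD), J2, u, ?_, (h2.trans hJA').trans hJ'J, ?_, h4.mono hsub1,
        Finset.mem_insert_self _ _, ?_, h5, h6, ?_⟩
      · refine Finset.insert_subset hc (Finset.union_subset ((h1.trans hJA').trans hJ'J) ?_)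
        exact Finset.sdiff_subset.trans hJ'J
      · rw [Finset.disjoint_insert_left, Finset.disjoint_union_left]
        refine ⟨fun h => ?_, h3, ?_⟩
        · exact (Finset.mem_erase.1 (hJA' (h2 h))).1 rfl
        · exact Finset.disjoint_of_subset_right h2 Finset.sdiff_disjoint
      · intro z hz
        exact (hDD z hz).mono (Finset.subset_union_right.trans (Finset.subset_insert _ _))
      · rw [hclA]
        refine h7.trans (Finset.union_subset_union_left fun z hz => ?_)
        rw [mem_cl] at *
        exact ⟨hz.1, hz.2.mono hsub1⟩
    have hsum : cs D J v ≤ cs D J' v + cs D J' c := by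
      unfold cs
      rw [← Nat.add_zero ((cl D J v).card)]
      refine le_trans ?_ (Finset.card_union_le _ _)
      refine Finset.card_le_card fun z hz => ?_
      rw [Finset.mem_union, mem_cl, mem_cl]
      rw [mem_cl] at hz
      rcases hcov z hz.2 with h | h
      · exact Or.inl ⟨hz.1, h⟩
      · exact Or.inr ⟨hz.1, h⟩
    by_cases hA : m ≤ cs D J' v
    · obtain ⟨J1, J2, u, h1, h2, h3, h4, h5, h6, h7, h8, h9⟩ := main v c hvc rfl hA
      refine ⟨J1, J2, u, h1, h2, h3, h4, h7, h8, fun z hz => ?_⟩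
      rw [mem_cl] at hz
      rcases hcov z hz.2 with h | h
      · exact h9 (mem_cl.2 ⟨hz.1, h⟩)
      · exact Finset.mem_union_left _ (mem_cl.2 ⟨hz.1, (Cn.edge h5).trans (h6 z h)⟩)
    · have hD : m ≤ cs D J' c := by omega
      obtain ⟨J1, J2, u, h1, h2, h3, h4, h5, h6, h7, h8, h9⟩ :=
        main c v (fun h => hvc h.symm) Sym2.eq_swap hD
      have hvcJ : Cn J1 v c := Cn.edge h5
      refine ⟨J1, J2, u, h1, h2, h3, hvcJ.trans h4, h7, h8, fun z hz => ?_⟩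
      rw [mem_cl] at hz
      rcases hcov z hz.2 with h | h
      · exact Finset.mem_union_left _ (mem_cl.2 ⟨hz.1, h6 z h⟩)
      · rcases Finset.mem_union.1 (h9 (mem_cl.2 ⟨hz.1, h⟩)) with h' | h'
        · exact Finset.mem_union_left _ (mem_cl.2 ⟨hz.1, hvcJ.trans (mem_cl.1 h').2⟩)
        · exact Finset.mem_union_right _ h'

lemma tail_step (hp : PP p) (D : Finset W) (x : W) {m : ℕ} (hm : 1 ≤ m) (n : ℕ) :
    Pr p D.sym2 (fun ω => n + 2 * m ≤ cs D ω x) ≤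
      Pr p D.sym2 (fun ω => n ≤ cs D ω x) * Pr p D.sym2 (fun ω => ∃ u, m ≤ cs D ω u) := by
  refine bk hp (fun _ _ h h' => h'.trans (cs_mono h x))
    (fun _ _ h ⟨u, h'⟩ => ⟨u, h'.trans (cs_mono h u)⟩) ?_
  intro ω _ h
  obtain ⟨J1, J2, u, h1, h2, h3, h4, h5, h6, h7⟩ := decomp D hm ω x (by omega)
  refine ⟨J1, J2, ?_, ⟨u, h5⟩, h3, h1, h2⟩
  have := (Finset.card_le_card h7).trans (Finset.card_union_le _ _)
  unfold cs at *
  omega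

lemma tail_geom (hp : PP p) (D : Finset W) (x : W) {m : ℕ} (hm : 1 ≤ m) (k : ℕ) :
    Pr p D.sym2 (fun ω => m + 2 * m * k ≤ cs D ω x) ≤
      Pr p D.sym2 (fun ω => m ≤ cs D ω x) * (Pr p D.sym2 (fun ω => ∃ u, m ≤ cs D ω u)) ^ k := by
  induction k with
  | zero => simp
  | succ k ih =>
    have h := tail_step hp D x hm (m + 2 * m * k)
    have e : m + 2 * m * (k + 1) = m + 2 * m * k + 2 * m := by ring
    rw [e, pow_succ, ← mul_assoc]
    exact h.trans (mul_le_mul_of_nonneg_right ih (Pr_nonneg hp _))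

lemma tight (hp : PP p) (D : Finset W) (x : W) {m : ℕ} (hm : 1 ≤ m) {ε : ℝ} (hε : 0 < ε)
    (hq : Pr p D.sym2 (fun ω => ∃ u, m ≤ cs D ω u) ≤ 1 - ε) :
    Ex p D.sym2 (fun ω => (cs D ω x : ℝ)) ≤
      (1 + 2 / ε) * Ex p D.sym2 (fun ω => (min (cs D ω x) m : ℕ)) := by
  set q := Pr p D.sym2 (fun ω => ∃ u, m ≤ cs D ω u) with hqdef
  have hq0 : 0 ≤ q := Pr_nonneg hp _
  set K := D.card + 1
  set a := Pr p D.sym2 (fun ω => m ≤ cs D ω x) with ha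
  set M := Ex p D.sym2 (fun ω => ((min (cs D ω x) m : ℕ) : ℝ)) with hM
  have ha0 : 0 ≤ a := Pr_nonneg hp _
  have h1 : Ex p D.sym2 (fun ω => (cs D ω x : ℝ)) ≤
      Ex p D.sym2 (fun ω => ((min (cs D ω x) m : ℕ) : ℝ) +
        ∑ k ∈ Finset.range K, (2 * m : ℝ) * ind (m + 2 * m * k ≤ cs D ω x)) := by
    refine Ex_mono hp fun ω _ => ?_
    rcases lt_or_ge (cs D ω x) m with h | h
    · rw [min_eq_left h.le]
      have : 0 ≤ ∑ k ∈ Finset.range K, (2 * m : ℝ) * ind (m + 2 * m * k ≤ cs D ω x) :=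
        Finset.sum_nonneg fun k _ => mul_nonneg (by positivity) (ind_nonneg _)
      linarith
    · rw [min_eq_right h]
      set n := cs D ω x with hn
      set j := (n - m) / (2 * m) with hj
      have hdiv : n - m < 2 * m * (j + 1) := by
        have := Nat.lt_div_mul_add (a := n - m) (b := 2 * m) (by omega)
        rw [← hj] at this
        calc n - m < j * (2 * m) + 2 * m := this
          _ = 2 * m * (j + 1) := by ring
      have hjK : j + 1 ≤ K := by
        have h2 : j ≤ n - m := Nat.div_le_self _ _
        have h3 : n ≤ D.card := cs_le_card D ω x
        omega
      have hjm : 2 * m * j ≤ n - m := Nat.mul_div_le _ _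
      have h3 : (2 * m : ℝ) * (j + 1) ≤
          ∑ k ∈ Finset.range K, (2 * m : ℝ) * ind (m + 2 * m * k ≤ n) := by
        calc (2 * m : ℝ) * (j + 1) = ∑ k ∈ Finset.range (j + 1), (2 * m : ℝ) *
              ind (m + 2 * m * k ≤ n) := by
              rw [Finset.sum_congr rfl (g := fun _ => (2 * m : ℝ))]
              · simp; ring
              · intro k hk
                have hk' : k ≤ j := by simpa [Nat.lt_succ_iff] using hk
                have : 2 * m * k ≤ 2 * m * j := Nat.mul_le_mul_left _ hk'
                rw [ind_true (by omega), mul_one]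
          _ ≤ _ := Finset.sum_le_sum_of_subset_of_nonneg (by simpa using hjK)
              fun _ _ _ => mul_nonneg (by positivity) (ind_nonneg _)
      have h4 : (n : ℝ) ≤ m + 2 * m * (j + 1) := by
        have : n ≤ m + 2 * m * (j + 1) := by omega
        exact_mod_cast this
      linarith
  rw [Ex_add, Ex_sum] at h1
  have h2 : ∀ k ∈ Finset.range K, Ex p D.sym2 (fun ω => (2 * m : ℝ) *
      ind (m + 2 * m * k ≤ cs D ω x)) ≤ 2 * m * a * q ^ k := by
    intro k _
    rw [Ex_mul]
    calc _ ≤ (2 * m : ℝ) * (a * q ^ k) :=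
          mul_le_mul_of_nonneg_left (tail_geom hp D x hm k) (by positivity)
      _ = _ := by ring
  have h3 : ∑ k ∈ Finset.range K, 2 * m * a * q ^ k ≤ 2 * m * a * (1 / ε) := by
    rw [← Finset.mul_sum]
    refine mul_le_mul_of_nonneg_left ?_ (by positivity)
    have hq1 : q < 1 := by linarith
    calc ∑ k ∈ Finset.range K, q ^ k ≤ (1 - q)⁻¹ := by
          rw [← tsum_geometric_of_lt_one hq0 hq1]
          exact Summable.sum_le_tsum _ (fun _ _ => by positivity)
            (summable_geometric_of_lt_one hq0 hq1)
      _ ≤ ε⁻¹ := inv_anti₀ hε (by linarith)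
      _ = 1 / ε := by rw [one_div]
  have h4 : m * a ≤ M := by
    rw [ha, hM, Pr, ← Ex_mul]
    refine Ex_mono hp fun ω _ => ?_
    by_cases h : m ≤ cs D ω x
    · rw [ind_true h, min_eq_right h]; simp
    · rw [ind_false h]; simp
  have h5 : 2 * m * a * (1 / ε) ≤ 2 / ε * M := by
    calc 2 * m * a * (1 / ε) = 2 / ε * (m * a) := by ring
      _ ≤ _ := mul_le_mul_of_nonneg_left h4 (by positivity)
  have h6 := Finset.sum_le_sum h2
  linarith

end Graph

section Graph2
variable {W : Type*} [DecidableEq W] {p : Sym2 W → ℝ}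

lemma JL (hp : PP p) {D D1 D2 : Finset W} (h1 : D1 ⊆ D) (h2 : D2 ⊆ D) (hd : Disjoint D1 D2)
    {l : ℝ} (hl : ∀ u ∈ D1, ∀ v ∈ D2, 1 - p s(u, v) ≤ Real.exp (-l))
    (x1 x2 : Finset (Sym2 W) → W) (g : Finset (Sym2 W) → Finset (Sym2 W) → ℝ)
    (hg : ∀ a b, 0 ≤ g a b) :
    Ex p D.sym2 (fun ω => g (ω ∩ D1.sym2) (ω ∩ D2.sym2) *
      ind (¬ Cn ω (x1 (ω ∩ D1.sym2)) (x2 (ω ∩ D2.sym2)))) ≤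
    Ex p D1.sym2 (fun ω => Ex p D2.sym2 (fun η => g ω η *
      Real.exp (-(l * (cs D1 ω (x1 ω) * cs D2 η (x2 η)))))) := by
  classical
  set s := D1.sym2 with hs
  set t := D2.sym2 with ht
  set c := (D1 ×ˢ D2).image (fun q => s(q.1, q.2)) with hc
  have hdd := Finset.disjoint_left.1 hd
  have hst : Disjoint s t := by
    rw [Finset.disjoint_left]
    intro e he he'
    induction e with | _ a b =>
    exact hdd (Finset.mk_mem_sym2_iff.1 he).1 (Finset.mk_mem_sym2_iff.1 he').1
  have hstc : Disjoint (s ∪ t) c := by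
    rw [Finset.disjoint_right]
    intro e he he'
    obtain ⟨q, hq, rfl⟩ := Finset.mem_image.1 he
    have hq' := Finset.mem_product.1 hq
    rcases Finset.mem_union.1 he' with h | h
    · exact hdd (Finset.mk_mem_sym2_iff.1 h).2 hq'.2
    · exact hdd hq'.1 (Finset.mk_mem_sym2_iff.1 h).1
  have hsD : s ⊆ D.sym2 := Finset.sym2_mono h1
  have htD : t ⊆ D.sym2 := Finset.sym2_mono h2
  have hcD : c ⊆ D.sym2 := by
    intro e he
    obtain ⟨q, hq, rfl⟩ := Finset.mem_image.1 he
    have hq' := Finset.mem_product.1 hq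
    exact Finset.mk_mem_sym2_iff.2 ⟨h1 hq'.1, h2 hq'.2⟩
  set F : Finset (Sym2 W) → Finset (Sym2 W) → Finset (Sym2 W) := fun a b =>
    (cl D1 a (x1 a) ×ˢ cl D2 b (x2 b)).image (fun q => s(q.1, q.2)) with hF
  have hclD : ∀ a b, cl D1 a (x1 a) ×ˢ cl D2 b (x2 b) ⊆ D1 ×ˢ D2 := fun a b =>
    Finset.product_subset_product (fun _ h => (mem_cl.1 h).1) (fun _ h => (mem_cl.1 h).1)
  have hFc : ∀ a b, F a b ⊆ c := fun a b => Finset.image_subset_image (hclD a b)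
  have hFcard : ∀ a b, (F a b).card = cs D1 a (x1 a) * cs D2 b (x2 b) := by
    intro a b
    rw [hF, Finset.card_image_of_injOn, Finset.card_product]; rfl
    intro q hq r hr hqr
    have hq' := Finset.mem_product.1 (hclD a b hq)
    have hr' := Finset.mem_product.1 (hclD a b hr)
    rcases Sym2.eq_iff.1 hqr with h | h
    · exact Prod.ext h.1 h.2
    · exact absurd hr'.2 (hdd (h.1 ▸ hq'.1))
  have hprod : ∀ a b, ∏ e ∈ F a b, (1 - p e) ≤
      Real.exp (-(l * (cs D1 a (x1 a) * cs D2 b (x2 b)))) := by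
    intro a b
    calc ∏ e ∈ F a b, (1 - p e) ≤ ∏ e ∈ F a b, Real.exp (-l) := by
          refine Finset.prod_le_prod (fun e _ => by linarith [(hp e).2]) fun e he => ?_
          obtain ⟨q, hq, rfl⟩ := Finset.mem_image.1 he
          have hq' := Finset.mem_product.1 (hclD a b hq)
          exact hl _ hq'.1 _ hq'.2
      _ = _ := by
          rw [Finset.prod_const, hFcard, ← Real.exp_nat_mul]; push_cast; ring_nf
  set h : Finset (Sym2 W) → Finset (Sym2 W) → ℝ := fun a b =>
    g (a ∩ s) (a ∩ t) * ind (Disjoint b (F (a ∩ s) (a ∩ t))) with hh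
  have hint1 : ∀ ω : Finset (Sym2 W), ω ∩ (s ∪ t) ∩ s = ω ∩ s := by
    intro ω; ext; simp only [Finset.mem_inter, Finset.mem_union]; tauto
  have hint2 : ∀ ω : Finset (Sym2 W), ω ∩ (s ∪ t) ∩ t = ω ∩ t := by
    intro ω; ext; simp only [Finset.mem_inter, Finset.mem_union]; tauto
  calc _ ≤ Ex p D.sym2 (fun ω => h (ω ∩ (s ∪ t)) (ω ∩ c)) := by
        refine Ex_mono hp fun ω _ => ?_
        simp only [hh, hint1, hint2]
        refine mul_le_mul_of_nonneg_left (ind_mono fun hn => ?_) (hg _ _)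
        rw [Finset.disjoint_left]
        intro e he he'
        obtain ⟨q, hq, rfl⟩ := Finset.mem_image.1 he'
        have hq' := Finset.mem_product.1 hq
        refine hn (((mem_cl.1 hq'.1).2.mono Finset.inter_subset_left).trans
          ((Cn.edge (Finset.mem_inter.1 he).1).trans
          ((mem_cl.1 hq'.2).2.mono Finset.inter_subset_left).symm))
    _ = Ex p (s ∪ t) (fun a => Ex p c (fun b => h a b)) :=
        Ex_prod_two hstc h (Finset.union_subset hsD htD) hcD
    _ ≤ Ex p (s ∪ t) (fun a => (fun a' b' => g a' b' *
          Real.exp (-(l * (cs D1 a' (x1 a') * cs D2 b' (x2 b'))))) (a ∩ s) (a ∩ t)) := by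
        refine Ex_mono hp fun a _ => ?_
        simp only [hh]
        rw [Ex_mul]
        refine mul_le_mul_of_nonneg_left ?_ (hg _ _)
        have := Pr_disj (p := p) (hFc (a ∩ s) (a ∩ t))
        unfold Pr at this
        simp only [disjoint_comm (a := F (a ∩ s) (a ∩ t))] at this
        rw [this]
        exact hprod _ _
    _ = _ := Ex_prod_two hst (fun a' b' => g a' b' *
          Real.exp (-(l * (cs D1 a' (x1 a') * cs D2 b' (x2 b'))))) Finset.subset_union_left Finset.subset_union_right

lemma join_lower (hp : PP p) {D D1 D2 : Finset W} (h1 : D1 ⊆ D) (h2 : D2 ⊆ D)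
    (hd : Disjoint D1 D2) {l : ℝ} (hl0 : 0 ≤ l)
    (hl : ∀ u ∈ D1, ∀ v ∈ D2, 1 - p s(u, v) ≤ Real.exp (-l)) (x y : W) (m : ℕ) :
    l / (1 + l * m ^ 2) * (Ex p D1.sym2 (fun ω => ((min (cs D1 ω x) m : ℕ) : ℝ)) *
      Ex p D2.sym2 (fun ω => ((min (cs D2 ω y) m : ℕ) : ℝ))) ≤ tau p D x y := by
  have h := JL hp h1 h2 hd hl (fun _ => x) (fun _ => y) (fun _ _ => 1) (fun _ _ => zero_le_one)
  simp only [one_mul] at h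
  have h' : 1 - tau p D x y ≤ Ex p D1.sym2 (fun ω => Ex p D2.sym2 (fun η =>
      Real.exp (-(l * (cs D1 ω x * cs D2 η y))))) := by
    refine le_trans (le_of_eq ?_) h
    have := Pr_not (p := p) (s := D.sym2) (fun ω => Cn ω x y)
    unfold tau
    rw [← this]; rfl
  have key : ∀ a b : ℕ, l / (1 + l * m ^ 2) * ((min a m : ℕ) * (min b m : ℕ) : ℝ) ≤
      1 - Real.exp (-(l * (a * b))) := by
    intro a b
    set a' := ((min a m : ℕ) : ℝ)
    set b' := ((min b m : ℕ) : ℝ)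
    have ha : a' ≤ a := by simp [a']
    have hb : b' ≤ b := by simp [b']
    have ha0 : 0 ≤ a' := by positivity
    have hb0 : 0 ≤ b' := by positivity
    have ha2 : a' ≤ m := by simp [a']
    have hb2 : b' ≤ m := by simp [b']
    have e1 : Real.exp (-(l * (a * b))) ≤ Real.exp (-(l * (a' * b'))) := by
      refine Real.exp_le_exp.2 (neg_le_neg (mul_le_mul_of_nonneg_left ?_ hl0))
      exact mul_le_mul ha hb hb0 (by positivity)
    set z := l * (a' * b') with hz
    have hz0 : 0 ≤ z := by positivity
    have e2 : Real.exp (-z) ≤ 1 / (1 + z) := by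
      rw [Real.exp_neg, ← one_div]
      exact one_div_le_one_div_of_le (by linarith) (by linarith [Real.add_one_le_exp z])
    have hzm : z ≤ l * m ^ 2 := by
      rw [sq]
      exact mul_le_mul_of_nonneg_left (mul_le_mul ha2 hb2 hb0 (by positivity)) hl0
    have e3 : z / (1 + l * m ^ 2) ≤ z / (1 + z) :=
      div_le_div_of_nonneg_left hz0 (by linarith) (by linarith)
    have e4 : z / (1 + z) = 1 - 1 / (1 + z) := by field_simp; ring
    have e5 : l / (1 + l * m ^ 2) * (a' * b') = z / (1 + l * m ^ 2) := by rw [hz]; ring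
    rw [e5]; linarith
  have h3 : l / (1 + l * m ^ 2) * (Ex p D1.sym2 (fun ω => ((min (cs D1 ω x) m : ℕ) : ℝ)) *
      Ex p D2.sym2 (fun ω => ((min (cs D2 ω y) m : ℕ) : ℝ))) ≤
      Ex p D1.sym2 (fun ω => Ex p D2.sym2 (fun η =>
      1 - Real.exp (-(l * (cs D1 ω x * cs D2 η y))))) := by
    rw [← Ex_mul_right, ← Ex_mul]
    refine Ex_mono hp fun ω _ => ?_
    rw [← mul_assoc, ← Ex_mul]
    refine Ex_mono hp fun η _ => ?_
    rw [mul_assoc]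
    exact key _ _
  simp only [Ex_sub, Ex_const] at h3
  linarith

/-- The equivalence of edges induced by an equivalence of vertices. -/
def s2e (e : W ≃ W) : Sym2 W ≃ Sym2 W where
  toFun := Sym2.map e
  invFun := Sym2.map e.symm
  left_inv q := by rw [Sym2.map_map]; simp
  right_inv q := by rw [Sym2.map_map]; simp

lemma Ex_sym2_map (e : W ≃ W) (he : ∀ q, p (Sym2.map e q) = p q) (D : Finset W)
    (f : Finset (Sym2 W) → ℝ) :
    Ex p (D.map e.toEmbedding).sym2 f =
      Ex p D.sym2 (fun ω => f (ω.map (s2e e).toEmbedding)) := by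
  have h1 : (D.map e.toEmbedding).sym2 = D.sym2.map (s2e e).toEmbedding := by
    rw [Finset.sym2_map]; rfl
  rw [h1, Ex_map]
  have : (fun i => p ((s2e e) i)) = p := by
    funext q; exact he q
  rw [this]

lemma Cn_map (e : W ≃ W) (ω : Finset (Sym2 W)) (x y : W) :
    Cn (ω.map (s2e e).toEmbedding) (e x) (e y) ↔ Cn ω x y := by
  have hm : ∀ a b, s(e a, e b) ∈ ω.map (s2e e).toEmbedding ↔ s(a, b) ∈ ω := by
    intro a b
    have : s(e a, e b) = (s2e e).toEmbedding s(a, b) := rfl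
    rw [this, Finset.mem_map']
  constructor
  · intro h
    have : ∀ z, Cn (ω.map (s2e e).toEmbedding) (e x) z → Cn ω x (e.symm z) := by
      intro z hz
      induction hz with
      | refl => simpa using Cn.refl ω x
      | @tail a b _ hab ih =>
        refine ih.trans (Cn.edge ?_)
        rw [← hm]; simpa using hab
    simpa using this _ h
  · intro h
    induction h with
    | refl => exact Cn.refl _ _
    | tail _ hab ih => exact ih.trans (Cn.edge ((hm _ _).2 hab))

lemma cs_map (e : W ≃ W) (D : Finset W) (ω : Finset (Sym2 W)) (x : W) :
    cs (D.map e.toEmbedding) (ω.map (s2e e).toEmbedding) (e x) = cs D ω x := by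
  unfold cs
  rw [← Finset.card_map (s := cl D ω x) e.toEmbedding]
  congr 1
  ext z
  simp only [mem_cl, Finset.mem_map]
  constructor
  · rintro ⟨⟨a, ha, rfl⟩, h⟩
    exact ⟨a, ⟨ha, (Cn_map e ω x a).1 h⟩, rfl⟩
  · rintro ⟨a, ⟨ha, h⟩, rfl⟩
    exact ⟨⟨a, ha, rfl⟩, (Cn_map e ω x a).2 h⟩

lemma tau_map (e : W ≃ W) (he : ∀ q, p (Sym2.map e q) = p q) (D : Finset W) (x y : W) :
    tau p (D.map e.toEmbedding) (e x) (e y) = tau p D x y := by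
  unfold tau Pr
  rw [Ex_sym2_map e he]
  exact Ex_congr fun ω _ => ind_congr (Cn_map e ω x y)

lemma Pr_big_map (e : W ≃ W) (he : ∀ q, p (Sym2.map e q) = p q) (D : Finset W) (k : ℕ) :
    Pr p (D.map e.toEmbedding).sym2 (fun ω => ∃ x, k ≤ cs (D.map e.toEmbedding) ω x) =
    Pr p D.sym2 (fun ω => ∃ x, k ≤ cs D ω x) := by
  unfold Pr
  rw [Ex_sym2_map e he]
  refine Ex_congr fun ω _ => ind_congr ?_
  dsimp only
  rw [e.surjective.exists]
  simp only [cs_map]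

end Graph2

section Lattice
variable {d : ℕ}

lemma normInf_le_iff {x : V d} {n : ℕ} : normInf x ≤ n ↔ ∀ i, (x i).natAbs ≤ n := by
  simp [normInf, Finset.sup_le_iff]

lemma natAbs_le_normInf (x : V d) (i : Fin d) : (x i).natAbs ≤ normInf x :=
  normInf_le_iff.1 le_rfl i

lemma normInf_neg (x : V d) : normInf (-x) = normInf x := by simp [normInf]

lemma normInf_comm (x y : V d) : normInf (x - y) = normInf (y - x) := by
  rw [← normInf_neg, neg_sub]

lemma normInf_add_le (x y : V d) : normInf (x + y) ≤ normInf x + normInf y := by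
  rw [normInf_le_iff]
  intro i
  have h1 := natAbs_le_normInf x i
  have h2 := natAbs_le_normInf y i
  have := Int.natAbs_add_le (x i) (y i)
  simp only [Pi.add_apply]; omega

lemma normInf_tri (x y z : V d) : normInf (x - z) ≤ normInf (x - y) + normInf (y - z) := by
  have := normInf_add_le (x - y) (y - z)
  rwa [sub_add_sub_cancel] at this

lemma normInf_zero : normInf (0 : V d) = 0 := by
  have : normInf (0 : V d) ≤ 0 := normInf_le_iff.2 (by simp)
  omega

lemma normInf_pos {x : V d} (h : x ≠ 0) : 1 ≤ normInf x := by
  by_contra hc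
  have : normInf x ≤ 0 := by omega
  rw [normInf_le_iff] at this
  exact h (funext fun i => by simpa using this i)

lemma normInf_sub_pos {x y : V d} (h : x ≠ y) : 1 ≤ normInf (x - y) :=
  normInf_pos (sub_ne_zero.2 h)

lemma ne_of_normInf {x y : V d} (h : 1 ≤ normInf (x - y)) : x ≠ y := by
  rintro rfl
  rw [sub_self, normInf_zero] at h; omega

/-- Closed ball. -/
noncomputable def ball (x : V d) (n : ℕ) : Finset (V d) :=
  Fintype.piFinset fun i => Finset.Icc (x i - n) (x i + n)

lemma mem_ball {x y : V d} {n : ℕ} : y ∈ ball x n ↔ normInf (y - x) ≤ n := by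
  rw [normInf_le_iff, ball, Fintype.mem_piFinset]
  refine forall_congr' fun i => ?_
  simp only [Finset.mem_Icc, Pi.sub_apply]; omega

lemma self_mem_ball (x : V d) (n : ℕ) : x ∈ ball x n := by
  rw [mem_ball, sub_self, normInf_zero]; omega

lemma ball_subset {x y : V d} {m n : ℕ} (h : normInf (x - y) + m ≤ n) : ball x m ⊆ ball y n := by
  intro z hz
  rw [mem_ball] at *
  have := normInf_tri z x y
  omega

lemma ball_mono (x : V d) {m n : ℕ} (h : m ≤ n) : ball x m ⊆ ball x n :=
  ball_subset (by rw [sub_self, normInf_zero]; omega)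

lemma exists_ball (D : Finset (V d)) (x : V d) : ∃ n, D ⊆ ball x n :=
  ⟨D.sup fun y => normInf (y - x), fun y hy => mem_ball.2
    (Finset.le_sup (f := fun y => normInf (y - x)) hy)⟩

/-- Half-open box. -/
noncomputable def Q (v : V d) (N : ℕ) : Finset (V d) :=
  Fintype.piFinset fun i => Finset.Ico (v i) (v i + N)

lemma mem_Q {v y : V d} {N : ℕ} : y ∈ Q v N ↔ ∀ i, v i ≤ y i ∧ y i < v i + N := by
  simp [Q, Fintype.mem_piFinset]

lemma card_Q (v : V d) (N : ℕ) : (Q v N).card = N ^ d := by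
  simp [Q, Fintype.card_piFinset]

lemma ball_eq_Q (x : V d) (n : ℕ) : ball x n = Q (fun i => x i - n) (2 * n + 1) := by
  ext y
  rw [mem_Q, ball, Fintype.mem_piFinset]
  refine forall_congr' fun i => ?_
  simp only [Finset.mem_Icc]; push_cast; omega

lemma card_ball (x : V d) (n : ℕ) : (ball x n).card = (2 * n + 1) ^ d := by
  rw [ball_eq_Q, card_Q]

lemma Q_dist {v x y : V d} {N : ℕ} (hx : x ∈ Q v N) (hy : y ∈ Q v N) : normInf (x - y) ≤ N := by
  rw [normInf_le_iff]
  intro i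
  have h1 := mem_Q.1 hx i
  have h2 := mem_Q.1 hy i
  simp only [Pi.sub_apply]; omega

lemma Q_map (v z : V d) (N : ℕ) : (Q v N).map (Equiv.addRight z).toEmbedding = Q (v + z) N := by
  ext y
  rw [Finset.mem_map_equiv, mem_Q, mem_Q]
  refine forall_congr' fun i => ?_
  simp only [Equiv.addRight_symm, Equiv.coe_addRight, Pi.add_apply, Pi.neg_apply]
  omega

lemma ball_map (x z : V d) (n : ℕ) :
    (ball x n).map (Equiv.addRight z).toEmbedding = ball (x + z) n := by
  rw [ball_eq_Q, ball_eq_Q, Q_map]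
  congr 1
  funext i
  simp only [Pi.add_apply]; ring

lemma card_sphere_le {d : ℕ} (hd : 1 ≤ d) {j : ℕ} (hj : 1 ≤ j) (s : Finset (V d))
    (hs : ∀ w ∈ s, normInf w = j) : (s.card : ℝ) ≤ 2 * d * 3 ^ (d - 1) * (j : ℝ) ^ (d - 1) := by
  obtain ⟨i, rfl⟩ : ∃ i, j = i + 1 := ⟨j - 1, by omega⟩
  have h1 : s ⊆ ball 0 (i + 1) \ ball 0 i := by
    intro w hw
    rw [Finset.mem_sdiff, mem_ball, mem_ball, sub_zero, hs w hw]; omega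
  have h2 := Finset.card_le_card h1
  rw [Finset.card_sdiff_of_subset (ball_mono 0 (by omega)), card_ball, card_ball] at h2
  have h3 : ((s.card : ℕ) : ℝ) ≤ (2 * (i + 1) + 1 : ℝ) ^ d - (2 * i + 1 : ℝ) ^ d := by
    have h4 : (2 * i + 1) ^ d ≤ (2 * (i + 1) + 1) ^ d := Nat.pow_le_pow_left (by omega) d
    have h5 : (s.card : ℝ) ≤ (((2 * (i + 1) + 1) ^ d - (2 * i + 1) ^ d : ℕ) : ℝ) := by
      exact_mod_cast h2
    rw [Nat.cast_sub h4] at h5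
    push_cast at h5; exact h5
  have h6 : (2 * (i + 1) + 1 : ℝ) ^ d - (2 * i + 1 : ℝ) ^ d ≤
      2 * d * (2 * (i + 1) + 1 : ℝ) ^ (d - 1) := by
    have hab : ∀ (x y : ℝ), 0 ≤ y → y ≤ x → x ^ d - y ^ d ≤ (x - y) * (d * x ^ (d - 1)) := by
      intro x y hy hyx
      rw [← (Commute.all x y).mul_geom_sum₂ d]
      refine mul_le_mul_of_nonneg_left ?_ (by linarith)
      calc ∑ k ∈ Finset.range d, x ^ k * y ^ (d - 1 - k) ≤ ∑ k ∈ Finset.range d, x ^ (d - 1) := by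
            refine Finset.sum_le_sum fun k hk => ?_
            have hk' : k ≤ d - 1 := by have := Finset.mem_range.1 hk; omega
            calc x ^ k * y ^ (d - 1 - k) ≤ x ^ k * x ^ (d - 1 - k) :=
                  mul_le_mul_of_nonneg_left (pow_le_pow_left₀ hy hyx _)
                    (pow_nonneg (hy.trans hyx) _)
              _ = x ^ (d - 1) := by rw [← pow_add]; congr 1; omega
        _ = _ := by simp
    have := hab (2 * (i + 1) + 1) (2 * i + 1) (by positivity) (by linarith)
    calc _ ≤ _ := this
      _ = _ := by ring
  refine h3.trans (h6.trans ?_)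
  rw [mul_assoc (2 * (d:ℝ)), ← mul_pow]
  refine mul_le_mul_of_nonneg_left (pow_le_pow_left₀ (by positivity) ?_ _) (by positivity)
  push_cast
  have : (0:ℝ) ≤ i := by positivity
  linarith

lemma shell_sum {d : ℕ} (hd : 1 ≤ d) {m n : ℕ} (hm : 1 ≤ m) (f : ℕ → ℝ) (hf : ∀ j, 0 ≤ f j)
    (s : Finset (V d)) (hs : ∀ w ∈ s, m ≤ normInf w ∧ normInf w ≤ n) :
    ∑ w ∈ s, f (normInf w) ≤
      2 * d * 3 ^ (d - 1) * ∑ j ∈ Finset.Icc m n, (j : ℝ) ^ (d - 1) * f j := by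
  rw [← Finset.sum_fiberwise_of_maps_to (t := Finset.Icc m n) (g := fun w => normInf w)
    (fun w hw => Finset.mem_Icc.2 (hs w hw)), Finset.mul_sum]
  refine Finset.sum_le_sum fun j hj => ?_
  rw [Finset.sum_congr rfl (g := fun _ => f j)
    (fun w hw => by rw [(Finset.mem_filter.1 hw).2]), Finset.sum_const, nsmul_eq_mul, ← mul_assoc]
  refine mul_le_mul_of_nonneg_right ?_ (hf j)
  exact card_sphere_le hd (hm.trans (Finset.mem_Icc.1 hj).1) _ fun w hw => (Finset.mem_filter.1 hw).2

lemma bern_up {s : ℝ} (hs0 : 0 < s) (hs1 : s ≤ 1) {j : ℕ} (hj : 1 ≤ j) :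
    ((j - 1 : ℕ) : ℝ) ^ s ≤ (j : ℝ) ^ s * (1 - s / j) := by
  have hj0 : (0:ℝ) < j := by exact_mod_cast hj
  have hj1 : (1:ℝ) ≤ j := by exact_mod_cast hj
  have h1 : ((j - 1 : ℕ) : ℝ) = j * (1 + -(1 / j)) := by
    rw [Nat.cast_sub hj]; field_simp; push_cast; ring
  have h2 : (1:ℝ) / j ≤ 1 := by rw [div_le_one hj0]; exact hj1
  rw [h1, Real.mul_rpow hj0.le (by linarith)]
  refine mul_le_mul_of_nonneg_left ?_ (by positivity)
  have := rpow_one_add_le_one_add_mul_self (s := -(1 / (j:ℝ))) (by linarith) hs0.le hs1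
  calc _ ≤ _ := this
    _ = _ := by ring

lemma sum_up {s : ℝ} (hs0 : 0 < s) (hs1 : s ≤ 1) (n : ℕ) :
    ∑ j ∈ Finset.Icc 1 n, (j : ℝ) ^ (s - 1) ≤ (n : ℝ) ^ s / s := by
  induction n with
  | zero => simp [Real.zero_rpow hs0.ne']
  | succ n ih =>
    rw [Finset.sum_Icc_succ_top (by omega)]
    have h := bern_up hs0 hs1 (j := n + 1) (by omega)
    have hn : (0:ℝ) < ((n+1 : ℕ) : ℝ) := by positivity
    have e : ((n + 1 : ℕ) : ℝ) ^ (s - 1) = ((n + 1 : ℕ) : ℝ) ^ s / ((n+1 : ℕ) : ℝ) := by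
      rw [Real.rpow_sub hn, Real.rpow_one]
    rw [e]
    simp only [Nat.add_sub_cancel] at h
    calc _ ≤ ((n + 1 : ℕ) : ℝ) ^ s * (1 - s / ((n + 1 : ℕ) : ℝ)) / s +
          ((n + 1 : ℕ) : ℝ) ^ s / ((n+1 : ℕ) : ℝ) := by
          refine add_le_add_left (ih.trans ?_) _
          exact div_le_div_of_nonneg_right h hs0.le
      _ = _ := by field_simp; ring

lemma sum_down {a : ℝ} (ha0 : 0 < a) (ha1 : a ≤ 1) {m : ℕ} (hm : 1 ≤ m) (n : ℕ) (hmn : m ≤ n) :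
    ∑ j ∈ Finset.Icc m n, (j : ℝ) ^ (-1 - a) ≤
      (1 + 1 / a) * (m : ℝ) ^ (-a) - (n : ℝ) ^ (-a) / a := by
  induction n, hmn using Nat.le_induction with
  | base =>
    have hm1 : (1:ℝ) ≤ m := by exact_mod_cast hm
    simp only [Finset.Icc_self, Finset.sum_singleton]
    have : (m:ℝ) ^ (-1 - a) ≤ (m:ℝ) ^ (-a) := Real.rpow_le_rpow_of_exponent_le hm1 (by linarith)
    calc _ ≤ _ := this
      _ = _ := by ring
  | succ n hn ih =>
    rw [Finset.sum_Icc_succ_top (by omega)]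
    have hn1 : 1 ≤ n := hm.trans hn
    have hn0 : (0:ℝ) < n := by exact_mod_cast hn1
    have h := bern_up ha0 ha1 (j := n + 1) (by omega)
    simp only [Nat.add_sub_cancel] at h
    set x : ℝ := ((n + 1 : ℕ) : ℝ) with hx
    have hx0 : 0 < x := by positivity
    have hx1 : 1 < x := by rw [hx]; push_cast; linarith
    have hax : a / x < 1 := by rw [div_lt_one hx0]; linarith
    have e : x ^ (-1 - a) = x ^ (-a) / x := by
      rw [show -1 - a = -a - 1 by ring, Real.rpow_sub hx0, Real.rpow_one]
    have h2 : x ^ (-a) * (1 + a / x) ≤ (n:ℝ) ^ (-a) := by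
      rw [Real.rpow_neg hx0.le, Real.rpow_neg hn0.le]
      have hn' : 0 < (n:ℝ) ^ a := by positivity
      have hx' : 0 < x ^ a := by positivity
      rw [← div_eq_inv_mul, div_le_iff₀ hx', ← div_eq_inv_mul, le_div_iff₀ hn']
      have : (1 + a / x) * (n:ℝ) ^ a ≤ (1 + a / x) * (x ^ a * (1 - a / x)) :=
        mul_le_mul_of_nonneg_left h (by positivity)
      nlinarith [sq_nonneg (a / x)]
    have h3 : x ^ (-a) / x ≤ (n:ℝ) ^ (-a) / a - x ^ (-a) / a := by
      rw [← sub_div, le_div_iff₀ ha0]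
      calc x ^ (-a) / x * a = x ^ (-a) * (1 + a / x) - x ^ (-a) := by ring
        _ ≤ _ := by linarith
    rw [e]
    linarith

/-- dimension constant -/
noncomputable def Kd (d : ℕ) (s : ℝ) : ℝ := 2 * d * 3 ^ (d - 1) * (1 + 1 / s)

lemma Kd_pos {d : ℕ} (hd : 1 ≤ d) {s : ℝ} (hs : 0 < s) : 0 < Kd d s := by
  have : (0:ℝ) < d := by exact_mod_cast hd
  unfold Kd; positivity

lemma K1 {d : ℕ} (hd : 1 ≤ d) {s : ℝ} (hs0 : 0 < s) (hs1 : s ≤ 1) {t : ℝ} (ht : 0 ≤ t)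
    (A : Finset (V d)) (hA : ∀ w ∈ A, w ≠ 0 ∧ (normInf w : ℝ) ≤ t) :
    ∑ w ∈ A, (normInf w : ℝ) ^ (-(d:ℝ) + s) ≤ Kd d s * t ^ s := by
  have h := shell_sum hd le_rfl (fun j => (j:ℝ) ^ (-(d:ℝ) + s)) (fun j => by positivity) A
    (n := ⌊t⌋₊) (fun w hw => ⟨normInf_pos (hA w hw).1, Nat.le_floor (hA w hw).2⟩)
  refine h.trans ?_
  rw [Kd, mul_assoc (2 * (d:ℝ) * 3 ^ (d-1))]
  refine mul_le_mul_of_nonneg_left ?_ (by positivity)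
  calc _ = ∑ j ∈ Finset.Icc 1 ⌊t⌋₊, (j : ℝ) ^ (s - 1) := by
        refine Finset.sum_congr rfl fun j hj => ?_
        have hj : (0:ℝ) < j := by exact_mod_cast (Finset.mem_Icc.1 hj).1
        rw [← Real.rpow_natCast, ← Real.rpow_add hj, Nat.cast_sub hd]
        congr 1; push_cast; ring
    _ ≤ _ := sum_up hs0 hs1 _
    _ ≤ t ^ s / s := by
        refine div_le_div_of_nonneg_right ?_ hs0.le
        exact Real.rpow_le_rpow (by positivity) (Nat.floor_le ht) hs0.le
    _ ≤ _ := by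
        have : 0 ≤ t ^ s := by positivity
        rw [add_mul, one_mul, one_div, div_eq_inv_mul]
        linarith

lemma K2 {d : ℕ} (hd : 1 ≤ d) {a : ℝ} (ha0 : 0 < a) (ha1 : a ≤ 1) {m : ℕ} (hm : 1 ≤ m)
    (A : Finset (V d)) (hA : ∀ w ∈ A, m ≤ normInf w) :
    ∑ w ∈ A, (normInf w : ℝ) ^ (-(d:ℝ) - a) ≤ Kd d a * (m : ℝ) ^ (-a) := by
  obtain ⟨n, hn⟩ := exists_ball A 0
  have hn' : ∀ w ∈ A, normInf w ≤ max m n := fun w hw => by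
    have := mem_ball.1 (hn hw); rw [sub_zero] at this; exact this.trans (le_max_right _ _)
  have h := shell_sum hd hm (fun j => (j:ℝ) ^ (-(d:ℝ) - a)) (fun j => by positivity) A
    (n := max m n) (fun w hw => ⟨hA w hw, hn' w hw⟩)
  refine h.trans ?_
  rw [Kd, mul_assoc (2 * (d:ℝ) * 3 ^ (d-1))]
  refine mul_le_mul_of_nonneg_left ?_ (by positivity)
  calc _ = ∑ j ∈ Finset.Icc m (max m n), (j : ℝ) ^ (-1 - a) := by
        refine Finset.sum_congr rfl fun j hj => ?_
        have hj : (0:ℝ) < j := by exact_mod_cast hm.trans (Finset.mem_Icc.1 hj).1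
        rw [← Real.rpow_natCast, ← Real.rpow_add hj, Nat.cast_sub hd]
        congr 1; push_cast; ring
    _ ≤ _ := sum_down ha0 ha1 hm _ (le_max_left _ _)
    _ ≤ _ := by
        have : 0 ≤ ((max m n : ℕ) : ℝ) ^ (-a) / a := by positivity
        linarith

end Lattice

section ChiL
variable {W : Type*} [DecidableEq W] {p : Sym2 W → ℝ}

lemma chi_exit (hp : PP p) {D S : Finset W} {x : W} (hx : x ∈ D) (hxS : x ∈ S) {q : ℝ}
    (hφ : ∑ u ∈ D ∩ S, ∑ v ∈ D \ S, tau p (D ∩ S) x u * p s(u, v) ≤ q) {G : ℝ} (hG0 : 0 ≤ G)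
    (hG : ∀ v ∈ D, ∑ y ∈ D, tau p D v y ≤ G) :
    ∑ y ∈ D \ S, tau p D x y ≤ q * G := by
  calc ∑ y ∈ D \ S, tau p D x y ≤ ∑ y ∈ D \ S, (0 +
      ∑ u ∈ D ∩ S, ∑ v ∈ D \ S, tau p (D ∩ S) x u * p s(u, v) * tau p D v y) := by
        refine Finset.sum_le_sum fun y hy => ?_
        have h := exit_ineq hp y hx hxS
        rwa [tau_out (D := D ∩ S) (Finset.mem_inter.2 ⟨hx, hxS⟩) (fun h =>
          (Finset.mem_sdiff.1 hy).2 (Finset.mem_inter.1 h).2)] at h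
    _ = ∑ u ∈ D ∩ S, ∑ v ∈ D \ S, tau p (D ∩ S) x u * p s(u, v) * ∑ y ∈ D \ S, tau p D v y := by
        simp only [zero_add, Finset.mul_sum]
        rw [Finset.sum_comm]
        refine Finset.sum_congr rfl fun u _ => Finset.sum_comm
    _ ≤ ∑ u ∈ D ∩ S, ∑ v ∈ D \ S, tau p (D ∩ S) x u * p s(u, v) * G := by
        refine Finset.sum_le_sum fun u _ => Finset.sum_le_sum fun v hv => ?_
        refine mul_le_mul_of_nonneg_left ?_ (mul_nonneg (tau_nonneg hp _ _ _) (hp _).1)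
        refine le_trans ?_ (hG v (Finset.mem_sdiff.1 hv).1)
        exact Finset.sum_le_sum_of_subset_of_nonneg Finset.sdiff_subset
          fun _ _ _ => tau_nonneg hp _ _ _
    _ = (∑ u ∈ D ∩ S, ∑ v ∈ D \ S, tau p (D ∩ S) x u * p s(u, v)) * G := by
        simp only [Finset.sum_mul]
    _ ≤ _ := mul_le_mul_of_nonneg_right hφ hG0

lemma chi_bound (hp : PP p) {D : Finset W} (S : W → Finset W) (hS : ∀ x, x ∈ S x) {M : ℕ}
    (hM : ∀ x, (S x).card ≤ M)
    (hφ : ∀ x ∈ D, ∑ u ∈ D ∩ S x, ∑ v ∈ D \ S x, tau p (D ∩ S x) x u * p s(u, v) ≤ 1 / 2) :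
    ∀ x ∈ D, ∑ y ∈ D, tau p D x y ≤ 2 * M := by
  intro x hx
  obtain ⟨z, hz, hmax⟩ := Finset.exists_max_image D (fun v => ∑ y ∈ D, tau p D v y) ⟨x, hx⟩
  set G := ∑ y ∈ D, tau p D z y with hG
  have hG0 : 0 ≤ G := Finset.sum_nonneg fun _ _ => tau_nonneg hp _ _ _
  have h1 := chi_exit hp hz (hS z) (hφ z hz) hG0 hmax
  have h2 : ∑ y ∈ D ∩ S z, tau p D z y ≤ M := by
    calc ∑ y ∈ D ∩ S z, tau p D z y ≤ ∑ y ∈ D ∩ S z, 1 :=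
          Finset.sum_le_sum fun y _ => tau_le_one hp _ _ _
      _ = ((D ∩ S z).card : ℝ) := by simp
      _ ≤ M := by exact_mod_cast (Finset.card_le_card Finset.inter_subset_right).trans (hM z)
  have h3 : G = ∑ y ∈ D ∩ S z, tau p D z y + ∑ y ∈ D \ S z, tau p D z y := by
    rw [hG, ← Finset.sum_inter_add_sum_sdiff D (S z)]
  have := hmax x hx
  linarith

end ChiL

/-- Abstract hypotheses on edge probabilities. -/
structure Hyp (d : ℕ) (α a b : ℝ) (p : Sym2 (V d) → ℝ) : Prop where
  hd : 1 ≤ d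
  h0 : 0 < α
  h1 : α < 1
  had : α < d
  ha : 0 < a
  hb : 0 < b
  pp : PP p
  inv : ∀ z q, p (Sym2.map (Equiv.addRight z) q) = p q
  lo : ∀ u v, u ≠ v → 1 - p s(u, v) ≤ Real.exp (-(a * (normInf (u - v) : ℝ) ^ (-(d:ℝ) - α)))
  hi : ∀ u v, u ≠ v → p s(u, v) ≤ b * (normInf (u - v) : ℝ) ^ (-(d:ℝ) - α)

section HypS
variable {d : ℕ} {α a b : ℝ} {p : Sym2 (V d) → ℝ}

lemma tau_trans (H : Hyp d α a b p) (D : Finset (V d)) (x y z : V d) :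
    tau p (D.map (Equiv.addRight z).toEmbedding) (x + z) (y + z) = tau p D x y :=
  tau_map (Equiv.addRight z) (H.inv z) D x y

lemma Pr_Q (H : Hyp d α a b p) (v : V d) (N k : ℕ) :
    Pr p (Q v N).sym2 (fun ω => ∃ x, k ≤ cs (Q v N) ω x) =
    Pr p (Q 0 N).sym2 (fun ω => ∃ x, k ≤ cs (Q (0 : V d) N) ω x) := by
  have := Pr_big_map (Equiv.addRight v) (H.inv v) (Q 0 N) k
  rw [Q_map, zero_add] at this
  exact this

end HypS

/-- Averaged exit kernel. -/
noncomputable def kap {d : ℕ} (p : Sym2 (V d) → ℝ) (x : V d) (n : ℕ) (u v : V d) : ℝ :=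
  p s(u, v) * (((Finset.Ico n (2 * n)).filter
    (fun j => normInf (u - x) ≤ j ∧ j < normInf (v - x))).card / n)

section HypS2
variable {d : ℕ} {α a b : ℝ} {p : Sym2 (V d) → ℝ}

lemma kap_nonneg (hp : PP p) (x : V d) (n : ℕ) (u v : V d) : 0 ≤ kap p x n u v :=
  mul_nonneg (hp _).1 (by positivity)

lemma kap_zero (x : V d) (n : ℕ) {u v : V d} (h : normInf (v - x) ≤ n ∨ u = v) :
    kap p x n u v = 0 := by
  unfold kap
  rw [Finset.filter_false_of_mem]
  · simp
  · intro j hj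
    have := Finset.mem_Ico.1 hj
    rcases h with h | rfl <;> omega

lemma kap_le1 (hp : PP p) (x : V d) {n : ℕ} (hn : 1 ≤ n) (u v : V d) :
    kap p x n u v ≤ p s(u, v) := by
  unfold kap
  refine mul_le_of_le_one_right (hp _).1 ?_
  rw [div_le_one (by exact_mod_cast hn)]
  have := Finset.card_filter_le (Finset.Ico n (2 * n))
    (fun j => normInf (u - x) ≤ j ∧ j < normInf (v - x))
  rw [Nat.card_Ico] at this
  exact_mod_cast (by omega)

lemma kap_le2 (hp : PP p) (x : V d) (n : ℕ) (u v : V d) :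
    kap p x n u v ≤ p s(u, v) * (normInf (u - v) / n) := by
  unfold kap
  refine mul_le_mul_of_nonneg_left ?_ (hp _).1
  refine div_le_div_of_nonneg_right ?_ (by positivity)
  have h1 : (Finset.Ico n (2 * n)).filter
    (fun j => normInf (u - x) ≤ j ∧ j < normInf (v - x)) ⊆
      Finset.Ico (normInf (u - x)) (normInf (v - x)) := by
    intro j hj
    exact Finset.mem_Ico.2 (Finset.mem_filter.1 hj).2
  have h2 := Finset.card_le_card h1
  rw [Nat.card_Ico] at h2
  have h3 := normInf_tri v u x
  rw [normInf_comm v u] at h3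
  exact_mod_cast (by omega)

lemma avg_exit (hp : PP p) {D : Finset (V d)} {x : V d} (y : V d) (hx : x ∈ D) {n : ℕ}
    (hn : 1 ≤ n) :
    tau p D x y ≤ tau p (D ∩ ball x (2 * n)) x y +
      ∑ u ∈ D ∩ ball x (2 * n), ∑ v ∈ D,
        tau p (D ∩ ball x (2 * n)) x u * kap p x n u v * tau p D v y := by
  classical
  set D' := D ∩ ball x (2 * n) with hD'
  have hn0 : (0:ℝ) < n := by exact_mod_cast hn
  have hj : ∀ j ∈ Finset.Ico n (2 * n), tau p D x y ≤ tau p D' x y +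
      ∑ u ∈ D', ∑ v ∈ D, tau p D' x u * p s(u, v) * tau p D v y *
        (if normInf (u - x) ≤ j ∧ j < normInf (v - x) then 1 else 0) := by
    intro j hj
    have hj' := Finset.mem_Ico.1 hj
    have hsub : D ∩ ball x j ⊆ D' :=
      Finset.inter_subset_inter_left (ball_mono x (by omega))
    refine (exit_ineq hp y hx (self_mem_ball x j)).trans (add_le_add (tau_mono hp hsub _ _) ?_)
    calc _ ≤ ∑ u ∈ D ∩ ball x j, ∑ v ∈ D \ ball x j, tau p D' x u * p s(u, v) * tau p D v y *
        (if normInf (u - x) ≤ j ∧ j < normInf (v - x) then 1 else 0) := by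
          refine Finset.sum_le_sum fun u hu => Finset.sum_le_sum fun v hv => ?_
          have hu' := mem_ball.1 (Finset.mem_inter.1 hu).2
          have hv' : j < normInf (v - x) := by
            have := (Finset.mem_sdiff.1 hv).2
            rw [mem_ball] at this; omega
          rw [if_pos ⟨hu', hv'⟩, mul_one]
          refine mul_le_mul_of_nonneg_right ?_ (tau_nonneg hp _ _ _)
          exact mul_le_mul_of_nonneg_right (tau_mono hp hsub _ _) (hp _).1
      _ ≤ _ := by
          have hnn : ∀ u v, 0 ≤ tau p D' x u * p s(u, v) * tau p D v y *
            (if normInf (u - x) ≤ j ∧ j < normInf (v - x) then 1 else 0) := fun u v =>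
            mul_nonneg (mul_nonneg (mul_nonneg (tau_nonneg hp _ _ _) (hp _).1)
              (tau_nonneg hp _ _ _)) (by split_ifs <;> norm_num)
          refine (Finset.sum_le_sum fun u _ => Finset.sum_le_sum_of_subset_of_nonneg
            Finset.sdiff_subset fun v _ _ => hnn u v).trans ?_
          exact Finset.sum_le_sum_of_subset_of_nonneg hsub
            fun u _ _ => Finset.sum_nonneg fun v _ => hnn u v
  have hs := Finset.sum_le_sum hj
  rw [Finset.sum_const, Finset.sum_add_distrib, Finset.sum_const, Nat.card_Ico] at hs
  have e1 : 2 * n - n = n := by omega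
  rw [e1, nsmul_eq_mul, nsmul_eq_mul] at hs
  have e2 : ∑ j ∈ Finset.Ico n (2 * n), ∑ u ∈ D', ∑ v ∈ D,
      tau p D' x u * p s(u, v) * tau p D v y *
        (if normInf (u - x) ≤ j ∧ j < normInf (v - x) then (1:ℝ) else 0) =
      n * ∑ u ∈ D', ∑ v ∈ D, tau p D' x u * kap p x n u v * tau p D v y := by
    rw [Finset.sum_comm, Finset.mul_sum]
    refine Finset.sum_congr rfl fun u _ => ?_
    rw [Finset.sum_comm, Finset.mul_sum]
    refine Finset.sum_congr rfl fun v _ => ?_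
    rw [← Finset.mul_sum, Finset.sum_boole, kap]
    field_simp
  rw [e2, ← mul_add] at hs
  exact le_of_mul_le_mul_left hs hn0


lemma kap_le1' (H : Hyp d α a b p) (x : V d) {n : ℕ} (hn : 1 ≤ n) (u v : V d) :
    kap p x n u v ≤ b * (normInf (u - v) : ℝ) ^ (-(d:ℝ) - α) := by
  by_cases h : u = v
  · rw [kap_zero x n (Or.inr h)]
    have := H.hb; positivity
  · exact (kap_le1 H.pp x hn u v).trans (H.hi u v h)

lemma kap_le2' (H : Hyp d α a b p) (x : V d) (n : ℕ) {u v : V d} (h : u ≠ v) :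
    kap p x n u v ≤ b / n * (normInf (u - v) : ℝ) ^ (-(d:ℝ) + (1 - α)) := by
  refine (kap_le2 H.pp x n u v).trans ?_
  have hpos : (0:ℝ) < normInf (u - v) := by exact_mod_cast normInf_sub_pos h
  calc p s(u, v) * (normInf (u - v) / n) ≤
        b * (normInf (u - v) : ℝ) ^ (-(d:ℝ) - α) * (normInf (u - v) / n) :=
        mul_le_mul_of_nonneg_right (H.hi u v h) (by positivity)
    _ = b / n * ((normInf (u - v) : ℝ) ^ (-(d:ℝ) - α) * (normInf (u - v) : ℝ) ^ (1:ℝ)) := by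
        rw [Real.rpow_one]; ring
    _ = _ := by rw [← Real.rpow_add hpos]; congr 2; ring

lemma sum_diff_le (H : Hyp d α a b p) {A : Finset (V d)} (v : V d) (f : ℕ → ℝ) :
    ∑ u ∈ A, f (normInf (u - v)) =
      ∑ w ∈ A.map (Equiv.addRight (-v)).toEmbedding, f (normInf w) := by
  rw [Finset.sum_map]
  refine Finset.sum_congr rfl fun u _ => ?_
  simp [sub_eq_add_neg]

lemma kapsum2 (H : Hyp d α a b p) (x v : V d) {n : ℕ} {t : ℝ} (ht : 0 ≤ t) (A : Finset (V d))
    (hA : ∀ u ∈ A, (normInf (u - v) : ℝ) ≤ t) :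
    ∑ u ∈ A, kap p x n u v ≤ b * Kd d (1 - α) * t ^ (1 - α) / n := by
  classical
  have h1 := H.h1
  have h0 := H.h0
  calc ∑ u ∈ A, kap p x n u v = ∑ u ∈ A.erase v, kap p x n u v := by
        rw [Finset.sum_erase]
        exact kap_zero x n (Or.inr rfl)
    _ ≤ ∑ u ∈ A.erase v, b / n * (normInf (u - v) : ℝ) ^ (-(d:ℝ) + (1 - α)) :=
        Finset.sum_le_sum fun u hu => kap_le2' H x n (Finset.ne_of_mem_erase hu)
    _ = b / n * ∑ u ∈ A.erase v, (normInf (u - v) : ℝ) ^ (-(d:ℝ) + (1 - α)) := by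
        rw [Finset.mul_sum]
    _ ≤ b / n * (Kd d (1 - α) * t ^ (1 - α)) := by
        refine mul_le_mul_of_nonneg_left ?_ (by have := H.hb; positivity)
        rw [sum_diff_le H v (fun k => (k:ℝ) ^ (-(d:ℝ) + (1 - α)))]
        refine K1 H.hd (by linarith) (by linarith) ht _ fun w hw => ?_
        obtain ⟨u, hu, rfl⟩ := Finset.mem_map.1 hw
        have hu' := Finset.mem_erase.1 hu
        simp only [Equiv.coe_toEmbedding, Equiv.coe_addRight, ← sub_eq_add_neg]
        exact ⟨sub_ne_zero.2 hu'.1, hA u hu'.2⟩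
    _ = _ := by ring

lemma psum (H : Hyp d α a b p) (u : V d) {m : ℕ} (hm : 1 ≤ m) (A : Finset (V d))
    (hA : ∀ v ∈ A, m ≤ normInf (u - v)) :
    ∑ v ∈ A, p s(u, v) ≤ b * Kd d α * (m:ℝ) ^ (-α) := by
  calc ∑ v ∈ A, p s(u, v) ≤ ∑ v ∈ A, b * (normInf (v - u) : ℝ) ^ (-(d:ℝ) - α) := by
        refine Finset.sum_le_sum fun v hv => ?_
        rw [normInf_comm]
        exact H.hi u v (ne_of_normInf (hm.trans (hA v hv)))
    _ = b * ∑ v ∈ A, (normInf (v - u) : ℝ) ^ (-(d:ℝ) - α) := by rw [Finset.mul_sum]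
    _ ≤ b * (Kd d α * (m:ℝ) ^ (-α)) := by
        refine mul_le_mul_of_nonneg_left ?_ H.hb.le
        rw [sum_diff_le H u (fun k => (k:ℝ) ^ (-(d:ℝ) - α))]
        refine K2 H.hd H.h0 H.h1.le hm _ fun w hw => ?_
        obtain ⟨v, hv, rfl⟩ := Finset.mem_map.1 hw
        simp only [Equiv.coe_toEmbedding, Equiv.coe_addRight, ← sub_eq_add_neg]
        rw [normInf_comm]; exact hA v hv
    _ = _ := by ring

lemma kap_symm_aux (H : Hyp d α a b p) (x : V d) (n : ℕ) {u v : V d} (h : u ≠ v) :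
    kap p x n u v ≤ b / n * (normInf (v - u) : ℝ) ^ (-(d:ℝ) + (1 - α)) := by
  rw [normInf_comm]; exact kap_le2' H x n h

lemma kapsum1 (H : Hyp d α a b p) (x u : V d) {n : ℕ} (hn : 1 ≤ n) (A : Finset (V d)) :
    ∑ v ∈ A, kap p x n u v ≤ b * (Kd d (1 - α) + Kd d α) * (n:ℝ) ^ (-α) := by
  classical
  have hn0 : (0:ℝ) < n := by exact_mod_cast hn
  have h1 := H.h1
  have h0 := H.h0
  rw [← Finset.sum_filter_add_sum_filter_not A (fun v => normInf (u - v) ≤ n)]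
  have e1 : ∑ v ∈ A with normInf (u - v) ≤ n, kap p x n u v ≤
      b * Kd d (1 - α) * (n:ℝ) ^ (-α) := by
    set B := A.filter (fun v => normInf (u - v) ≤ n)
    calc ∑ v ∈ B, kap p x n u v = ∑ v ∈ B.erase u, kap p x n u v := by
          rw [Finset.sum_erase]
          exact kap_zero x n (Or.inr rfl)
      _ ≤ ∑ v ∈ B.erase u, b / n * (normInf (v - u) : ℝ) ^ (-(d:ℝ) + (1 - α)) :=
          Finset.sum_le_sum fun v hv => kap_symm_aux H x n (Finset.ne_of_mem_erase hv).symm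
      _ = b / n * ∑ v ∈ B.erase u, (normInf (v - u) : ℝ) ^ (-(d:ℝ) + (1 - α)) := by
          rw [Finset.mul_sum]
      _ ≤ b / n * (Kd d (1 - α) * (n:ℝ) ^ (1 - α)) := by
          refine mul_le_mul_of_nonneg_left ?_ (by have := H.hb; positivity)
          rw [sum_diff_le H u (fun k => (k:ℝ) ^ (-(d:ℝ) + (1 - α)))]
          refine K1 H.hd (by linarith) (by linarith) hn0.le _ fun w hw => ?_
          obtain ⟨v, hv, rfl⟩ := Finset.mem_map.1 hw
          have hv' := Finset.mem_erase.1 hv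
          simp only [Equiv.coe_toEmbedding, Equiv.coe_addRight, ← sub_eq_add_neg]
          refine ⟨sub_ne_zero.2 hv'.1, ?_⟩
          rw [normInf_comm]
          exact_mod_cast (Finset.mem_filter.1 hv'.2).2
      _ = _ := by
          rw [show (1:ℝ) - α = -α + 1 by ring, Real.rpow_add hn0, Real.rpow_one]
          field_simp
  have e2 : ∑ v ∈ A with ¬ normInf (u - v) ≤ n, kap p x n u v ≤ b * Kd d α * (n:ℝ) ^ (-α) := by
    refine (Finset.sum_le_sum fun v _ => kap_le1 H.pp x hn u v).trans (psum H u hn _ ?_)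
    intro v hv
    have := (Finset.mem_filter.1 hv).2
    omega
  calc _ ≤ _ := add_le_add e1 e2
    _ = _ := by ring

lemma split_lemma (H : Hyp d α a b p) {D : Finset (V d)} {x y : V d} (hx : x ∈ D) {n : ℕ} (hn : 1 ≤ n)
    (hxy : 2 * n < normInf (x - y)) {η : ℝ} (hη0 : 0 < η) (hη : η ≤ 1 / 2) {S1 S2 F : ℝ}
    (hS1 : ∑ u ∈ D ∩ ball x (2 * n), tau p (D ∩ ball x (2 * n)) x u ≤ S1)
    (hS2 : ∑ v ∈ D, tau p D v y ≤ S2) (hF0 : 0 ≤ F)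
    (hF : ∀ u ∈ D ∩ ball x (2 * n), n ≤ 2 * normInf (u - x) →
      tau p (D ∩ ball x (2 * n)) x u ≤ F) :
    tau p D x y ≤ b * (η * n) ^ (-(d:ℝ) - α) * S1 * S2 +
      F * (b * Kd d (1 - α) * η ^ (1 - α) * (n:ℝ) ^ (-α)) * S2 := by
  classical
  have hn0 : (0:ℝ) < n := by exact_mod_cast hn
  have hp := H.pp
  have hb := H.hb
  have h1 := H.h1
  have h0 := H.h0
  set D' := D ∩ ball x (2 * n) with hD'
  have hex := avg_exit hp y hx hn
  rw [← hD', tau_out (D := D') (x := x) (y := y)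
    (Finset.mem_inter.2 ⟨hx, self_mem_ball _ _⟩) (fun h => by
      have := mem_ball.1 (Finset.mem_inter.1 h).2
      rw [normInf_comm] at this; omega), zero_add] at hex
  refine hex.trans ?_
  set L := b * (η * n) ^ (-(d:ℝ) - α) with hL
  have hL0 : 0 ≤ L := by positivity
  have key : ∀ u ∈ D', ∀ v ∈ D, tau p D' x u * kap p x n u v * tau p D v y ≤
      L * (tau p D' x u * tau p D v y) +
      F * ((if (normInf (u - v) : ℝ) ≤ η * n then kap p x n u v else 0) * tau p D v y) := by
    intro u hu v _
    have t1 := tau_nonneg hp D' x u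
    have t2 := tau_nonneg hp D v y
    have k0 := kap_nonneg hp x n u v
    by_cases hc : (normInf (u - v) : ℝ) ≤ η * n
    · rw [if_pos hc]
      have hl : 0 ≤ L * (tau p D' x u * tau p D v y) := by positivity
      have : tau p D' x u * kap p x n u v * tau p D v y ≤ F * (kap p x n u v * tau p D v y) := by
        by_cases hv : normInf (v - x) ≤ n
        · rw [kap_zero x n (Or.inl hv)]; simp
        · rw [← mul_assoc F]
          refine mul_le_mul_of_nonneg_right (mul_le_mul_of_nonneg_right (hF u hu ?_) k0) t2
          have h2 : (normInf (u - v) : ℝ) ≤ n / 2 := hc.trans (by nlinarith)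
          have h3 : 2 * normInf (u - v) ≤ n := by
            have : (2:ℝ) * normInf (u - v) ≤ n := by linarith
            exact_mod_cast this
          have h4 := normInf_tri v u x
          rw [normInf_comm v u] at h4
          omega
      linarith
    · rw [if_neg hc]
      have hk : kap p x n u v ≤ L := by
        refine (kap_le1' H x hn u v).trans (mul_le_mul_of_nonneg_left ?_ hb.le)
        have hd0 : (0:ℝ) ≤ d := by positivity
        exact Real.rpow_le_rpow_of_nonpos (by positivity) (le_of_not_ge hc) (by linarith)
      have : tau p D' x u * kap p x n u v * tau p D v y ≤ tau p D' x u * L * tau p D v y :=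
        mul_le_mul_of_nonneg_right (mul_le_mul_of_nonneg_left hk t1) t2
      calc _ ≤ _ := this
        _ = _ := by ring
  refine (Finset.sum_le_sum fun u hu => Finset.sum_le_sum fun v hv => key u hu v hv).trans ?_
  simp only [Finset.sum_add_distrib, ← Finset.mul_sum, ← Finset.sum_mul]
  have hS10 : 0 ≤ ∑ u ∈ D', tau p D' x u := Finset.sum_nonneg fun _ _ => tau_nonneg hp _ _ _
  have hS20 : 0 ≤ ∑ v ∈ D, tau p D v y := Finset.sum_nonneg fun _ _ => tau_nonneg hp _ _ _
  refine add_le_add ?_ ?_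
  · rw [mul_assoc L]
    exact mul_le_mul_of_nonneg_left (mul_le_mul hS1 hS2 hS20 (hS10.trans hS1)) hL0
  · rw [mul_assoc]
    refine mul_le_mul_of_nonneg_left ?_ hF0
    rw [Finset.sum_comm]
    set Z := b * Kd d (1 - α) * η ^ (1 - α) * (n:ℝ) ^ (-α) with hZ
    have hZ0 : 0 ≤ Z := by
      have := (Kd_pos (d := d) H.hd (s := 1 - α) (by linarith)).le
      positivity
    calc _ ≤ ∑ v ∈ D, Z * tau p D v y := by
          refine Finset.sum_le_sum fun v _ => ?_
          rw [← Finset.sum_mul]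
          refine mul_le_mul_of_nonneg_right ?_ (tau_nonneg hp _ _ _)
          rw [← Finset.sum_filter]
          refine (kapsum2 H x v (n := n) (t := η * n) (by positivity) _
            (fun u hu => (Finset.mem_filter.1 hu).2)).trans (le_of_eq ?_)
          rw [Real.mul_rpow hη0.le hn0.le, hZ,
            show (-α) = (1 - α) - 1 by ring, Real.rpow_sub hn0 (1 - α) 1, Real.rpow_one]
          ring
      _ = Z * ∑ v ∈ D, tau p D v y := by rw [Finset.mul_sum]
      _ ≤ _ := mul_le_mul_of_nonneg_left hS2 hZ0

end HypS2

lemma join_tight {W : Type*} [DecidableEq W] {p : Sym2 W → ℝ}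
    (hp : PP p) {D D1 D2 : Finset W} (h1 : D1 ⊆ D) (h2 : D2 ⊆ D)
    (hd : Disjoint D1 D2) {l : ℝ} (hl0 : 0 ≤ l)
    (hl : ∀ u ∈ D1, ∀ v ∈ D2, 1 - p s(u, v) ≤ Real.exp (-l)) (x y : W) {m : ℕ} (hm : 1 ≤ m)
    {ε : ℝ} (hε : 0 < ε) (hq1 : Pr p D1.sym2 (fun ω => ∃ u, m ≤ cs D1 ω u) ≤ 1 - ε)
    (hq2 : Pr p D2.sym2 (fun ω => ∃ u, m ≤ cs D2 ω u) ≤ 1 - ε) :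
    l / (1 + l * m ^ 2) * ((∑ u ∈ D1, tau p D1 x u) * ∑ u ∈ D2, tau p D2 y u) ≤
      (1 + 2 / ε) ^ 2 * tau p D x y := by
  have hj := join_lower hp h1 h2 hd hl0 hl x y m
  have t1 := tight hp D1 x hm hε hq1
  have t2 := tight hp D2 y hm hε hq2
  rw [Ex_cs] at t1 t2
  set M1 := Ex p D1.sym2 (fun ω => ((min (cs D1 ω x) m : ℕ) : ℝ))
  set M2 := Ex p D2.sym2 (fun ω => ((min (cs D2 ω y) m : ℕ) : ℝ))
  have hM1 : 0 ≤ M1 := Ex_nonneg hp fun _ _ => by positivity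
  have hS2 : 0 ≤ ∑ u ∈ D2, tau p D2 y u := Finset.sum_nonneg fun _ _ => tau_nonneg hp _ _ _
  calc _ ≤ l / (1 + l * m ^ 2) * (((1 + 2 / ε) * M1) * ((1 + 2 / ε) * M2)) := by
        refine mul_le_mul_of_nonneg_left ?_ (by positivity)
        exact mul_le_mul t1 t2 hS2 (by positivity)
    _ = (1 + 2 / ε) ^ 2 * (l / (1 + l * m ^ 2) * (M1 * M2)) := by ring
    _ ≤ _ := mul_le_mul_of_nonneg_left hj (by positivity)

/-- threshold -/
noncomputable def mm (d : ℕ) (α A : ℝ) (N : ℕ) : ℕ := ⌈A * (N:ℝ) ^ (((d:ℝ) + α) / 2)⌉₊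

/-- no big clusters -/
def NB (d : ℕ) (α A ε : ℝ) (p : Sym2 (V d) → ℝ) : Prop :=
  ∀ N : ℕ, 1 ≤ N → Pr p (Q 0 N).sym2 (fun ω => ∃ x, mm d α A N ≤ cs (Q (0 : V d) N) ω x) ≤ 1 - ε

lemma mm_pos {d : ℕ} {α A : ℝ} (hA : 0 < A) {N : ℕ} (hN : 1 ≤ N) : 1 ≤ mm d α A N := by
  have hN0 : (0:ℝ) < N := by exact_mod_cast hN
  exact Nat.ceil_pos.2 (by positivity)

lemma mm_sq {d : ℕ} {α A : ℝ} (hα : 0 < α) (hA : 0 < A) {N : ℕ} (hN : 1 ≤ N) :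
    (mm d α A N : ℝ) ^ 2 ≤ (A + 1) ^ 2 * (N:ℝ) ^ ((d:ℝ) + α) := by
  have hN0 : (0:ℝ) < N := by exact_mod_cast hN
  have hN1 : (1:ℝ) ≤ N := by exact_mod_cast hN
  have h1 : (mm d α A N : ℝ) ≤ (A + 1) * (N:ℝ) ^ (((d:ℝ) + α) / 2) := by
    have := Nat.ceil_lt_add_one (a := A * (N:ℝ) ^ (((d:ℝ) + α) / 2)) (by positivity)
    have h2 : 1 ≤ (N:ℝ) ^ (((d:ℝ) + α) / 2) := Real.one_le_rpow hN1 (by positivity)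
    unfold mm
    linarith
  calc (mm d α A N : ℝ) ^ 2 ≤ ((A + 1) * (N:ℝ) ^ (((d:ℝ) + α) / 2)) ^ 2 :=
        pow_le_pow_left₀ (by positivity) h1 2
    _ = (A + 1) ^ 2 * ((N:ℝ) ^ (((d:ℝ) + α) / 2)) ^ 2 := by ring
    _ = _ := by rw [← Real.rpow_natCast ((N:ℝ) ^ (((d:ℝ)+α)/2)) 2, ← Real.rpow_mul hN0.le]; congr 2; push_cast; ring

section Avg
variable {d : ℕ} {α a b A ε : ℝ} {p : Sym2 (V d) → ℝ}

/-- the total two-point sum -/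
noncomputable def XX (p : Sym2 (V d) → ℝ) (N : ℕ) : ℝ :=
  ∑ x ∈ Q (0 : V d) N, ∑ y ∈ Q (0 : V d) N, tau p (Q 0 N) x y

lemma NB_Q (H : Hyp d α a b p) (hNB : NB d α A ε p) (v : V d) {N : ℕ} (hN : 1 ≤ N) :
    Pr p (Q v N).sym2 (fun ω => ∃ x, mm d α A N ≤ cs (Q v N) ω x) ≤ 1 - ε := by
  rw [Pr_Q H]; exact hNB N hN

lemma XX_trans (H : Hyp d α a b p) (v : V d) (N : ℕ) :
    ∑ x ∈ Q v N, ∑ y ∈ Q v N, tau p (Q v N) x y = XX p N := by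
  have h : Q v N = (Q 0 N).map (Equiv.addRight v).toEmbedding := by rw [Q_map, zero_add]
  rw [XX, h, Finset.sum_map]
  refine Finset.sum_congr rfl fun x _ => ?_
  rw [Finset.sum_map]
  refine Finset.sum_congr rfl fun y _ => ?_
  exact tau_trans H (Q 0 N) x y v

lemma lo_mono (H : Hyp d α a b p) {u v : V d} (huv : u ≠ v) {r : ℝ}
    (hr : (normInf (u - v) : ℝ) ≤ r) :
    1 - p s(u, v) ≤ Real.exp (-(a * r ^ (-(d:ℝ) - α))) := by
  refine (H.lo u v huv).trans (Real.exp_le_exp.2 (neg_le_neg ?_))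
  refine mul_le_mul_of_nonneg_left ?_ H.ha.le
  have h0 := H.h0
  have hpos : (0:ℝ) < normInf (u - v) := by exact_mod_cast normInf_sub_pos huv
  have : (0:ℝ) ≤ d := by positivity
  exact Real.rpow_le_rpow_of_nonpos hpos hr (by linarith)

/-- growth constant -/
noncomputable def c3 (d : ℕ) (α a A ε : ℝ) : ℝ :=
  a * 2 ^ (-(d:ℝ) - α) * 2 ^ (-(d:ℝ) - α) / (1 + a * (A + 1) ^ 2) / (1 + 2 / ε) ^ 2

lemma c3_pos (ha : 0 < a) (hε : 0 < ε) : 0 < c3 d α a A ε := by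
  unfold c3; positivity

lemma XX_step (H : Hyp d α a b p) (hA : 0 < A) (hε : 0 < ε) (hNB : NB d α A ε p) {N : ℕ}
    (hN : 1 ≤ N) :
    c3 d α a A ε * (XX p N / (N:ℝ) ^ ((d:ℝ) + α)) ^ 2 ≤
      XX p (2 * N) / ((2 * N : ℕ) : ℝ) ^ ((d:ℝ) + α) := by
  have hp := H.pp
  have ha := H.ha
  have h0 := H.h0
  have hN0 : (0:ℝ) < N := by exact_mod_cast hN
  set v : V d := fun _ => (N:ℤ) with hv
  have s1 : Q (0 : V d) N ⊆ Q 0 (2 * N) := by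
    intro y hy
    rw [mem_Q] at *
    intro i; have := hy i; simp only [Pi.zero_apply] at *; push_cast; omega
  have s2 : Q v N ⊆ Q 0 (2 * N) := by
    intro y hy
    rw [mem_Q] at *
    intro i; have := hy i; simp only [Pi.zero_apply, hv] at *; push_cast; omega
  have hdis : Disjoint (Q (0 : V d) N) (Q v N) := by
    rw [Finset.disjoint_left]
    intro y hy hy'
    rw [mem_Q] at *
    have h1 := hy ⟨0, H.hd⟩
    have h2 := hy' ⟨0, H.hd⟩
    simp only [Pi.zero_apply, hv] at *; omega
  set l : ℝ := a * (2 * N : ℝ) ^ (-(d:ℝ) - α) with hl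
  have hl0 : 0 ≤ l := by positivity
  have hlb : ∀ x ∈ Q (0 : V d) N, ∀ y ∈ Q v N, 1 - p s(x, y) ≤ Real.exp (-l) := by
    intro x hx y hy
    refine lo_mono H ?_ ?_
    · rintro rfl; exact Finset.disjoint_left.1 hdis hx hy
    · have := Q_dist (s1 hx) (s2 hy)
      exact_mod_cast this
  set m := mm d α A N with hm
  have hm1 : 1 ≤ m := mm_pos hA hN
  have hlm : l * m ^ 2 ≤ a * (A + 1) ^ 2 := by
    calc l * m ^ 2 ≤ l * ((A + 1) ^ 2 * (N:ℝ) ^ ((d:ℝ) + α)) :=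
          mul_le_mul_of_nonneg_left (mm_sq h0 hA hN) hl0
      _ = a * (A + 1) ^ 2 * ((2 * N : ℝ) ^ (-(d:ℝ) - α) * (N:ℝ) ^ ((d:ℝ) + α)) := by
          rw [hl]; ring
      _ ≤ a * (A + 1) ^ 2 * 1 := by
          refine mul_le_mul_of_nonneg_left ?_ (by positivity)
          rw [show -(d:ℝ) - α = -((d:ℝ) + α) by ring, Real.rpow_neg (by positivity),
            inv_mul_le_iff₀ (by positivity), mul_one]
          exact Real.rpow_le_rpow hN0.le (by linarith) (by positivity)
      _ = _ := mul_one _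
  set c := l / (1 + a * (A + 1) ^ 2) / (1 + 2 / ε) ^ 2 with hc
  have hpair : ∀ x y : V d, c * ((∑ u ∈ Q (0 : V d) N, tau p (Q 0 N) x u) *
      ∑ u ∈ Q v N, tau p (Q v N) y u) ≤ tau p (Q 0 (2 * N)) x y := by
    intro x y
    have h := join_tight hp s1 s2 hdis hl0 hlb x y hm1 hε (NB_Q H hNB 0 hN) (NB_Q H hNB v hN)
    have hSS : 0 ≤ (∑ u ∈ Q (0 : V d) N, tau p (Q 0 N) x u) * ∑ u ∈ Q v N, tau p (Q v N) y u :=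
      mul_nonneg (Finset.sum_nonneg fun _ _ => tau_nonneg hp _ _ _)
        (Finset.sum_nonneg fun _ _ => tau_nonneg hp _ _ _)
    have h2 : l / (1 + a * (A + 1) ^ 2) ≤ l / (1 + l * m ^ 2) :=
      div_le_div_of_nonneg_left hl0 (by positivity) (by linarith)
    have h3 := mul_le_mul_of_nonneg_right h2 hSS
    rw [hc, div_mul_eq_mul_div, div_le_iff₀ (by positivity), mul_comm (tau _ _ _ _)]
    exact h3.trans h
  have hX0 : 0 ≤ XX p N := Finset.sum_nonneg fun _ _ => Finset.sum_nonneg fun _ _ =>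
    tau_nonneg hp _ _ _
  have hbig : c * XX p N ^ 2 ≤ XX p (2 * N) := by
    calc c * XX p N ^ 2 = ∑ x ∈ Q (0 : V d) N, ∑ y ∈ Q v N,
          c * ((∑ u ∈ Q (0 : V d) N, tau p (Q 0 N) x u) * ∑ u ∈ Q v N, tau p (Q v N) y u) := by
          simp only [← Finset.mul_sum, ← Finset.sum_mul]
          rw [XX_trans H v, sq]; rfl
      _ ≤ ∑ x ∈ Q (0 : V d) N, ∑ y ∈ Q v N, tau p (Q 0 (2 * N)) x y :=
          Finset.sum_le_sum fun x _ => Finset.sum_le_sum fun y _ => hpair x y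
      _ ≤ ∑ x ∈ Q (0 : V d) N, ∑ y ∈ Q 0 (2 * N), tau p (Q 0 (2 * N)) x y :=
          Finset.sum_le_sum fun x _ => Finset.sum_le_sum_of_subset_of_nonneg s2
            fun _ _ _ => tau_nonneg hp _ _ _
      _ ≤ _ := Finset.sum_le_sum_of_subset_of_nonneg s1
            fun _ _ _ => Finset.sum_nonneg fun _ _ => tau_nonneg hp _ _ _
  have hT : 0 < (N:ℝ) ^ ((d:ℝ) + α) := by positivity
  have e2 : ((2 * N : ℕ) : ℝ) ^ ((d:ℝ) + α) = 2 ^ ((d:ℝ) + α) * (N:ℝ) ^ ((d:ℝ) + α) := by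
    push_cast
    rw [Real.mul_rpow (by norm_num) hN0.le]
  have e3 : l = a * (2 ^ (-(d:ℝ) - α) * ((N:ℝ) ^ ((d:ℝ) + α))⁻¹) := by
    rw [hl, Real.mul_rpow (by norm_num) hN0.le, ← Real.rpow_neg hN0.le]
    congr 3; ring
  have e4 : (2:ℝ) ^ (-(d:ℝ) - α) = (2 ^ ((d:ℝ) + α))⁻¹ := by
    rw [← Real.rpow_neg (by norm_num)]; congr 1; ring
  rw [e2, le_div_iff₀ (by positivity)]
  refine le_trans (le_of_eq ?_) hbig
  rw [hc, c3, e3, e4]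
  have h2T : (0:ℝ) < 2 ^ ((d:ℝ) + α) := by positivity
  generalize (2:ℝ) ^ ((d:ℝ) + α) = B at *
  generalize (N:ℝ) ^ ((d:ℝ) + α) = T at *
  generalize (1 + a * (A + 1) ^ 2) = G
  generalize (1 + 2 / ε) ^ 2 = G2
  have hB := h2T.ne'
  have hT' := hT.ne'
  rw [show XX p N / T = XX p N * T⁻¹ from div_eq_mul_inv _ _]
  have i1 : B⁻¹ * B = 1 := inv_mul_cancel₀ hB
  have i2 : T⁻¹ * T = 1 := inv_mul_cancel₀ hT'
  calc a * B⁻¹ * B⁻¹ / G / G2 * (XX p N * T⁻¹) ^ 2 * (B * T)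
      = a * B⁻¹ / G / G2 * XX p N ^ 2 * T⁻¹ * (B⁻¹ * B) * (T⁻¹ * T) := by ring
    _ = _ := by rw [i1, i2]; ring

lemma exp_beats (d : ℕ) (K : ℝ) : ∃ k : ℕ, K * ((2:ℝ) ^ k) ^ d < 2 ^ (2 ^ k) := by
  have h := tendsto_pow_const_div_const_pow_of_one_lt d (r := (2:ℝ)) (by norm_num)
  have h2 : Filter.Tendsto (fun n : ℕ => K * ((n:ℝ) ^ d / 2 ^ n)) Filter.atTop (nhds (K * 0)) :=
    h.const_mul K
  rw [mul_zero] at h2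
  have h3 := h2.eventually (gt_mem_nhds (show (0:ℝ) < 1 by norm_num))
  obtain ⟨n0, hn0⟩ := Filter.eventually_atTop.1 h3
  refine ⟨n0, ?_⟩
  have := hn0 (2 ^ n0) (Nat.lt_two_pow_self).le
  rw [← mul_div_assoc, div_lt_one (by positivity)] at this
  exact_mod_cast this

lemma XX_le (H : Hyp d α a b p) (hA : 0 < A) (hε : 0 < ε) (hNB : NB d α A ε p) {N : ℕ}
    (hN : 1 ≤ N) : XX p N ≤ 2 / c3 d α a A ε * (N:ℝ) ^ ((d:ℝ) + α) := by
  have hc := c3_pos (d := d) (α := α) (A := A) H.ha hε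
  have h0 := H.h0
  have hN0 : (0:ℝ) < N := by exact_mod_cast hN
  by_contra hcon
  push Not at hcon
  set c := c3 d α a A ε with hcd
  set y : ℕ → ℝ := fun k => c * (XX p (2 ^ k * N) / ((2 ^ k * N : ℕ) : ℝ) ^ ((d:ℝ) + α)) with hy
  have hy0 : 2 ≤ y 0 := by
    simp only [hy, pow_zero, one_mul]
    rw [div_mul_eq_mul_div, div_lt_iff₀ hc] at hcon
    rw [← mul_div_assoc, le_div_iff₀ (by positivity)]
    linarith
  have hstep : ∀ k, y k ^ 2 ≤ y (k + 1) := by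
    intro k
    have hk : 1 ≤ 2 ^ k * N := Nat.one_le_iff_ne_zero.2 (by positivity)
    have := XX_step H hA hε hNB hk
    have e : 2 ^ (k + 1) * N = 2 * (2 ^ k * N) := by ring
    simp only [hy]
    rw [e]
    rw [mul_pow, sq c, mul_assoc]
    exact mul_le_mul_of_nonneg_left this hc.le
  have hgrow : ∀ k, (2:ℝ) ^ (2 ^ k) ≤ y k := by
    intro k
    induction k with
    | zero => simpa using hy0
    | succ k ih =>
      refine le_trans ?_ (hstep k)
      rw [pow_succ, pow_mul]
      exact pow_le_pow_left₀ (by positivity) ih 2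
  obtain ⟨k, hk⟩ := exp_beats d (c * (N:ℝ) ^ d)
  have hup : y k ≤ c * ((2 ^ k * N : ℕ) : ℝ) ^ d := by
    simp only [hy]
    refine mul_le_mul_of_nonneg_left ?_ hc.le
    set M := 2 ^ k * N with hM
    have hM1 : 1 ≤ M := Nat.one_le_iff_ne_zero.2 (by positivity)
    have hM1' : (1:ℝ) ≤ M := by exact_mod_cast hM1
    have hM0 : (0:ℝ) < M := by linarith
    rw [div_le_iff₀ (by positivity)]
    calc XX p M ≤ ∑ x ∈ Q (0 : V d) M, ∑ y ∈ Q (0 : V d) M, 1 :=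
          Finset.sum_le_sum fun _ _ => Finset.sum_le_sum fun _ _ => tau_le_one H.pp _ _ _
      _ = (M:ℝ) ^ d * (M:ℝ) ^ d := by simp [card_Q]
      _ ≤ _ := by
          refine mul_le_mul_of_nonneg_left ?_ (by positivity)
          rw [← Real.rpow_natCast]
          exact Real.rpow_le_rpow_of_exponent_le hM1' (by linarith)
  have := hgrow k
  push_cast at hup
  rw [mul_pow] at hup
  have e : c * (N:ℝ) ^ d * (2 ^ k) ^ d = c * ((2 ^ k) ^ d * (N:ℝ) ^ d) := by ring
  linarith

/-- averaged constant -/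
noncomputable def CI (d : ℕ) (α a A ε : ℝ) : ℝ := 2 / c3 d α a A ε * 2 ^ d * 9

lemma CI_pos (ha : 0 < a) (hε : 0 < ε) : 0 < CI d α a A ε := by
  have := c3_pos (d := d) (α := α) (A := A) ha hε
  unfold CI; positivity

lemma ball_sum_trans (H : Hyp d α a b p) (x : V d) (n : ℕ) :
    ∑ y ∈ ball x n, tau p (ball x n) x y = ∑ y ∈ ball (0 : V d) n, tau p (ball 0 n) 0 y := by
  have h : ball x n = (ball 0 n).map (Equiv.addRight x).toEmbedding := by rw [ball_map, zero_add]
  rw [h, Finset.sum_map]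
  refine Finset.sum_congr rfl fun y _ => ?_
  have := tau_trans H (ball 0 n) 0 y x
  rw [zero_add] at this
  exact this

lemma ball_avg (H : Hyp d α a b p) (hA : 0 < A) (hε : 0 < ε) (hNB : NB d α A ε p) {R : ℕ}
    (hR : 1 ≤ R) : ∑ y ∈ ball (0 : V d) (2 * R), tau p (ball 0 (2 * R)) 0 y ≤
      CI d α a A ε * (R:ℝ) ^ α := by
  have hc := c3_pos (d := d) (α := α) (A := A) H.ha hε
  have hp := H.pp
  have h0 := H.h0
  have hR1 : (1:ℝ) ≤ R := by exact_mod_cast hR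
  set S := 2 * R with hS
  set e := ∑ y ∈ ball (0 : V d) S, tau p (ball 0 S) 0 y with he
  have h1 : ((2 * S + 1 : ℕ) : ℝ) ^ d * e ≤ XX p (2 * (2 * S) + 1) := by
    calc ((2 * S + 1 : ℕ) : ℝ) ^ d * e = ∑ x ∈ ball (0 : V d) S, e := by
          rw [Finset.sum_const, card_ball]; simp
      _ = ∑ x ∈ ball (0 : V d) S, ∑ y ∈ ball x S, tau p (ball x S) x y :=
          Finset.sum_congr rfl fun x _ => (ball_sum_trans H x S).symm
      _ ≤ ∑ x ∈ ball (0 : V d) S, ∑ y ∈ ball (0 : V d) (2 * S), tau p (ball 0 (2 * S)) x y := by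
          refine Finset.sum_le_sum fun x hx => ?_
          have hsub : ball x S ⊆ ball 0 (2 * S) :=
            ball_subset (by have := mem_ball.1 hx; omega)
          refine (Finset.sum_le_sum fun y _ => tau_mono hp hsub x y).trans ?_
          exact Finset.sum_le_sum_of_subset_of_nonneg hsub fun _ _ _ => tau_nonneg hp _ _ _
      _ ≤ ∑ x ∈ ball (0 : V d) (2 * S), ∑ y ∈ ball (0 : V d) (2 * S),
            tau p (ball 0 (2 * S)) x y :=
          Finset.sum_le_sum_of_subset_of_nonneg (ball_mono 0 (by omega))
            fun _ _ _ => Finset.sum_nonneg fun _ _ => tau_nonneg hp _ _ _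
      _ = _ := by rw [ball_eq_Q]; exact XX_trans H _ _
  have h2 := XX_le H hA hε hNB (N := 2 * (2 * S) + 1) (by omega)
  set T : ℝ := ((2 * S + 1 : ℕ) : ℝ) with hT
  have hT0 : 0 < T := by positivity
  set U : ℝ := ((2 * (2 * S) + 1 : ℕ) : ℝ) with hU
  have hU0 : 0 < U := by positivity
  have hUT : U ≤ 2 * T := by rw [hU, hT]; push_cast; linarith
  have hUR : U ≤ 9 * R := by rw [hU, hS]; push_cast; linarith
  rw [Real.rpow_add hU0, Real.rpow_natCast] at h2
  have h3 : U ^ α ≤ 9 * (R:ℝ) ^ α := by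
    calc U ^ α ≤ (9 * R) ^ α := Real.rpow_le_rpow hU0.le hUR h0.le
      _ = 9 ^ α * (R:ℝ) ^ α := Real.mul_rpow (by norm_num) (by positivity)
      _ ≤ 9 ^ (1:ℝ) * (R:ℝ) ^ α := by
          refine mul_le_mul_of_nonneg_right ?_ (by positivity)
          exact Real.rpow_le_rpow_of_exponent_le (by norm_num) H.h1.le
      _ = _ := by rw [Real.rpow_one]
  have h4 : U ^ d ≤ 2 ^ d * T ^ d := by
    rw [← mul_pow]; exact pow_le_pow_left₀ hU0.le hUT d
  have h5 : T ^ d * e ≤ T ^ d * (CI d α a A ε * (R:ℝ) ^ α) := by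
    calc T ^ d * e ≤ 2 / c3 d α a A ε * (U ^ d * U ^ α) := h1.trans h2
      _ ≤ 2 / c3 d α a A ε * ((2 ^ d * T ^ d) * (9 * (R:ℝ) ^ α)) := by
          refine mul_le_mul_of_nonneg_left ?_ (by positivity)
          exact mul_le_mul h4 h3 (by positivity) (by positivity)
      _ = _ := by unfold CI; ring
  exact le_of_mul_le_mul_left h5 (by positivity)

lemma D_avg (H : Hyp d α a b p) (hA : 0 < A) (hε : 0 < ε) (hNB : NB d α A ε p) {N : ℕ}
    (hN : 1 ≤ N) {D : Finset (V d)} {z : V d} (hD : D ⊆ ball z N) {x : V d} (hx : x ∈ D) :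
    ∑ y ∈ D, tau p D x y ≤ CI d α a A ε * (N:ℝ) ^ α := by
  have hp := H.pp
  have hsub : D ⊆ ball x (2 * N) := by
    refine hD.trans (ball_subset ?_)
    have := mem_ball.1 (hD hx)
    rw [normInf_comm] at this; omega
  refine le_trans ?_ (ball_avg H hA hε hNB hN)
  rw [← ball_sum_trans H x]
  refine (Finset.sum_le_sum fun y _ => tau_mono hp hsub x y).trans ?_
  exact Finset.sum_le_sum_of_subset_of_nonneg hsub fun _ _ _ => tau_nonneg hp _ _ _

lemma sum_flip_le (hp : PP p) {D : Finset (V d)} {G : ℝ} (hG0 : 0 ≤ G)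
    (hG : ∀ x ∈ D, ∑ y ∈ D, tau p D x y ≤ G) (y : V d) : ∑ v ∈ D, tau p D v y ≤ G := by
  by_cases hy : y ∈ D
  · simp only [tau_symm D _ y]; exact hG y hy
  · rw [Finset.sum_congr rfl (g := fun _ => (0:ℝ)) fun v hv => tau_out hv hy]
    simpa using hG0

end Avg

/-- parameters -/
structure Par (d : ℕ) (α a b A ε : ℝ) : Prop where
  hd : 1 ≤ d
  h0 : 0 < α
  h1 : α < 1
  had : α < d
  ha : 0 < a
  hb : 0 < b
  hA : 0 < A
  hε : 0 < ε

section Up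
variable {d : ℕ} {α a b A ε : ℝ}

lemma exists_eta {α M θ : ℝ} (h1 : α < 1) (hM : 0 < M) (hθ : 0 < θ) :
    ∃ η : ℝ, 0 < η ∧ η ≤ 1 / 2 ∧ M * η ^ (1 - α) ≤ θ := by
  have h1' : 0 < 1 - α := by linarith
  refine ⟨min (1/2) ((θ / M) ^ (1 / (1 - α))), by positivity, min_le_left _ _, ?_⟩
  have : (min (1/2) ((θ / M) ^ (1 / (1 - α)))) ^ (1 - α) ≤ θ / M := by
    calc _ ≤ ((θ / M) ^ (1 / (1 - α))) ^ (1 - α) :=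
          Real.rpow_le_rpow (by positivity) (min_le_right _ _) h1'.le
      _ = θ / M := by
          rw [← Real.rpow_mul (by positivity), one_div_mul_cancel h1'.ne', Real.rpow_one]
  calc _ ≤ M * (θ / M) := mul_le_mul_of_nonneg_left this hM.le
    _ = θ := by field_simp

lemma P1 (R : Par d α a b A ε) : ∃ C : ℝ, 0 < C ∧ ∀ p : Sym2 (V d) → ℝ, Hyp d α a b p →
    NB d α A ε p → ∀ N : ℕ, 1 ≤ N → ∀ D : Finset (V d), ∀ z x y : V d, D ⊆ ball z N → x ∈ D →
    N ≤ 8 * normInf (x - y) → tau p D x y ≤ C * (N:ℝ) ^ (α - d) := by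
  obtain ⟨hd, h0, h1, had, ha, hb, hA, hε⟩ := R
  set I := CI d α a A ε with hI
  have hI0 : 0 < I := CI_pos ha hε
  set K := Kd d (1 - α) with hK
  have hK0 : 0 < K := Kd_pos hd (by linarith)
  set θ : ℝ := 33 ^ (α - d) with hθ
  have hθ0 : 0 < θ := by positivity
  obtain ⟨η, hη0, hη2, hη⟩ := exists_eta (α := α) (M := 33 * b * K * I) (θ := θ / 2) h1
    (by positivity) (by positivity)
  set C := 1 / θ + 132 * b * η ^ (-(d:ℝ) - α) * I ^ 2 / θ with hC
  have hC0 : 0 < C := by positivity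
  refine ⟨C, hC0, fun p H hNB => ?_⟩
  have hp := H.pp
  intro N
  induction N using Nat.strong_induction_on with
  | _ N ih =>
  intro hN D z x y hD hx hxy
  have hN0 : (0:ℝ) < N := by exact_mod_cast hN
  rcases Nat.eq_zero_or_pos (N / 17) with hn | hn
  · refine (tau_le_one hp _ _ _).trans ?_
    have hN33 : (N:ℝ) ≤ 33 := by
      have : N ≤ 33 := by omega
      exact_mod_cast this
    have : θ ≤ (N:ℝ) ^ (α - d) := Real.rpow_le_rpow_of_nonpos hN0 hN33 (by linarith)
    calc (1:ℝ) = 1 / θ * θ := by field_simp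
      _ ≤ C * (N:ℝ) ^ (α - d) := by
        refine mul_le_mul ?_ this hθ0.le hC0.le
        rw [hC]; linarith [show 0 ≤ 132 * b * η ^ (-(d:ℝ) - α) * I ^ 2 / θ by positivity]
  · set n := N / 17 with hn'
    have hn0 : (0:ℝ) < n := by exact_mod_cast hn
    have hN33 : (N:ℝ) ≤ 33 * n := by
      have : N ≤ 33 * n := by omega
      exact_mod_cast this
    have hS1 : ∑ u ∈ D ∩ ball x (2 * n), tau p (D ∩ ball x (2 * n)) x u ≤
        2 * I * (n:ℝ) ^ α := by
      refine (D_avg H hA hε hNB (N := 2 * n) (by omega) (z := x) Finset.inter_subset_right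
        (Finset.mem_inter.2 ⟨hx, self_mem_ball _ _⟩)).trans ?_
      push_cast
      rw [Real.mul_rpow (by norm_num) hn0.le]
      have : (2:ℝ) ^ α ≤ 2 := by
        calc (2:ℝ) ^ α ≤ 2 ^ (1:ℝ) := Real.rpow_le_rpow_of_exponent_le (by norm_num) h1.le
          _ = 2 := Real.rpow_one 2
      have h3 : 0 < (n:ℝ) ^ α := by positivity
      calc I * (2 ^ α * (n:ℝ) ^ α) ≤ I * (2 * (n:ℝ) ^ α) := by gcongr
        _ = _ := by ring
    have hS2 : ∑ v ∈ D, tau p D v y ≤ 33 * I * (n:ℝ) ^ α := by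
      refine sum_flip_le hp (by positivity) (fun x hx => ?_) y
      refine (D_avg H hA hε hNB hN hD hx).trans ?_
      have : (33:ℝ) ^ α ≤ 33 := by
        calc (33:ℝ) ^ α ≤ 33 ^ (1:ℝ) := Real.rpow_le_rpow_of_exponent_le (by norm_num) h1.le
          _ = 33 := Real.rpow_one 33
      calc I * (N:ℝ) ^ α ≤ I * (33 * n) ^ α := by gcongr
        _ = I * (33 ^ α * (n:ℝ) ^ α) := by rw [Real.mul_rpow (by norm_num) hn0.le]
        _ ≤ I * (33 * (n:ℝ) ^ α) := by gcongr
        _ = _ := by ring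
    have hF : ∀ u ∈ D ∩ ball x (2 * n), n ≤ 2 * normInf (u - x) →
      tau p (D ∩ ball x (2 * n)) x u ≤ C * (n:ℝ) ^ (α - d) := by
      intro u _ hun
      rw [normInf_comm] at hun
      refine (ih (2 * n) (by omega) (by omega) _ x x u Finset.inter_subset_right
        (Finset.mem_inter.2 ⟨hx, self_mem_ball _ _⟩) (by omega)).trans ?_
      refine mul_le_mul_of_nonneg_left ?_ hC0.le
      refine Real.rpow_le_rpow_of_nonpos hn0 ?_ (by linarith)
      push_cast; linarith
    have hs := split_lemma H hx hn (y := y) (by omega) hη0 hη2 hS1 hS2 (by positivity) hF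
    refine hs.trans ?_
    set T := (n:ℝ) ^ (α - d) with hT
    have hT0 : 0 < T := by positivity
    have e1 : b * (η * n) ^ (-(d:ℝ) - α) * (2 * I * (n:ℝ) ^ α) * (33 * I * (n:ℝ) ^ α) =
        66 * b * η ^ (-(d:ℝ) - α) * I ^ 2 * T := by
      rw [Real.mul_rpow hη0.le hn0.le]
      have : (n:ℝ) ^ (-(d:ℝ) - α) * (n:ℝ) ^ α * (n:ℝ) ^ α = T := by
        rw [← Real.rpow_add hn0, ← Real.rpow_add hn0]; congr 1; ring
      rw [← this]; ring
    have e2 : C * T * (b * K * η ^ (1 - α) * (n:ℝ) ^ (-α)) * (33 * I * (n:ℝ) ^ α) =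
        C * T * (33 * b * K * I * η ^ (1 - α)) := by
      have : (n:ℝ) ^ (-α) * (n:ℝ) ^ α = 1 := by
        rw [← Real.rpow_add hn0, neg_add_cancel, Real.rpow_zero]
      calc _ = C * T * (33 * b * K * I * η ^ (1 - α)) * ((n:ℝ) ^ (-α) * (n:ℝ) ^ α) := by ring
        _ = _ := by rw [this, mul_one]
    rw [e1, e2]
    have e3 : θ * T ≤ (N:ℝ) ^ (α - d) := by
      rw [hθ, hT, ← Real.mul_rpow (by norm_num) hn0.le]
      exact Real.rpow_le_rpow_of_nonpos hN0 hN33 (by linarith)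
    have e4 : 66 * b * η ^ (-(d:ℝ) - α) * I ^ 2 ≤ C * (θ / 2) := by
      have : C * (θ / 2) = 1 / 2 + 66 * b * η ^ (-(d:ℝ) - α) * I ^ 2 := by
        rw [hC]; field_simp; ring
      rw [this]; linarith
    calc _ ≤ C * (θ / 2) * T + C * T * (θ / 2) := by gcongr
      _ = C * (θ * T) := by ring
      _ ≤ _ := by gcongr

end Up

section Up2
variable {d : ℕ} {α a b A ε : ℝ}

lemma P2_step (R : Par d α a b A ε) : ∃ C : ℝ, 0 < C ∧ ∀ p : Sym2 (V d) → ℝ, Hyp d α a b p →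
    NB d α A ε p → ∀ n : ℕ, 1 ≤ n → ∀ x y : V d, 2 * normInf (x - y) ≤ n →
    tau p (ball x (4 * n)) x y ≤ tau p (ball x (2 * n)) x y + C * (n:ℝ) ^ (α - d) := by
  obtain ⟨C1, hC1, hP1⟩ := P1 R
  obtain ⟨hd, h0, h1, had, ha, hb, hA, hε⟩ := R
  set I := CI d α a A ε with hI
  have hI0 : 0 < I := CI_pos ha hε
  have hK0 : 0 < Kd d (1 - α) := Kd_pos hd (by linarith)
  have hK1 : 0 < Kd d α := Kd_pos hd h0
  set C2 := b * (Kd d (1 - α) + Kd d α) with hC2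
  have hC20 : 0 < C2 := by positivity
  refine ⟨2 * I * C1 * C2, by positivity, fun p H hNB n hn x y hxy => ?_⟩
  have hp := H.pp
  have hn0 : (0:ℝ) < n := by exact_mod_cast hn
  have hex := avg_exit hp (D := ball x (4 * n)) y (self_mem_ball _ _) hn
  have hi : ball x (4 * n) ∩ ball x (2 * n) = ball x (2 * n) :=
    Finset.inter_eq_right.2 (ball_mono x (by omega))
  rw [hi] at hex
  refine hex.trans ?_
  gcongr
  set F := C1 * (n:ℝ) ^ (α - d) with hF
  have hF0 : 0 ≤ F := by positivity
  have key : ∀ u ∈ ball x (2 * n), ∀ v ∈ ball x (4 * n),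
      tau p (ball x (2 * n)) x u * kap p x n u v * tau p (ball x (4 * n)) v y ≤
      tau p (ball x (2 * n)) x u * (kap p x n u v * F) := by
    intro u _ v hv
    rw [mul_assoc]
    refine mul_le_mul_of_nonneg_left ?_ (tau_nonneg hp _ _ _)
    rcases le_or_gt (normInf (v - x)) n with h | h
    · rw [kap_zero x n (Or.inl h)]; simp
    · refine mul_le_mul_of_nonneg_left ?_ (kap_nonneg hp _ _ _ _)
      have := normInf_tri v y x
      rw [normInf_comm y x] at this
      refine (hP1 p H hNB (4 * n) (by omega) _ x v y le_rfl hv (by omega)).trans ?_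
      rw [hF]
      refine mul_le_mul_of_nonneg_left ?_ hC1.le
      refine Real.rpow_le_rpow_of_nonpos hn0 ?_ (by linarith)
      push_cast; linarith
  calc _ ≤ ∑ u ∈ ball x (2 * n), ∑ v ∈ ball x (4 * n),
        tau p (ball x (2 * n)) x u * (kap p x n u v * F) :=
        Finset.sum_le_sum fun u hu => Finset.sum_le_sum fun v hv => key u hu v hv
    _ = ∑ u ∈ ball x (2 * n), tau p (ball x (2 * n)) x u *
        ((∑ v ∈ ball x (4 * n), kap p x n u v) * F) := by
        refine Finset.sum_congr rfl fun u _ => ?_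
        rw [← Finset.mul_sum, Finset.sum_mul]
    _ ≤ ∑ u ∈ ball x (2 * n), tau p (ball x (2 * n)) x u * ((C2 * (n:ℝ) ^ (-α)) * F) := by
        refine Finset.sum_le_sum fun u _ => ?_
        refine mul_le_mul_of_nonneg_left ?_ (tau_nonneg hp _ _ _)
        exact mul_le_mul_of_nonneg_right (kapsum1 H x u hn _) hF0
    _ = (∑ u ∈ ball x (2 * n), tau p (ball x (2 * n)) x u) * ((C2 * (n:ℝ) ^ (-α)) * F) := by
        rw [Finset.sum_mul]
    _ ≤ (2 * I * (n:ℝ) ^ α) * ((C2 * (n:ℝ) ^ (-α)) * F) := by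
        refine mul_le_mul_of_nonneg_right ?_ (by positivity)
        refine (D_avg H hA hε hNB (N := 2 * n) (by omega) (z := x) le_rfl
          (self_mem_ball _ _)).trans ?_
        push_cast
        rw [Real.mul_rpow (by norm_num) hn0.le]
        have : (2:ℝ) ^ α ≤ 2 := by
          calc (2:ℝ) ^ α ≤ 2 ^ (1:ℝ) := Real.rpow_le_rpow_of_exponent_le (by norm_num) h1.le
            _ = 2 := Real.rpow_one 2
        calc I * (2 ^ α * (n:ℝ) ^ α) ≤ I * (2 * (n:ℝ) ^ α) := by gcongr
          _ = _ := by ring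
    _ = 2 * I * C1 * C2 * (n:ℝ) ^ (α - d) * ((n:ℝ) ^ (-α) * (n:ℝ) ^ α) := by rw [hF]; ring
    _ = _ := by rw [← Real.rpow_add hn0, neg_add_cancel, Real.rpow_zero, mul_one]

lemma P2 (R : Par d α a b A ε) : ∃ C : ℝ, 0 < C ∧ ∀ p : Sym2 (V d) → ℝ, Hyp d α a b p →
    NB d α A ε p → ∀ D : Finset (V d), ∀ x y : V d, x ∈ D → x ≠ y →
    tau p D x y ≤ C * (normInf (x - y) : ℝ) ^ (α - d) := by
  obtain ⟨C1, hC1, hP1⟩ := P1 R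
  obtain ⟨C2, hC2, hS⟩ := P2_step R
  obtain ⟨hd, h0, h1, had, ha, hb, hA, hε⟩ := R
  set s : ℝ := 2 ^ (α - d) with hs
  have hs0 : 0 < s := by positivity
  have hs1 : s < 1 := Real.rpow_lt_one_of_one_lt_of_neg (by norm_num) (by linarith)
  have hs1' : 0 < 1 - s := by linarith
  refine ⟨C1 + C2 / (1 - s), by positivity, fun p H hNB D x y hx hxy => ?_⟩
  have hp := H.pp
  set r := normInf (x - y) with hr
  have hr1 : 1 ≤ r := normInf_pos (sub_ne_zero.2 hxy)
  have hr0 : (0:ℝ) < r := by exact_mod_cast hr1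
  have ind : ∀ k : ℕ, tau p (ball x (4 * r * 2 ^ k)) x y ≤
      (C1 + C2 * (1 - s ^ k) / (1 - s)) * (r:ℝ) ^ (α - d) := by
    intro k
    induction k with
    | zero =>
      refine (hP1 p H hNB (4 * r * 2 ^ 0) (by omega) _ x x y le_rfl (self_mem_ball _ _)
        (by omega)).trans ?_
      simp only [pow_zero, sub_self, mul_zero, zero_div, add_zero, mul_one]
      refine mul_le_mul_of_nonneg_left ?_ hC1.le
      refine Real.rpow_le_rpow_of_nonpos hr0 ?_ (by linarith)
      push_cast; linarith
    | succ k ih =>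
      have h2k : 1 ≤ 2 ^ k := Nat.one_le_two_pow
      have h := hS p H hNB (2 * r * 2 ^ k) (by nlinarith) x y (by nlinarith)
      rw [show 4 * (2 * r * 2 ^ k) = 4 * r * 2 ^ (k+1) by ring,
        show 2 * (2 * r * 2 ^ k) = 4 * r * 2 ^ k by ring] at h
      have e : ((2 * r * 2 ^ k : ℕ):ℝ) ^ (α - d) ≤ s ^ k * (r:ℝ) ^ (α - d) := by
        calc ((2 * r * 2 ^ k : ℕ):ℝ) ^ (α - d) ≤ (2 ^ k * (r:ℝ)) ^ (α - d) := by
              refine Real.rpow_le_rpow_of_nonpos (by positivity) ?_ (by linarith)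
              push_cast
              nlinarith [show (0:ℝ) < 2 ^ k * r by positivity]
          _ = s ^ k * (r:ℝ) ^ (α - d) := by
              rw [Real.mul_rpow (by positivity) hr0.le]
              congr 1
              rw [hs, ← Real.rpow_natCast, ← Real.rpow_natCast, ← Real.rpow_mul (by norm_num),
                ← Real.rpow_mul (by norm_num), mul_comm]
      calc _ ≤ (C1 + C2 * (1 - s ^ k) / (1 - s)) * (r:ℝ) ^ (α - d) +
            C2 * (s ^ k * (r:ℝ) ^ (α - d)) := by
            refine h.trans (add_le_add ih ?_)
            exact mul_le_mul_of_nonneg_left e hC2.le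
        _ = _ := by field_simp; ring
  obtain ⟨m, hm⟩ := exists_ball D x
  have hm2 : D ⊆ ball x (4 * r * 2 ^ m) := by
    refine hm.trans (ball_mono x ?_)
    have : m < 2 ^ m := Nat.lt_two_pow_self
    nlinarith
  refine (tau_mono hp hm2 x y).trans ((ind m).trans ?_)
  refine mul_le_mul_of_nonneg_right ?_ (by positivity)
  have : 1 - s ^ m ≤ 1 := by linarith [pow_pos hs0 m]
  gcongr
  calc C2 * (1 - s ^ m) ≤ C2 * 1 := by gcongr
    _ = C2 := mul_one _

lemma P3 (R : Par d α a b A ε) {g : ℝ} (hg : 0 < g) : ∃ C : ℝ, 0 < C ∧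
    ∀ p : Sym2 (V d) → ℝ, Hyp d α a b p →
    NB d α A ε p → ∀ X : ℕ, 1 ≤ X →
    (∀ D : Finset (V d), ∀ x ∈ D, ∑ y ∈ D, tau p D x y ≤ g * (X:ℝ) ^ α) →
    ∀ r : ℕ, ∀ D : Finset (V d), ∀ x y : V d, x ∈ D → x ≠ y → normInf (x - y) = r →
    tau p D x y ≤ C * (X:ℝ) ^ (2 * α) * (r : ℝ) ^ (-(d:ℝ) - α) := by
  obtain ⟨C2, hC2, hP2⟩ := P2 R
  obtain ⟨hd, h0, h1, had, ha, hb, hA, hε⟩ := R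
  set K := Kd d (1 - α) with hK
  have hK0 : 0 < K := Kd_pos hd (by linarith)
  obtain ⟨η, hη0, hη2, hη⟩ := exists_eta (α := α) (M := 8 ^ ((d:ℝ) + α) * b * K * 4 * g)
    (θ := 1 / 2) h1 (by positivity) (by positivity)
  set C := C2 + 2 ^ ((d:ℝ) + α) + 2 * (b * η ^ (-(d:ℝ) - α) * 4 ^ ((d:ℝ) + α) * g ^ 2) with hC
  have q1 : 0 < 2 * (b * η ^ (-(d:ℝ) - α) * 4 ^ ((d:ℝ) + α) * g ^ 2) := by positivity
  have q2 : (0:ℝ) < 2 ^ ((d:ℝ) + α) := by positivity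
  have hC0 : 0 < C := by positivity
  refine ⟨C, hC0, fun p H hNB X hX hG r => ?_⟩
  have hp := H.pp
  have hX1 : (1:ℝ) ≤ X := by exact_mod_cast hX
  have hX0 : (0:ℝ) < X := by linarith
  induction r using Nat.strong_induction_on with
  | _ r ih =>
  intro D x y hx hxy hr
  have hr1 : 1 ≤ r := hr ▸ normInf_pos (sub_ne_zero.2 hxy)
  have hr0 : (0:ℝ) < r := by exact_mod_cast hr1
  rcases le_or_gt r X with hrX | hrX
  · have hrX' : (r:ℝ) ≤ X := by exact_mod_cast hrX
    refine (hP2 p H hNB D x y hx hxy).trans ?_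
    rw [hr]
    calc C2 * (r:ℝ) ^ (α - d) = C2 * ((r:ℝ) ^ (2 * α) * (r:ℝ) ^ (-(d:ℝ) - α)) := by
          rw [← Real.rpow_add hr0]; congr 2; ring
      _ ≤ C * ((X:ℝ) ^ (2 * α) * (r:ℝ) ^ (-(d:ℝ) - α)) := by
          have : C2 ≤ C := by rw [hC]; linarith
          gcongr
      _ = _ := by ring
  rcases Nat.lt_or_ge r 3 with hr3 | hr3
  · refine (tau_le_one hp _ _ _).trans ?_
    have e1 : 1 ≤ (X:ℝ) ^ (2 * α) := Real.one_le_rpow hX1 (by positivity)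
    have e2 : (2:ℝ) ^ (-(d:ℝ) - α) ≤ (r:ℝ) ^ (-(d:ℝ) - α) := by
      refine Real.rpow_le_rpow_of_nonpos hr0 ?_ (by linarith)
      have : r ≤ 2 := by omega
      exact_mod_cast this
    calc (1:ℝ) = 2 ^ ((d:ℝ) + α) * 1 * 2 ^ (-(d:ℝ) - α) := by
          rw [mul_one, ← Real.rpow_add (by norm_num),
            show (d:ℝ) + α + (-(d:ℝ) - α) = 0 by ring, Real.rpow_zero]
      _ ≤ _ := by
          have : (2:ℝ) ^ ((d:ℝ) + α) ≤ C := by rw [hC]; linarith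
          gcongr
  · set n := (r - 1) / 2 with hn'
    have hn : 1 ≤ n := by omega
    have hn0 : (0:ℝ) < n := by exact_mod_cast hn
    have hnr : (r:ℝ) / 4 ≤ n := by
      have : r ≤ 4 * n := by omega
      have : (r:ℝ) ≤ 4 * n := by exact_mod_cast this
      linarith
    have hXn : (X:ℝ) ≤ 4 * n := by
      have : X ≤ 4 * n := by omega
      exact_mod_cast this
    set T := (r:ℝ) ^ (-(d:ℝ) - α) with hT
    have hT0 : 0 < T := by positivity
    have hS1 : ∑ u ∈ D ∩ ball x (2 * n), tau p (D ∩ ball x (2 * n)) x u ≤ g * (X:ℝ) ^ α :=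
      hG _ _ (Finset.mem_inter.2 ⟨hx, self_mem_ball _ _⟩)
    have hS2 : ∑ v ∈ D, tau p D v y ≤ g * (X:ℝ) ^ α :=
      sum_flip_le hp (by positivity) (fun x hx => hG D x hx) y
    have hdiv : ∀ k : ℝ, 0 < k → (r / k) ^ (-(d:ℝ) - α) = k ^ ((d:ℝ) + α) * T := by
      intro k hk
      rw [Real.div_rpow hr0.le hk.le, div_eq_mul_inv, ← Real.rpow_neg hk.le, mul_comm]
      congr 2; ring
    have hF : ∀ u ∈ D ∩ ball x (2 * n), n ≤ 2 * normInf (u - x) →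
        tau p (D ∩ ball x (2 * n)) x u ≤ C * (X:ℝ) ^ (2 * α) * (8 ^ ((d:ℝ) + α) * T) := by
      intro u hu hun
      have hu2 := mem_ball.1 (Finset.mem_inter.1 hu).2
      rw [normInf_comm] at hun hu2
      refine (ih (normInf (x - u)) (by omega) (D ∩ ball x (2 * n)) x u
        (Finset.mem_inter.2 ⟨hx, self_mem_ball _ _⟩) (ne_of_normInf (by omega)) rfl).trans ?_
      refine mul_le_mul_of_nonneg_left ?_ (by positivity)
      rw [← hdiv 8 (by norm_num)]
      refine Real.rpow_le_rpow_of_nonpos (by positivity) ?_ (by linarith)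
      have : (n:ℝ) ≤ 2 * normInf (x - u) := by exact_mod_cast hun
      linarith
    have hs := split_lemma H hx hn (y := y) (by omega) hη0 hη2 hS1 hS2 (by positivity) hF
    refine hs.trans ?_
    have hXX : (X:ℝ) ^ α * (X:ℝ) ^ α = (X:ℝ) ^ (2 * α) := by
      rw [← Real.rpow_add hX0]; congr 1; ring
    have e1 : b * (η * n) ^ (-(d:ℝ) - α) * (g * (X:ℝ) ^ α) * (g * (X:ℝ) ^ α) ≤
        C / 2 * (X:ℝ) ^ (2 * α) * T := by
      have e0 : (n:ℝ) ^ (-(d:ℝ) - α) ≤ 4 ^ ((d:ℝ) + α) * T := by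
        rw [← hdiv 4 (by norm_num)]
        exact Real.rpow_le_rpow_of_nonpos (by positivity) hnr (by linarith)
      rw [Real.mul_rpow hη0.le hn0.le]
      calc b * (η ^ (-(d:ℝ) - α) * (n:ℝ) ^ (-(d:ℝ) - α)) * (g * (X:ℝ) ^ α) * (g * (X:ℝ) ^ α)
          = b * (η ^ (-(d:ℝ) - α) * (n:ℝ) ^ (-(d:ℝ) - α)) * g ^ 2 *
            ((X:ℝ) ^ α * (X:ℝ) ^ α) := by ring
        _ = b * (η ^ (-(d:ℝ) - α) * (n:ℝ) ^ (-(d:ℝ) - α)) * g ^ 2 * (X:ℝ) ^ (2 * α) := by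
            rw [hXX]
        _ ≤ b * (η ^ (-(d:ℝ) - α) * (4 ^ ((d:ℝ) + α) * T)) * g ^ 2 * (X:ℝ) ^ (2 * α) := by
            gcongr
        _ = (b * η ^ (-(d:ℝ) - α) * 4 ^ ((d:ℝ) + α) * g ^ 2) * (X:ℝ) ^ (2 * α) * T := by ring
        _ ≤ _ := by
            have : b * η ^ (-(d:ℝ) - α) * 4 ^ ((d:ℝ) + α) * g ^ 2 ≤ C / 2 := by
              rw [hC]; linarith
            gcongr
    have e2 : C * (X:ℝ) ^ (2 * α) * (8 ^ ((d:ℝ) + α) * T) *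
        (b * K * η ^ (1 - α) * (n:ℝ) ^ (-α)) * (g * (X:ℝ) ^ α) ≤
        C / 2 * (X:ℝ) ^ (2 * α) * T := by
      have e0 : (n:ℝ) ^ (-α) * (X:ℝ) ^ α ≤ 4 := by
        calc (n:ℝ) ^ (-α) * (X:ℝ) ^ α ≤ (n:ℝ) ^ (-α) * (4 * n) ^ α := by gcongr
          _ = 4 ^ α * ((n:ℝ) ^ (-α) * (n:ℝ) ^ α) := by
              rw [Real.mul_rpow (by norm_num) hn0.le]; ring
          _ = 4 ^ α := by rw [← Real.rpow_add hn0, neg_add_cancel, Real.rpow_zero, mul_one]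
          _ ≤ 4 ^ (1:ℝ) := Real.rpow_le_rpow_of_exponent_le (by norm_num) h1.le
          _ = 4 := Real.rpow_one 4
      calc _ = C * (X:ℝ) ^ (2 * α) * T * (8 ^ ((d:ℝ) + α) * b * K * η ^ (1 - α) * g) *
            ((n:ℝ) ^ (-α) * (X:ℝ) ^ α) := by ring
        _ ≤ C * (X:ℝ) ^ (2 * α) * T * (8 ^ ((d:ℝ) + α) * b * K * η ^ (1 - α) * g) * 4 := by
            gcongr
        _ = C * (X:ℝ) ^ (2 * α) * T * (8 ^ ((d:ℝ) + α) * b * K * 4 * g * η ^ (1 - α)) := by ring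
        _ ≤ C * (X:ℝ) ^ (2 * α) * T * (1 / 2) := by gcongr
        _ = _ := by ring
    calc _ ≤ C / 2 * (X:ℝ) ^ (2 * α) * T + C / 2 * (X:ℝ) ^ (2 * α) * T := add_le_add e1 e2
      _ = _ := by ring

end Up2

section Low
variable {d : ℕ} {α a b A ε : ℝ} {p : Sym2 (V d) → ℝ}

lemma tau_self (D : Finset (V d)) (x : V d) : tau p D x x = 1 := by
  unfold tau Pr
  rw [← Ex_const (p := p) (s := D.sym2) 1]
  exact Ex_congr fun ω hω => ind_true (Cn.refl _ _)

lemma avg_phi (hp : PP p) (D : Finset (V d)) (x : V d) {n : ℕ} (hn : 1 ≤ n) :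
    ∃ j, j ≤ 2 * n ∧ ∑ u ∈ D ∩ ball x j, ∑ v ∈ D \ ball x j, tau p (D ∩ ball x j) x u * p s(u, v) ≤
      ∑ u ∈ D ∩ ball x (2 * n), ∑ v ∈ D, tau p (D ∩ ball x (2 * n)) x u * kap p x n u v := by
  classical
  set D' := D ∩ ball x (2 * n) with hD'
  have hn0 : (0:ℝ) < n := by exact_mod_cast hn
  have hj : ∀ j ∈ Finset.Ico n (2 * n),
      ∑ u ∈ D ∩ ball x j, ∑ v ∈ D \ ball x j, tau p (D ∩ ball x j) x u * p s(u, v) ≤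
      ∑ u ∈ D', ∑ v ∈ D, tau p D' x u * p s(u, v) *
        (if normInf (u - x) ≤ j ∧ j < normInf (v - x) then 1 else 0) := by
    intro j hj
    have hj' := Finset.mem_Ico.1 hj
    have hsub : D ∩ ball x j ⊆ D' :=
      Finset.inter_subset_inter_left (ball_mono x (by omega))
    calc _ ≤ ∑ u ∈ D ∩ ball x j, ∑ v ∈ D \ ball x j, tau p D' x u * p s(u, v) *
        (if normInf (u - x) ≤ j ∧ j < normInf (v - x) then 1 else 0) := by
          refine Finset.sum_le_sum fun u hu => Finset.sum_le_sum fun v hv => ?_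
          have hu' := mem_ball.1 (Finset.mem_inter.1 hu).2
          have hv' : j < normInf (v - x) := by
            have := (Finset.mem_sdiff.1 hv).2
            rw [mem_ball] at this; omega
          rw [if_pos ⟨hu', hv'⟩, mul_one]
          exact mul_le_mul_of_nonneg_right (tau_mono hp hsub _ _) (hp _).1
      _ ≤ _ := by
          have hnn : ∀ u v, 0 ≤ tau p D' x u * p s(u, v) *
            (if normInf (u - x) ≤ j ∧ j < normInf (v - x) then 1 else 0) := fun u v =>
            mul_nonneg (mul_nonneg (tau_nonneg hp _ _ _) (hp _).1)
              (by split_ifs <;> norm_num)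
          refine (Finset.sum_le_sum fun u _ => Finset.sum_le_sum_of_subset_of_nonneg
            Finset.sdiff_subset fun v _ _ => hnn u v).trans ?_
          exact Finset.sum_le_sum_of_subset_of_nonneg hsub
            fun u _ _ => Finset.sum_nonneg fun v _ => hnn u v
  have hs := Finset.sum_le_sum hj
  have e2 : ∑ j ∈ Finset.Ico n (2 * n), ∑ u ∈ D', ∑ v ∈ D,
      tau p D' x u * p s(u, v) *
        (if normInf (u - x) ≤ j ∧ j < normInf (v - x) then (1:ℝ) else 0) =
      n * ∑ u ∈ D', ∑ v ∈ D, tau p D' x u * kap p x n u v := by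
    rw [Finset.sum_comm, Finset.mul_sum]
    refine Finset.sum_congr rfl fun u _ => ?_
    rw [Finset.sum_comm, Finset.mul_sum]
    refine Finset.sum_congr rfl fun v _ => ?_
    rw [← Finset.mul_sum, Finset.sum_boole, kap]
    field_simp
  rw [e2] at hs
  have hcard : (n:ℝ) * ∑ u ∈ D', ∑ v ∈ D, tau p D' x u * kap p x n u v =
      ∑ _j ∈ Finset.Ico n (2 * n), ∑ u ∈ D', ∑ v ∈ D, tau p D' x u * kap p x n u v := by
    rw [Finset.sum_const, Nat.card_Ico, nsmul_eq_mul, show 2 * n - n = n by omega]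
  rw [hcard] at hs
  obtain ⟨j, hj1, hj2⟩ := Finset.exists_le_of_sum_le (Finset.nonempty_Ico.2 (by omega)) hs
  exact ⟨j, (Finset.mem_Ico.1 hj1).2.le, hj2⟩

lemma phi_half (H : Hyp d α a b p) {n : ℕ} (hn : 1 ≤ n)
    (hE : b * (Kd d (1 - α) + Kd d α) * (n:ℝ) ^ (-α) *
      ∑ u ∈ ball (0 : V d) (2 * n), tau p (ball 0 (2 * n)) 0 u ≤ 1 / 2)
    (D : Finset (V d)) (x : V d) :
    ∃ j, j ≤ 2 * n ∧ ∑ u ∈ D ∩ ball x j, ∑ v ∈ D \ ball x j,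
      tau p (D ∩ ball x j) x u * p s(u, v) ≤ 1 / 2 := by
  have hp := H.pp
  obtain ⟨j, hj, h⟩ := avg_phi hp D x hn
  have h0 := H.h0
  have h1 := H.h1
  have hb := H.hb
  have hK0 : 0 < Kd d (1 - α) := Kd_pos H.hd (by linarith)
  have hK1 : 0 < Kd d α := Kd_pos H.hd h0
  refine ⟨j, hj, h.trans (le_trans ?_ hE)⟩
  calc _ ≤ ∑ u ∈ D ∩ ball x (2 * n), tau p (ball x (2 * n)) x u *
        (b * (Kd d (1 - α) + Kd d α) * (n:ℝ) ^ (-α)) := by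
        refine Finset.sum_le_sum fun u _ => ?_
        rw [← Finset.mul_sum]
        refine mul_le_mul (tau_mono hp Finset.inter_subset_right _ _) (kapsum1 H x u hn D)
          (Finset.sum_nonneg fun v _ => kap_nonneg hp _ _ _ _) (tau_nonneg hp _ _ _)
    _ ≤ ∑ u ∈ ball x (2 * n), tau p (ball x (2 * n)) x u *
        (b * (Kd d (1 - α) + Kd d α) * (n:ℝ) ^ (-α)) := by
        refine Finset.sum_le_sum_of_subset_of_nonneg Finset.inter_subset_right fun u _ _ => ?_
        exact mul_nonneg (tau_nonneg hp _ _ _) (by positivity)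
    _ = _ := by rw [← Finset.sum_mul, ball_sum_trans H, mul_comm]

lemma chi_fin (H : Hyp d α a b p) {n : ℕ} (hn : 1 ≤ n)
    (hE : b * (Kd d (1 - α) + Kd d α) * (n:ℝ) ^ (-α) *
      ∑ u ∈ ball (0 : V d) (2 * n), tau p (ball 0 (2 * n)) 0 u ≤ 1 / 2)
    (D : Finset (V d)) : ∀ x ∈ D, ∑ y ∈ D, tau p D x y ≤ 2 * ((4 * n + 1) ^ d : ℕ) := by
  have hp := H.pp
  choose j hj1 hj2 using fun x => phi_half H hn hE D x
  refine chi_bound hp (fun x => ball x (j x)) (fun x => self_mem_ball _ _) (fun x => ?_)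
    (fun x _ => hj2 x)
  rw [card_ball]
  exact Nat.pow_le_pow_left (by have := hj1 x; omega) d

lemma chi_half (H : Hyp d α a b p) {n : ℕ} (hn : 1 ≤ n)
    (hE : b * (Kd d (1 - α) + Kd d α) * (n:ℝ) ^ (-α) *
      ∑ u ∈ ball (0 : V d) (2 * n), tau p (ball 0 (2 * n)) 0 u ≤ 1 / 2)
    (D : Finset (V d)) {x : V d} (hx : x ∈ D) {G : ℝ} (hG0 : 0 ≤ G)
    (hG : ∀ v ∈ D, ∑ y ∈ D, tau p D v y ≤ G) :
    ∑ y ∈ D \ ball x (2 * n), tau p D x y ≤ G / 2 := by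
  have hp := H.pp
  obtain ⟨j, hj1, hj2⟩ := phi_half H hn hE D x
  have := chi_exit hp hx (self_mem_ball x j) hj2 hG0 hG
  calc _ ≤ ∑ y ∈ D \ ball x j, tau p D x y := by
        refine Finset.sum_le_sum_of_subset_of_nonneg
          (Finset.sdiff_subset_sdiff le_rfl (ball_mono x hj1)) fun u _ _ => tau_nonneg hp _ _ _
    _ ≤ _ := by linarith

lemma LBJ (R : Par d α a b A ε) : ∃ c : ℝ, 0 < c ∧ ∀ p : Sym2 (V d) → ℝ, Hyp d α a b p →
    NB d α A ε p → ∀ x : V d, ∀ n : ℕ, 2 * n < normInf x →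
    c * (normInf x : ℝ) ^ (-(d:ℝ) - α) * (∑ u ∈ ball (0 : V d) n, tau p (ball 0 n) 0 u) ^ 2 ≤
      tau p (ball 0 (2 * normInf x)) 0 x := by
  obtain ⟨hd, h0, h1, had, ha, hb, hA, hε⟩ := R
  refine ⟨a * 2 ^ (-(d:ℝ) - α) / (1 + a * (A + 1) ^ 2) / (1 + 2 / ε) ^ 2, by positivity,
    fun p H hNB x n hn => ?_⟩
  have hp := H.pp
  set r := normInf x with hr
  have hr0 : (0:ℝ) < r := by
    have : 0 < r := by omega
    exact_mod_cast this
  set E := ∑ u ∈ ball (0 : V d) n, tau p (ball 0 n) 0 u with hE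
  set l := a * (2 * (r:ℝ)) ^ (-(d:ℝ) - α) with hl
  have hl0 : 0 < l := by positivity
  have hdist : ∀ u ∈ ball (0 : V d) n, ∀ v ∈ ball x n, u ≠ v ∧ normInf (u - v) ≤ 2 * r := by
    intro u hu v hv
    have hu' := mem_ball.1 hu
    have hv' := mem_ball.1 hv
    rw [sub_zero] at hu'
    have h1 := normInf_tri u x v
    have h2 := normInf_tri x u 0
    rw [sub_zero, sub_zero] at h2
    have h3 := normInf_add_le u (-x)
    rw [← sub_eq_add_neg, normInf_neg] at h3
    have h4 := normInf_comm v x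
    have h5 := normInf_tri u v x
    have h6 := normInf_comm u x
    refine ⟨fun h => ?_, by omega⟩
    subst h
    omega
  have hball : ∀ v : V d, Pr p (ball v n).sym2
      (fun ω => ∃ u, mm d α A (2 * n + 1) ≤ cs (ball v n) ω u) ≤ 1 - ε := by
    intro v
    rw [ball_eq_Q]
    exact NB_Q H hNB _ (by omega)
  have hj := join_tight hp (D := ball 0 (2 * r)) (D1 := ball 0 n) (D2 := ball x n)
    (ball_mono 0 (by omega)) (ball_subset (by rw [sub_zero]; omega))
    (Finset.disjoint_left.2 fun u hu hv => (hdist u hu u hv).1 rfl) hl0.le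
    (fun u hu v hv => lo_mono H (hdist u hu v hv).1 (by exact_mod_cast (hdist u hu v hv).2))
    0 x (m := mm d α A (2 * n + 1)) (mm_pos hA (by omega)) hε (hball 0) (hball x)
  rw [ball_sum_trans H x n, ← hE] at hj
  set m := mm d α A (2 * n + 1) with hm
  have hlm : l * (m:ℝ) ^ 2 ≤ a * (A + 1) ^ 2 := by
    have e1 := mm_sq (d := d) h0 hA (N := 2 * n + 1) (by omega)
    have e2 : ((2 * n + 1 : ℕ) : ℝ) ^ ((d:ℝ) + α) ≤ (2 * (r:ℝ)) ^ ((d:ℝ) + α) := by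
      refine Real.rpow_le_rpow (by positivity) ?_ (by positivity)
      have : 2 * n + 1 ≤ 2 * r := by omega
      exact_mod_cast this
    calc l * (m:ℝ) ^ 2 ≤ l * ((A + 1) ^ 2 * (2 * (r:ℝ)) ^ ((d:ℝ) + α)) := by
          refine mul_le_mul_of_nonneg_left (e1.trans ?_) hl0.le
          gcongr
      _ = a * (A + 1) ^ 2 * ((2 * (r:ℝ)) ^ (-(d:ℝ) - α) * (2 * (r:ℝ)) ^ ((d:ℝ) + α)) := by
          rw [hl]; ring
      _ = _ := by
          rw [← Real.rpow_add (by positivity), show -(d:ℝ) - α + ((d:ℝ) + α) = 0 by ring,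
            Real.rpow_zero, mul_one]
  have hE0 : 0 ≤ E := Finset.sum_nonneg fun _ _ => tau_nonneg hp _ _ _
  have e3 : l / (1 + a * (A + 1) ^ 2) * (E * E) ≤ (1 + 2 / ε) ^ 2 * tau p (ball 0 (2 * r)) 0 x := by
    refine le_trans ?_ hj
    gcongr
  rw [← div_le_iff₀' (by positivity)] at e3
  refine le_trans (le_of_eq ?_) e3
  rw [hl, Real.mul_rpow (by norm_num) hr0.le]
  ring

lemma LB (R : Par d α a b A ε) : ∃ c : ℝ, 0 < c ∧ ∀ p : Sym2 (V d) → ℝ, Hyp d α a b p →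
    NB d α A ε p → ∀ x : V d, x ≠ 0 → ∀ M : ℕ, 1 ≤ M → M ≤ normInf x →
    (∀ n : ℕ, 1 ≤ n → 2 * n < M → 1 / 2 < b * (Kd d (1 - α) + Kd d α) * (n:ℝ) ^ (-α) *
      ∑ u ∈ ball (0 : V d) (2 * n), tau p (ball 0 (2 * n)) 0 u) →
    c * (normInf x : ℝ) ^ (-(d:ℝ) - α) * (M:ℝ) ^ (2 * α) ≤
      tau p (ball 0 (2 * normInf x)) 0 x := by
  obtain ⟨c, hc, hL⟩ := LBJ R
  obtain ⟨hd, h0, h1, had, ha, hb, hA, hε⟩ := R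
  have hK0 : 0 < Kd d (1 - α) := Kd_pos hd (by linarith)
  have hK1 : 0 < Kd d α := Kd_pos hd h0
  set C2 := b * (Kd d (1 - α) + Kd d α) with hC2
  have hC20 : 0 < C2 := by positivity
  set κ := min (1 / 4) (1 / (16 * C2)) with hκ
  have hκ0 : 0 < κ := by positivity
  refine ⟨c * κ ^ 2, by positivity, fun p H hNB x hx M hM hMr hyp => ?_⟩
  have hp := H.pp
  set r := normInf x with hr
  have hM0 : (0:ℝ) < M := by exact_mod_cast hM
  set n := (M - 1) / 4 with hn
  have h2n : 2 * (2 * n) < r := by omega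
  refine le_trans ?_ (hL p H hNB x (2 * n) h2n)
  set E := ∑ u ∈ ball (0 : V d) (2 * n), tau p (ball 0 (2 * n)) 0 u with hE
  have hEk : κ * (M:ℝ) ^ α ≤ E := by
    rcases Nat.eq_zero_or_pos n with h | h
    · have hE1 : 1 ≤ E := by
        rw [← tau_self (p := p) (ball 0 (2 * n)) 0]
        exact Finset.single_le_sum (f := fun u => tau p (ball 0 (2 * n)) 0 u)
          (fun u _ => tau_nonneg hp _ _ _) (self_mem_ball _ _)
      have hM4 : (M:ℝ) ≤ 4 := by
        have : M ≤ 4 := by omega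
        exact_mod_cast this
      have : (M:ℝ) ^ α ≤ 4 := by
        calc (M:ℝ) ^ α ≤ 4 ^ α := Real.rpow_le_rpow hM0.le hM4 h0.le
          _ ≤ 4 ^ (1:ℝ) := Real.rpow_le_rpow_of_exponent_le (by norm_num) h1.le
          _ = 4 := Real.rpow_one 4
      calc κ * (M:ℝ) ^ α ≤ 1 / 4 * 4 := by
            refine mul_le_mul (min_le_left _ _) this (by positivity) (by norm_num)
        _ ≤ E := by linarith
    · have h3 := hyp n h (by omega)
      have hn0 : (0:ℝ) < n := by exact_mod_cast h
      have hMn : (M:ℝ) ≤ 8 * n := by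
        have : M ≤ 8 * n := by omega
        exact_mod_cast this
      have : (M:ℝ) ^ α ≤ 8 * (n:ℝ) ^ α := by
        calc (M:ℝ) ^ α ≤ (8 * n) ^ α := Real.rpow_le_rpow hM0.le hMn h0.le
          _ = 8 ^ α * (n:ℝ) ^ α := Real.mul_rpow (by norm_num) hn0.le
          _ ≤ 8 ^ (1:ℝ) * (n:ℝ) ^ α := by
            gcongr
            · norm_num
          _ = 8 * (n:ℝ) ^ α := by rw [Real.rpow_one]
      have hnn : (n:ℝ) ^ α * (n:ℝ) ^ (-α) = 1 := by
        rw [← Real.rpow_add hn0, add_neg_cancel, Real.rpow_zero]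
      calc κ * (M:ℝ) ^ α ≤ 1 / (16 * C2) * (8 * (n:ℝ) ^ α) := by
            refine mul_le_mul (min_le_right _ _) this (by positivity) (by positivity)
        _ = (n:ℝ) ^ α / C2 * (1 / 2) := by field_simp; norm_num
        _ ≤ (n:ℝ) ^ α / C2 * (C2 * (n:ℝ) ^ (-α) * E) := by gcongr
        _ = ((n:ℝ) ^ α * (n:ℝ) ^ (-α)) * E := by field_simp
        _ = E := by rw [hnn, one_mul]
  calc c * κ ^ 2 * (r:ℝ) ^ (-(d:ℝ) - α) * (M:ℝ) ^ (2 * α) =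
      c * (r:ℝ) ^ (-(d:ℝ) - α) * (κ * (M:ℝ) ^ α) ^ 2 := by
        rw [mul_pow, ← Real.rpow_natCast ((M:ℝ) ^ α), ← Real.rpow_mul hM0.le,
          show α * ((2:ℕ):ℝ) = 2 * α by push_cast; ring]; ring
    _ ≤ _ := by gcongr

end Low

section Renorm
variable {d : ℕ} {α a b : ℝ} {p : Sym2 (V d) → ℝ}

lemma comb {κ W : Type*} [DecidableEq κ] [DecidableEq W] [Inhabited W] (u : Finset κ)
    {D : Finset W} (B : κ → Finset W)
    (hB : ∀ i ∈ u, B i ⊆ D) (hdis : ∀ i ∈ u, ∀ j ∈ u, i ≠ j → Disjoint (B i) (B j))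
    (x : κ → W) (ω : Finset (Sym2 W)) (k : ℕ) (G : κ → Prop)
    (hG : ∀ i ∈ u, G i → k ≤ cs (B i) (ω ∩ (B i).sym2) (x i))
    (hbad : ∀ i ∈ u, ∀ j ∈ u, i ≠ j → ¬ G i → G j)
    (hconn : ∀ i ∈ u, ∀ j ∈ u, i ≠ j → G i → G j → Cn ω (x i) (x j)) :
    ∃ z, (u.card - 1) * k ≤ cs D ω z := by
  classical
  set g := u.filter G with hg
  have hcard : u.card - 1 ≤ g.card := by
    have h1 : (u.filter (fun i => ¬ G i)).card ≤ 1 := by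
      rw [Finset.card_le_one]
      intro i hi j hj
      rw [Finset.mem_filter] at hi hj
      by_contra hne
      exact hj.2 (hbad i hi.1 j hj.1 hne hi.2)
    have h2 := Finset.card_filter_add_card_filter_not (s := u) G
    rw [← hg] at h2
    omega
  rcases g.eq_empty_or_nonempty with h | ⟨i0, hi0⟩
  · rw [h, Finset.card_empty] at hcard
    refine ⟨default, ?_⟩
    rw [Nat.le_zero.1 hcard]; simp
  · refine ⟨x i0, ?_⟩
    have hi0' := Finset.mem_filter.1 hi0
    calc (u.card - 1) * k ≤ g.card * k := Nat.mul_le_mul_right k hcard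
      _ = ∑ i ∈ g, k := by rw [Finset.sum_const, smul_eq_mul]
      _ ≤ ∑ i ∈ g, (cl (B i) (ω ∩ (B i).sym2) (x i)).card :=
          Finset.sum_le_sum fun i hi => hG i (Finset.mem_filter.1 hi).1 (Finset.mem_filter.1 hi).2
      _ = (g.biUnion fun i => cl (B i) (ω ∩ (B i).sym2) (x i)).card := by
          rw [Finset.card_biUnion]
          intro i hi j hj hij
          refine Finset.disjoint_left.2 fun y hy hy' => ?_
          exact Finset.disjoint_left.1 (hdis i (Finset.mem_filter.1 hi).1 j
            (Finset.mem_filter.1 hj).1 hij) (mem_cl.1 hy).1 (mem_cl.1 hy').1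
      _ ≤ cs D ω (x i0) := by
          refine Finset.card_le_card fun y hy => ?_
          obtain ⟨i, hi, hy⟩ := Finset.mem_biUnion.1 hy
          have hi' := Finset.mem_filter.1 hi
          rw [mem_cl] at hy ⊢
          refine ⟨hB i hi'.1 hy.1, ?_⟩
          have h3 : Cn ω (x i) y := hy.2.mono Finset.inter_subset_left
          by_cases hii : i0 = i
          · rw [hii]; exact h3
          · exact (hconn i0 hi0'.1 i hi'.1 hii hi0'.2 hi'.2).trans h3

lemma sym2_disj {W : Type*} [DecidableEq W] {s t : Finset W} (h : Disjoint s t) :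
    Disjoint s.sym2 t.sym2 := by
  rw [Finset.disjoint_left]
  intro e
  induction e with
  | _ x y =>
    intro h1 h2
    exact Finset.disjoint_left.1 h (Finset.mk_mem_sym2_iff.1 h1).1 (Finset.mk_mem_sym2_iff.1 h2).1

open Classical in
/-- a chosen vertex in a big cluster -/
noncomputable def pick (B : Finset (V d)) (k : ℕ) (η : Finset (Sym2 (V d))) : V d :=
  if h : ∃ x, k ≤ cs B η x then h.choose else 0

lemma pick_spec {B : Finset (V d)} {k : ℕ} {η : Finset (Sym2 (V d))}
    (h : ∃ x, k ≤ cs B η x) : k ≤ cs B η (pick B k η) := by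
  rw [pick, dif_pos h]; exact h.choose_spec

lemma renorm_pair (H : Hyp d α a b p) {D D1 D2 : Finset (V d)} (h1 : D1 ⊆ D) (h2 : D2 ⊆ D)
    (hd : Disjoint D1 D2) {l : ℝ} (hl0 : 0 ≤ l)
    (hl : ∀ u ∈ D1, ∀ v ∈ D2, 1 - p s(u, v) ≤ Real.exp (-l)) {k : ℕ} {e : ℝ} (he0 : 0 ≤ e)
    (he1 : Pr p D1.sym2 (fun ω => ¬ ∃ x, k ≤ cs D1 ω x) ≤ e)
    (he2 : Pr p D2.sym2 (fun ω => ¬ ∃ x, k ≤ cs D2 ω x) ≤ e) :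
    Pr p D.sym2 (fun ω => ((¬ ∃ x, k ≤ cs D1 (ω ∩ D1.sym2) x) ∧
        (¬ ∃ x, k ≤ cs D2 (ω ∩ D2.sym2) x)) ∨
      (((∃ x, k ≤ cs D1 (ω ∩ D1.sym2) x) ∧ (∃ x, k ≤ cs D2 (ω ∩ D2.sym2) x)) ∧
        ¬ Cn ω (pick D1 k (ω ∩ D1.sym2)) (pick D2 k (ω ∩ D2.sym2)))) ≤
      e ^ 2 + Real.exp (-(l * k ^ 2)) := by
  have hp := H.pp
  refine (Pr_or_le hp _ _).trans (add_le_add ?_ ?_)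
  · unfold Pr
    simp only [ind_and]
    rw [Ex_prod_two (sym2_disj hd) (fun ω η => ind (¬ ∃ x, k ≤ cs D1 ω x) *
      ind (¬ ∃ x, k ≤ cs D2 η x)) (Finset.sym2_mono h1) (Finset.sym2_mono h2)]
    simp only [Ex_mul]
    rw [Ex_mul_right, pow_two]
    exact mul_le_mul he1 he2 (Pr_nonneg hp _) he0
  · unfold Pr
    simp only [ind_and (_ ∧ _) (¬ Cn _ _ _)]
    refine (JL hp h1 h2 hd hl (pick D1 k) (pick D2 k) (fun ω η => ind ((∃ x, k ≤ cs D1 ω x) ∧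
      (∃ x, k ≤ cs D2 η x))) (fun _ _ => ind_nonneg _)).trans ?_
    rw [← Ex_const (p := p) (s := D1.sym2) (Real.exp _)]
    refine Ex_mono hp fun ω _ => ?_
    rw [← Ex_const (p := p) (s := D2.sym2) (Real.exp _)]
    refine Ex_mono hp fun η _ => ?_
    by_cases h : (∃ x, k ≤ cs D1 ω x) ∧ (∃ x, k ≤ cs D2 η x)
    · rw [ind_true h, one_mul, Real.exp_le_exp, neg_le_neg_iff]
      refine mul_le_mul_of_nonneg_left ?_ hl0
      rw [pow_two]
      have e1 : (k:ℝ) ≤ cs D1 ω (pick D1 k ω) := by exact_mod_cast pick_spec h.1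
      have e2 : (k:ℝ) ≤ cs D2 η (pick D2 k η) := by exact_mod_cast pick_spec h.2
      exact mul_le_mul e1 e2 (by positivity) (by positivity)
    · rw [ind_false h, zero_mul]; positivity

lemma renorm_step (H : Hyp d α a b p) {N L k : ℕ} (hN : 1 ≤ N) {e : ℝ} (he0 : 0 ≤ e)
    (he : Pr p (Q 0 N).sym2 (fun ω => ¬ ∃ x, k ≤ cs (Q (0 : V d) N) ω x) ≤ e) :
    Pr p (Q 0 (L * N)).sym2 (fun ω => ¬ ∃ x, (L ^ d - 1) * k ≤ cs (Q (0 : V d) (L * N)) ω x) ≤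
      ((L:ℝ) ^ d) ^ 2 * (e ^ 2 + Real.exp (-(a * ((L * N : ℕ):ℝ) ^ (-(d:ℝ) - α) * k ^ 2))) := by
  classical
  have hp := H.pp
  have ha := H.ha
  set D := Q (0 : V d) (L * N) with hD
  set B : V d → Finset (V d) := fun i => Q (fun t => N * i t) N with hB
  have hNz : (1:ℤ) ≤ N := by exact_mod_cast hN
  have hBD : ∀ i ∈ Q (0 : V d) L, B i ⊆ D := by
    intro i hi y hy
    rw [hD, mem_Q]
    rw [hB, mem_Q] at hy
    intro t
    have h1 := mem_Q.1 hi t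
    have h2 := hy t
    simp only [Pi.zero_apply, zero_add] at h1 ⊢
    refine ⟨?_, ?_⟩
    · exact le_trans (mul_nonneg (by omega) h1.1) h2.1
    · push_cast; nlinarith
  have hdis : ∀ i j, i ≠ j → Disjoint (B i) (B j) := by
    intro i j hij
    obtain ⟨t, ht⟩ := Function.ne_iff.1 hij
    refine Finset.disjoint_left.2 fun y hy hy' => ?_
    have h1 := mem_Q.1 hy t
    have h2 := mem_Q.1 hy' t
    rcases lt_or_gt_of_ne ht with h | h
    · have : i t + 1 ≤ j t := h
      nlinarith
    · have : j t + 1 ≤ i t := h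
      nlinarith
  set l := a * ((L * N : ℕ):ℝ) ^ (-(d:ℝ) - α) with hl
  have hl0 : 0 ≤ l := by positivity
  have heB : ∀ i, Pr p (B i).sym2 (fun ω => ¬ ∃ x, k ≤ cs (B i) ω x) ≤ e := by
    intro i
    rw [Pr_not] at he ⊢
    rw [hB]; dsimp only
    rw [Pr_Q H]; exact he
  set F : V d × V d → Finset (Sym2 (V d)) → Prop := fun q ω =>
    ((¬ ∃ x, k ≤ cs (B q.1) (ω ∩ (B q.1).sym2) x) ∧
        (¬ ∃ x, k ≤ cs (B q.2) (ω ∩ (B q.2).sym2) x)) ∨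
      (((∃ x, k ≤ cs (B q.1) (ω ∩ (B q.1).sym2) x) ∧ (∃ x, k ≤ cs (B q.2) (ω ∩ (B q.2).sym2) x)) ∧
        ¬ Cn ω (pick (B q.1) k (ω ∩ (B q.1).sym2)) (pick (B q.2) k (ω ∩ (B q.2).sym2))) with hF
  calc _ ≤ Pr p D.sym2 (fun ω => ∃ q ∈ (Q (0 : V d) L).offDiag, F q ω) := by
        refine Pr_mono hp fun ω _ hω => ?_
        by_contra hcon
        push Not at hcon
        apply hω
        have := comb (Q (0 : V d) L) (D := D) B hBD (fun i _ j _ hij => hdis i j hij)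
          (fun i => pick (B i) k (ω ∩ (B i).sym2)) ω k
          (fun i => ∃ x, k ≤ cs (B i) (ω ∩ (B i).sym2) x) (fun i _ hi => pick_spec hi)
          (fun i hi j hj hij hb => by
            by_contra hb2
            exact hcon (i, j) (Finset.mem_offDiag.2 ⟨hi, hj, hij⟩) (Or.inl ⟨hb, hb2⟩))
          (fun i hi j hj hij g1 g2 => by
            by_contra hb2
            exact hcon (i, j) (Finset.mem_offDiag.2 ⟨hi, hj, hij⟩) (Or.inr ⟨⟨g1, g2⟩, hb2⟩))
        rwa [card_Q] at this
    _ ≤ ∑ q ∈ (Q (0 : V d) L).offDiag, Pr p D.sym2 (F q) := Pr_exists_le hp _ _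
    _ ≤ ∑ q ∈ (Q (0 : V d) L).offDiag, (e ^ 2 + Real.exp (-(l * k ^ 2))) := by
        refine Finset.sum_le_sum fun q hq => ?_
        obtain ⟨hi, hj, hij⟩ := Finset.mem_offDiag.1 hq
        refine renorm_pair H (hBD _ hi) (hBD _ hj) (hdis _ _ hij) hl0 ?_ he0 (heB _) (heB _)
        intro u hu v hv
        refine lo_mono H ?_ ?_
        · rintro rfl
          exact Finset.disjoint_left.1 (hdis _ _ hij) hu hv
        · exact_mod_cast Q_dist (hBD _ hi hu) (hBD _ hj hv)
    _ ≤ _ := by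
        rw [Finset.sum_const, nsmul_eq_mul]
        refine mul_le_mul_of_nonneg_right ?_ (by positivity)
        rw [Finset.offDiag_card, card_Q, pow_two]
        exact_mod_cast Nat.sub_le _ _

end Renorm

section Renorm2
variable {d : ℕ} {α a b : ℝ} {p : Sym2 (V d) → ℝ}

/-- Renormalization invariant. -/
structure RI (d : ℕ) (α a : ℝ) (p : Sym2 (V d) → ℝ) (n0 : ℕ) (K δ ρ : ℝ) (n N k : ℕ) : Prop where
  hN : 1 ≤ N
  hk : n + 1 ≤ k
  bad : Pr p (Q 0 N).sym2 (fun ω => ¬ ∃ x, k ≤ cs (Q (0 : V d) N) ω x) ≤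
    δ / (((2:ℝ) ^ (n + n0)) ^ d) ^ 3
  big : K * (((2:ℝ) ^ (n + n0)) ^ d) ^ 3 * (N:ℝ) ^ ((d:ℝ) + α) ≤ a * (k:ℝ) ^ 2
  den : (1 / 2 + (1 / 2) ^ (n + 1)) * (ρ * (N:ℝ) ^ d) ≤ k

lemma exp_five {y : ℝ} (hy : 0 < y) : Real.exp (-y) ≤ 120 / y ^ 5 := by
  have h := Real.pow_div_factorial_le_exp y hy.le 5
  rw [Real.exp_neg, ← one_div, div_le_div_iff₀ (Real.exp_pos y) (by positivity)]
  have : ((Nat.factorial 5 : ℕ) : ℝ) = 120 := by norm_num [Nat.factorial]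
  rw [this, div_le_iff₀ (by norm_num)] at h
  linarith

lemma RI_step (H : Hyp d α a b p) {n0 : ℕ} {K δ ρ : ℝ} (hn0 : 2 ≤ n0)
    (hn0' : 4 * 8 ^ d ≤ ((2:ℝ) ^ n0) ^ ((d:ℝ) - α)) (hδ : δ = 1 / (2 * 8 ^ d))
    (hK : K = 240 * 8 ^ d / δ) (hρ : 0 ≤ ρ) {n N k : ℕ} (h : RI d α a p n0 K δ ρ n N k) :
    ∃ N' k', RI d α a p n0 K δ ρ (n + 1) N' k' := by
  obtain ⟨hN, hk, bad, big, den⟩ := h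
  have h0 := H.h0
  have had := H.had
  have ha := H.ha
  have hδ0 : 0 < δ := by rw [hδ]; positivity
  have hδ1 : δ ≤ 1 := by
    rw [hδ, div_le_one (by positivity)]
    have : (1:ℝ) ≤ 8 ^ d := one_le_pow₀ (by norm_num)
    linarith
  have h8 : (1:ℝ) ≤ 8 ^ d := one_le_pow₀ (by norm_num)
  have hK1 : 1 ≤ K := by
    rw [hK, le_div_iff₀ hδ0]; linarith
  set L := 2 ^ (n + n0) with hL
  have hLr : (L:ℝ) = 2 ^ (n + n0) := by rw [hL]; push_cast; rfl
  rw [← hLr] at bad big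
  have hL1 : 1 ≤ L := Nat.one_le_two_pow
  have hL0 : (0:ℝ) < L := by exact_mod_cast hL1
  have hN0 : (0:ℝ) < N := by exact_mod_cast hN
  set q : ℝ := (L:ℝ) ^ d with hq
  have hLd : (2:ℝ) ^ (n + 2) ≤ q := by
    have : (L:ℝ) ^ 1 ≤ (L:ℝ) ^ d := pow_le_pow_right₀ (by exact_mod_cast hL1) H.hd
    rw [pow_one] at this
    refine le_trans ?_ this
    rw [hLr]
    exact pow_le_pow_right₀ (by norm_num) (by omega)
  have hq4 : 4 ≤ q := by
    refine le_trans ?_ hLd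
    calc (4:ℝ) = 2 ^ 2 := by norm_num
      _ ≤ 2 ^ (n + 2) := pow_le_pow_right₀ (by norm_num) (by omega)
  have hq0 : 0 < q := by linarith
  have hqn : 4 ≤ L ^ d := by rw [hq] at hq4; exact_mod_cast hq4
  have hcast : ((L ^ d - 1 : ℕ) : ℝ) = q - 1 := by
    rw [Nat.cast_sub (by omega)]; push_cast; rw [hq]
  have hq' : ((2:ℝ) ^ (n + 1 + n0)) ^ d = 2 ^ d * q := by
    rw [hq, hLr, ← mul_pow]; congr 1; ring
  have hq3 : (2 ^ d * q) ^ 3 = 8 ^ d * q ^ 3 := by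
    rw [mul_pow, ← pow_mul, mul_comm d 3, pow_mul]; norm_num
  have hqr : q ^ 2 = (L:ℝ) ^ ((d:ℝ) + α) * (L:ℝ) ^ ((d:ℝ) - α) := by
    rw [← Real.rpow_add hL0, hq, ← pow_mul, ← Real.rpow_natCast]; congr 1; push_cast; ring
  have hLa : 4 * 8 ^ d ≤ (L:ℝ) ^ ((d:ℝ) - α) := by
    refine hn0'.trans (Real.rpow_le_rpow (by positivity) ?_ (by linarith))
    rw [hLr]
    exact pow_le_pow_right₀ (by norm_num) (by omega)
  have hk0 : 1 ≤ k := by omega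
  refine ⟨L * N, (L ^ d - 1) * k, ?_, ?_, ?_, ?_, ?_⟩
  · exact Nat.mul_pos hL1 hN
  · have : 3 * k ≤ (L ^ d - 1) * k := Nat.mul_le_mul_right k (by omega)
    omega
  · refine (renorm_step H hN (by positivity) bad).trans ?_
    rw [hq', hq3, ← hq]
    set y := a * ((L * N : ℕ):ℝ) ^ (-(d:ℝ) - α) * (k:ℝ) ^ 2 with hy
    have hyK : K * q ≤ y := by
      have e1 : ((L * N : ℕ):ℝ) ^ (-(d:ℝ) - α) =
          ((L:ℝ) ^ ((d:ℝ) + α))⁻¹ * ((N:ℝ) ^ ((d:ℝ) + α))⁻¹ := by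
        push_cast
        rw [Real.mul_rpow hL0.le hN0.le, ← Real.rpow_neg hL0.le, ← Real.rpow_neg hN0.le]
        congr 2 <;> ring
      have e2 : (L:ℝ) ^ ((d:ℝ) + α) ≤ q ^ 2 := by
        rw [hqr]
        refine le_mul_of_one_le_right (by positivity) (by linarith)
      have e3 : 0 < (L:ℝ) ^ ((d:ℝ) + α) := by positivity
      have e4 : 0 < (N:ℝ) ^ ((d:ℝ) + α) := by positivity
      have e5 : y = a * (k:ℝ) ^ 2 / ((L:ℝ) ^ ((d:ℝ) + α) * (N:ℝ) ^ ((d:ℝ) + α)) := by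
        rw [hy, e1]; field_simp
      rw [e5, le_div_iff₀ (by positivity)]
      calc K * q * ((L:ℝ) ^ ((d:ℝ) + α) * (N:ℝ) ^ ((d:ℝ) + α)) ≤
          K * q * (q ^ 2 * (N:ℝ) ^ ((d:ℝ) + α)) := by gcongr
        _ = K * q ^ 3 * (N:ℝ) ^ ((d:ℝ) + α) := by ring
        _ ≤ _ := big
    have hexp : Real.exp (-y) ≤ 120 / (K * q ^ 5) := by
      calc Real.exp (-y) ≤ Real.exp (-(K * q)) := Real.exp_le_exp.2 (by linarith)
        _ ≤ 120 / (K * q) ^ 5 := exp_five (by positivity)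
        _ ≤ _ := by
          rw [mul_pow]
          gcongr
          exact le_self_pow₀ hK1 (by norm_num)
    calc q ^ 2 * ((δ / q ^ 3) ^ 2 + Real.exp (-y)) ≤
        q ^ 2 * ((δ / q ^ 3) ^ 2 + 120 / (K * q ^ 5)) := by gcongr
      _ = δ ^ 2 / q ^ 4 + 120 / K / q ^ 3 := by field_simp
      _ ≤ δ ^ 2 / q ^ 3 + 120 / K / q ^ 3 := by
          gcongr
          · linarith
          · norm_num
      _ = δ / (8 ^ d * q ^ 3) := by
          have : 120 / K = δ / (2 * 8 ^ d) := by
            rw [hK]; field_simp; norm_num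
          rw [this, show δ ^ 2 = δ / (2 * 8 ^ d) by rw [pow_two]; nth_rewrite 2 [hδ]; ring]
          field_simp; norm_num
  · rw [hq', hq3]
    push_cast
    rw [hcast, Real.mul_rpow hL0.le hN0.le]
    have e1 : q ^ 2 / 4 ≤ (q - 1) ^ 2 := by nlinarith
    calc K * (8 ^ d * q ^ 3) * ((L:ℝ) ^ ((d:ℝ) + α) * (N:ℝ) ^ ((d:ℝ) + α)) =
        (K * q ^ 3 * (N:ℝ) ^ ((d:ℝ) + α)) * ((L:ℝ) ^ ((d:ℝ) + α) * (4 * 8 ^ d) / 4) := by ring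
      _ ≤ (a * (k:ℝ) ^ 2) * ((L:ℝ) ^ ((d:ℝ) + α) * (L:ℝ) ^ ((d:ℝ) - α) / 4) := by gcongr
      _ = (a * (k:ℝ) ^ 2) * (q ^ 2 / 4) := by rw [hqr]
      _ ≤ (a * (k:ℝ) ^ 2) * (q - 1) ^ 2 := by gcongr
      _ = _ := by ring
  · push_cast
    rw [hcast, mul_pow, ← hq]
    set hh : ℝ := (1 / 2) ^ (n + 1) with hhh
    have hh0 : 0 < hh := by positivity
    have hh1 : hh ≤ 1 / 2 := by
      rw [hhh, pow_succ]
      have : (1 / 2 : ℝ) ^ n ≤ 1 := pow_le_one₀ (by norm_num) (by norm_num)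
      linarith
    have hqh : 1 ≤ q * (hh / 2) := by
      have e : hh / 2 = 1 / 2 ^ (n + 2) := by
        rw [hhh, one_div_pow, pow_succ (2:ℝ) (n+1)]; field_simp
      rw [e, mul_one_div, le_div_iff₀ (by positivity), one_mul]; exact hLd
    have e2 : (1 / 2 : ℝ) ^ (n + 1 + 1) = hh / 2 := by rw [hhh, pow_succ _ (n+1)]; ring
    rw [e2]
    have hT : 0 ≤ ρ * (N:ℝ) ^ d := by positivity
    calc (1 / 2 + hh / 2) * (ρ * (q * (N:ℝ) ^ d)) = (q * (1 / 2 + hh / 2)) * (ρ * (N:ℝ) ^ d) := by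
          ring
      _ ≤ ((q - 1) * (1 / 2 + hh)) * (ρ * (N:ℝ) ^ d) := by
          refine mul_le_mul_of_nonneg_right ?_ hT
          nlinarith [hqh, hh1]
      _ = (q - 1) * ((1 / 2 + hh) * (ρ * (N:ℝ) ^ d)) := by ring
      _ ≤ (q - 1) * k := by
          refine mul_le_mul_of_nonneg_left den (by linarith)

lemma renorm {d : ℕ} {α : ℝ} (had : α < d) : ∃ ε K : ℝ, 0 < ε ∧ ε ≤ 1 / 2 ∧ 0 < K ∧
    ∀ (a b : ℝ) (p : Sym2 (V d) → ℝ), Hyp d α a b p → ∀ N k : ℕ, 1 ≤ N → 1 ≤ k →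
    K * (N:ℝ) ^ ((d:ℝ) + α) ≤ a * (k:ℝ) ^ 2 →
    1 - ε < Pr p (Q 0 N).sym2 (fun ω => ∃ x, k ≤ cs (Q (0 : V d) N) ω x) →
    ∃ ρ : ℝ, 0 < ρ ∧ ∀ m : ℕ, ∃ N' k' : ℕ, 1 ≤ N' ∧ m ≤ k' ∧ ρ * (N':ℝ) ^ d ≤ k' ∧
      1 / 2 ≤ Pr p (Q 0 N').sym2 (fun ω => ∃ x, k' ≤ cs (Q (0 : V d) N') ω x) := by
  have hpos : 0 < (d:ℝ) - α := by linarith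
  obtain ⟨n0, hn0, hn0'⟩ : ∃ n0 : ℕ, 2 ≤ n0 ∧ 4 * 8 ^ d ≤ ((2:ℝ) ^ n0) ^ ((d:ℝ) - α) := by
    have h2 : 1 < (2:ℝ) ^ ((d:ℝ) - α) := Real.one_lt_rpow (by norm_num) hpos
    obtain ⟨m, hm⟩ := pow_unbounded_of_one_lt (4 * (8:ℝ) ^ d) h2
    refine ⟨m + 2, by omega, hm.le.trans ?_⟩
    rw [← Real.rpow_natCast, ← Real.rpow_natCast, ← Real.rpow_mul (by norm_num),
      ← Real.rpow_mul (by norm_num)]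
    refine Real.rpow_le_rpow_of_exponent_le (by norm_num) ?_
    push_cast; nlinarith
  set δ : ℝ := 1 / (2 * 8 ^ d) with hδ
  set K : ℝ := 240 * 8 ^ d / δ with hK
  have hδ0 : 0 < δ := by positivity
  have hδ1 : δ ≤ 1 / 2 := by
    rw [hδ]
    refine div_le_div_of_nonneg_left (by norm_num) (by norm_num) ?_
    have : (1:ℝ) ≤ 8 ^ d := one_le_pow₀ (by norm_num)
    linarith
  have hone : ∀ n : ℕ, (1:ℝ) ≤ (((2:ℝ) ^ (n + n0)) ^ d) ^ 3 := fun n =>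
    one_le_pow₀ (one_le_pow₀ (one_le_pow₀ (by norm_num)))
  have hle : ∀ n : ℕ, δ / (((2:ℝ) ^ (n + n0)) ^ d) ^ 3 ≤ 1 / 2 := fun n =>
    (div_le_self hδ0.le (hone n)).trans hδ1
  refine ⟨δ / (((2:ℝ) ^ (0 + n0)) ^ d) ^ 3, K * (((2:ℝ) ^ (0 + n0)) ^ d) ^ 3, by positivity,
    hle 0, by positivity, ?_⟩
  intro a b p H N k hN hk hbig hPr
  have hN0 : (0:ℝ) < N := by exact_mod_cast hN
  have hk0 : (0:ℝ) < k := by exact_mod_cast hk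
  set ρ : ℝ := k / (N:ℝ) ^ d with hρ
  have hρ0 : 0 < ρ := by positivity
  have hRI : ∀ n, ∃ N' k', RI d α a p n0 K δ ρ n N' k' := by
    intro n
    induction n with
    | zero =>
      refine ⟨N, k, hN, by omega, ?_, hbig, ?_⟩
      · rw [Pr_not]; linarith
      · rw [hρ, div_mul_cancel₀ _ (by positivity)]; norm_num
    | succ n ih =>
      obtain ⟨N', k', h⟩ := ih
      exact RI_step H hn0 hn0' hδ hK hρ0.le h
  refine ⟨ρ / 2, by positivity, fun m => ?_⟩
  obtain ⟨N', k', h⟩ := hRI m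
  refine ⟨N', k', h.hN, by have := h.hk; omega, ?_, ?_⟩
  · refine le_trans ?_ h.den
    have : 0 ≤ ρ * (N':ℝ) ^ d := by positivity
    have h2 : (0:ℝ) ≤ (1 / 2) ^ (m + 1) := by positivity
    nlinarith
  · have := h.bad
    rw [Pr_not] at this
    linarith [hle m]

lemma Pr_cs_map (H : Hyp d α a b p) (D : Finset (V d)) (z x : V d) (k : ℕ) :
    Pr p (D.map (Equiv.addRight z).toEmbedding).sym2
      (fun ω => k ≤ cs (D.map (Equiv.addRight z).toEmbedding) ω (x + z)) =
    Pr p D.sym2 (fun ω => k ≤ cs D ω x) := by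
  unfold Pr
  rw [Ex_sym2_map _ (H.inv z)]
  refine Ex_congr fun ω _ => ind_congr ?_
  dsimp only
  rw [← cs_map (Equiv.addRight z) D ω x]
  rfl

lemma big_zero (H : Hyp d α a b p) {ρ : ℝ} {N k : ℕ} (hN : 1 ≤ N)
    (hk : ρ * (N:ℝ) ^ d ≤ k)
    (h : 1 / 2 ≤ Pr p (Q 0 N).sym2 (fun ω => ∃ x, k ≤ cs (Q (0 : V d) N) ω x)) :
    ρ / 2 ≤ Pr p (ball 0 N).sym2 (fun ω => k ≤ cs (ball (0 : V d) N) ω 0) := by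
  classical
  have hp := H.pp
  have hN0 : (0:ℝ) < N := by exact_mod_cast hN
  set D := Q (0 : V d) N with hD
  have hsum : (k:ℝ) * (1 / 2) ≤ ∑ x ∈ D, Pr p D.sym2 (fun ω => k ≤ cs D ω x) := by
    refine (mul_le_mul_of_nonneg_left h (by positivity)).trans ?_
    unfold Pr
    rw [← Ex_mul, ← Ex_sum]
    refine Ex_mono hp fun ω hω => ?_
    by_cases hx : ∃ x, k ≤ cs D ω x
    · obtain ⟨x, hx'⟩ := hx
      rw [ind_true ⟨x, hx'⟩, mul_one]
      calc (k:ℝ) ≤ (cl D ω x).card := by exact_mod_cast hx'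
        _ = ∑ y ∈ cl D ω x, (1:ℝ) := by simp
        _ ≤ ∑ y ∈ cl D ω x, ind (k ≤ cs D ω y) := by
            refine Finset.sum_le_sum fun y hy => ?_
            rw [ind_true]
            refine hx'.trans (Finset.card_le_card fun z hz => ?_)
            rw [mem_cl] at *
            exact ⟨hz.1, hy.2.symm.trans hz.2⟩
        _ ≤ _ := Finset.sum_le_sum_of_subset_of_nonneg (fun y hy => (mem_cl.1 hy).1)
            fun _ _ _ => ind_nonneg _
    · rw [ind_false hx, mul_zero]; exact Finset.sum_nonneg fun _ _ => ind_nonneg _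
  have hex : ∃ x ∈ D, ρ / 2 ≤ Pr p D.sym2 (fun ω => k ≤ cs D ω x) := by
    by_contra hcon
    push Not at hcon
    have hne : D.Nonempty := Finset.card_pos.1 (by rw [hD, card_Q]; positivity)
    have := Finset.sum_lt_sum_of_nonempty hne hcon
    rw [Finset.sum_const, hD, card_Q, nsmul_eq_mul] at this
    push_cast at this
    rw [← hD] at this
    nlinarith
  obtain ⟨x, hx, hxp⟩ := hex
  refine hxp.trans ?_
  rw [← Pr_cs_map H D (-x) x k, add_neg_cancel]
  have hsub : D.map (Equiv.addRight (-x)).toEmbedding ⊆ ball 0 N := by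
    intro y hy
    obtain ⟨w, hw, rfl⟩ := Finset.mem_map.1 hy
    rw [mem_ball, sub_zero]
    simp only [Equiv.coe_toEmbedding, Equiv.coe_addRight, ← sub_eq_add_neg]
    exact Q_dist hw hx
  refine (Pr_mono_set hp (Finset.sym2_mono hsub) fun _ _ h h' => h'.trans (cs_mono h 0)).trans ?_
  exact Pr_mono hp fun ω _ h => h.trans (cs_mono_dom hsub 0)

end Renorm2

section Link
variable {d : ℕ} {J : V d → V d → ℝ} {β : ℝ} {P : ℝ → Measure (Config d)}

/-- Symmetrized kernel on unordered pairs. -/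
noncomputable def jJ (J : V d → V d → ℝ) (e : Sym2 (V d)) : ℝ :=
  Sym2.lift ⟨fun x y => (J x y + J y x) / 2, fun x y => by dsimp only; rw [add_comm]⟩ e

/-- Real edge probability. -/
noncomputable def pb (J : V d → V d → ℝ) (β : ℝ) (e : Sym2 (V d)) : ℝ :=
  1 - Real.exp (-β * jJ J e)

lemma edgeProb_eq (e : Sym2 (V d)) : edgeProb J β e = ENNReal.ofReal (pb J β e) := rfl

lemma jJ_nonneg (hJ : ∀ x y, 0 ≤ J x y) (e : Sym2 (V d)) : 0 ≤ jJ J e := by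
  induction e using Sym2.ind with
  | _ x y => simp only [jJ, Sym2.lift_mk]; linarith [hJ x y, hJ y x]

lemma pb_PP (hJ : ∀ x y, 0 ≤ J x y) (hβ : 0 ≤ β) : PP (pb J β) := by
  intro e
  have h := mul_nonneg hβ (jJ_nonneg hJ e)
  have h1 : Real.exp (-β * jJ J e) ≤ 1 := Real.exp_le_one_iff.2 (by linarith)
  have h2 := Real.exp_pos (-β * jJ J e)
  constructor <;> unfold pb <;> linarith

lemma P_univ (hP : IsLRP J P) (β : ℝ) : P β Set.univ = 1 := by
  have := hP β ∅ (fun _ => true)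
  simpa using this

lemma cyl_meas (s : Finset (Sym2 (V d))) (f : Sym2 (V d) → Bool) :
    MeasurableSet {ω : Config d | ∀ e ∈ s, ω e = f e} := by
  have : {ω : Config d | ∀ e ∈ s, ω e = f e} = ⋂ e ∈ s, (fun ω : Config d => ω e) ⁻¹' {f e} := by
    ext ω; simp
  rw [this]
  exact s.measurableSet_biInter fun e _ => measurable_pi_apply e (measurableSet_singleton _)

open Classical in
lemma fil_eq (s : Finset (Sym2 (V d))) (A : Finset (Sym2 (V d)) → Prop) :
    {ω : Config d | A (s.filter (fun e => ω e = true))} =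
      ⋃ t ∈ s.powerset.filter A, {ω : Config d | ∀ e ∈ s, ω e = decide (e ∈ t)} := by
  ext ω
  simp only [Set.mem_setOf_eq, Set.mem_iUnion, Finset.mem_filter, Finset.mem_powerset, exists_prop]
  constructor
  · intro h
    refine ⟨_, ⟨Finset.filter_subset _ _, h⟩, fun e he => ?_⟩
    by_cases h : ω e = true <;> simp [he, h]
  · rintro ⟨t, ⟨hts, hA⟩, h⟩
    convert hA
    ext e
    rw [Finset.mem_filter]
    constructor
    · rintro ⟨he, h1⟩
      rw [h e he] at h1; simpa using h1
    · intro he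
      exact ⟨hts he, by rw [h e (hts he)]; simpa using he⟩

lemma fil_meas (s : Finset (Sym2 (V d))) (A : Finset (Sym2 (V d)) → Prop) :
    MeasurableSet {ω : Config d | A (s.filter (fun e => ω e = true))} := by
  classical
  rw [fil_eq]
  exact Finset.measurableSet_biUnion _ fun t _ => cyl_meas _ _

lemma link (hP : IsLRP J P) (hp : PP (pb J β)) (s : Finset (Sym2 (V d)))
    (A : Finset (Sym2 (V d)) → Prop) :
    P β {ω : Config d | A (s.filter (fun e => ω e = true))} = ENNReal.ofReal (Pr (pb J β) s A) := by
  classical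
  rw [fil_eq, measure_biUnion_finset ?_ fun t _ => cyl_meas _ _]
  · have hw : ∀ t : Finset (Sym2 (V d)), 0 ≤ (∏ e ∈ t, pb J β e) * ∏ e ∈ s \ t, (1 - pb J β e) :=
      fun t => mul_nonneg (Finset.prod_nonneg fun e _ => (hp e).1)
        (Finset.prod_nonneg fun e _ => by linarith [(hp e).2])
    unfold Pr Ex
    rw [ENNReal.ofReal_sum_of_nonneg fun t _ => mul_nonneg (hw t) (ind_nonneg _), Finset.sum_filter]
    refine Finset.sum_congr rfl fun t ht => ?_
    have hts := Finset.mem_powerset.1 ht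
    by_cases hA : A t
    · rw [if_pos hA, ind_true hA, mul_one, hP β s (fun e => decide (e ∈ t)),
        ENNReal.ofReal_mul (Finset.prod_nonneg fun e _ => (hp e).1),
        ENNReal.ofReal_prod_of_nonneg fun e _ => (hp e).1,
        ENNReal.ofReal_prod_of_nonneg fun e _ => by linarith [(hp e).2],
        ← Finset.prod_sdiff hts, mul_comm]
      congr 1
      · refine Finset.prod_congr rfl fun e he => ?_
        simp [he, edgeProb_eq]
      · refine Finset.prod_congr rfl fun e he => ?_
        have := (Finset.mem_sdiff.1 he).2
        simp only [this, decide_false, Bool.false_eq_true, if_false, edgeProb_eq]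
        rw [ENNReal.ofReal_sub _ (hp e).1, ENNReal.ofReal_one]
    · rw [if_neg hA, ind_false hA, mul_zero, ENNReal.ofReal_zero]
  · intro t ht t' ht' hne
    rw [Function.onFun, Set.disjoint_left]
    intro ω h h'
    refine hne ?_
    have h1 := Finset.mem_powerset.1 (Finset.mem_filter.1 (Finset.mem_coe.1 ht)).1
    have h2 := Finset.mem_powerset.1 (Finset.mem_filter.1 (Finset.mem_coe.1 ht')).1
    ext e
    by_cases he : e ∈ s
    · have := (h e he).symm.trans (h' e he)
      simpa using this
    · exact ⟨fun h => absurd (h1 h) he, fun h => absurd (h2 h) he⟩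

/-- Open edges in the box of radius `M`. -/
noncomputable def FF (M : ℕ) (ω : Config d) : Finset (Sym2 (V d)) :=
  (ball (0 : V d) M).sym2.filter (fun e => ω e = true)

lemma FF_mono {M N : ℕ} (h : M ≤ N) (ω : Config d) : FF M ω ⊆ FF N ω :=
  Finset.filter_subset_filter _ (Finset.sym2_mono (ball_mono 0 h))

lemma mem_FF {M : ℕ} {ω : Config d} {a b : V d} :
    s(a, b) ∈ FF M ω ↔ (normInf a ≤ M ∧ normInf b ≤ M) ∧ ω s(a, b) = true := by
  simp [FF, mem_ball]

lemma conn_iff (ω : Config d) (x y : V d) : conn ω x y ↔ ∃ M, Cn (FF M ω) x y := by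
  constructor
  · intro h
    induction h with
    | refl => exact ⟨0, Cn.refl _ _⟩
    | @tail b c _ hbc ih =>
      obtain ⟨M, hM⟩ := ih
      refine ⟨max M (max (normInf b) (normInf c)),
        (hM.mono (FF_mono (le_max_left _ _) ω)).trans (Cn.edge (mem_FF.2 ⟨⟨?_, ?_⟩, hbc.2⟩))⟩ <;> simp
  · rintro ⟨M, h⟩
    induction h with
    | refl => exact Relation.ReflTransGen.refl
    | @tail b c _ hbc ih =>
      by_cases h : b = c
      · rw [← h]; exact ih
      · exact ih.tail ⟨h, (mem_FF.1 hbc).2⟩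

lemma two_sup (hP : IsLRP J P) (hp : PP (pb J β)) (x y : V d) :
    twoPoint P β x y = ⨆ M : ℕ, ENNReal.ofReal (tau (pb J β) (ball 0 M) x y) := by
  have h : {ω : Config d | conn ω x y} = ⋃ M : ℕ, {ω : Config d | Cn (FF M ω) x y} := by
    ext ω; simp [conn_iff]
  unfold twoPoint
  rw [h, Monotone.measure_iUnion]
  · refine iSup_congr fun M => ?_
    exact link hP hp _ (fun ω => Cn ω x y)
  · intro M N hMN ω hω
    exact Cn.mono (FF_mono hMN ω) hω

lemma tau_le_two (hP : IsLRP J P) (hp : PP (pb J β)) (D : Finset (V d)) (x y : V d) :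
    ENNReal.ofReal (tau (pb J β) D x y) ≤ twoPoint P β x y := by
  obtain ⟨n, hn⟩ := exists_ball D 0
  rw [two_sup hP hp]
  exact (ENNReal.ofReal_le_ofReal (tau_mono hp hn x y)).trans
    (le_iSup (fun M : ℕ => ENNReal.ofReal (tau (pb J β) (ball 0 M) x y)) n)

lemma inf_of {ω : Config d} (h : ∀ k, ∃ M, k ≤ cs (ball 0 M) (FF M ω) 0) :
    (cluster ω 0).Infinite := by
  intro hf
  obtain ⟨M, hM⟩ := h (hf.toFinset.card + 1)
  have : cs (ball 0 M) (FF M ω) 0 ≤ hf.toFinset.card := by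
    refine Finset.card_le_card fun y hy => ?_
    rw [Set.Finite.mem_toFinset]
    exact (conn_iff ω 0 y).2 ⟨M, (mem_cl.1 hy).2⟩
  omega

lemma of_inf {ω : Config d} {x : V d} (h : (cluster ω x).Infinite) (k : ℕ) :
    ∃ M, normInf x ≤ M ∧ k ≤ cs (ball 0 M) (FF M ω) x := by
  obtain ⟨t, hts, htc⟩ := h.exists_subset_card_eq k
  have : ∀ y : V d, ∃ M, y ∈ t → normInf y ≤ M ∧ Cn (FF M ω) x y := by
    intro y
    by_cases hy : y ∈ t
    · obtain ⟨M, hM⟩ := (conn_iff ω x y).1 (hts hy)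
      exact ⟨max M (normInf y), fun _ => ⟨le_max_right _ _, hM.mono (FF_mono (le_max_left _ _) ω)⟩⟩
    · exact ⟨0, fun h => absurd h hy⟩
  choose f hf using this
  refine ⟨max (normInf x) (t.sup f), le_max_left _ _, ?_⟩
  rw [← htc]
  refine Finset.card_le_card fun y hy => mem_cl.2 ⟨?_, ?_⟩
  · rw [mem_ball, sub_zero]
    exact ((hf y hy).1.trans (Finset.le_sup hy)).trans (le_max_right _ _)
  · exact (hf y hy).2.mono (FF_mono ((Finset.le_sup hy).trans (le_max_right _ _)) ω)

end Link

section Crit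
variable {d : ℕ} {J : V d → V d → ℝ} {β α c C a b : ℝ} {P : ℝ → Measure (Config d)}

lemma jJ_mk (hJ : KernelHyp d J α c C) (x y : V d) : jJ J s(x, y) = J x y := by
  simp only [jJ, Sym2.lift_mk]; rw [hJ.symm y x]; ring

lemma pb_Hyp (hJ : KernelHyp d J α c C) (hα : α < 1) (hβ : 0 < β) (ha0 : 0 < a) (ha : a ≤ c * β)
    (hb : C * β ≤ b) : Hyp d α a b (pb J β) where
  hd := hJ.d_pos
  h0 := hJ.alpha_pos
  h1 := hα
  had := hJ.alpha_lt_d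
  ha := ha0
  hb := by
    have := hJ.c_pos; have := hJ.c_le_C
    have : 0 < C * β := mul_pos (by linarith) hβ
    linarith
  pp := pb_PP hJ.nonneg hβ.le
  inv := by
    intro z q
    induction q using Sym2.ind with
    | _ x y =>
      unfold pb
      rw [Sym2.map_mk, jJ_mk hJ, jJ_mk hJ]
      simp only [Equiv.coe_addRight]
      rw [hJ.transInv]
  lo := by
    intro u v huv
    unfold pb
    rw [jJ_mk hJ, _root_.sub_sub_cancel]
    refine Real.exp_le_exp.2 ?_
    have h1 := hJ.lower u v huv
    have h2 : (0:ℝ) ≤ (normInf (u - v) : ℝ) ^ (-(d : ℝ) - α) := by positivity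
    nlinarith [mul_le_mul_of_nonneg_left h1 hβ.le, mul_le_mul_of_nonneg_right ha h2]
  hi := by
    intro u v huv
    unfold pb
    rw [jJ_mk hJ]
    have h0 := Real.add_one_le_exp (-β * J u v)
    have h1 := hJ.upper u v huv
    have h2 : (0:ℝ) ≤ (normInf (u - v) : ℝ) ^ (-(d : ℝ) - α) := by positivity
    nlinarith [mul_le_mul_of_nonneg_left h1 hβ.le, mul_le_mul_of_nonneg_right hb h2]

lemma perc_pos (hP : IsLRP J P) (H : Hyp d α a b (pb J β)) {ρ : ℝ} (hρ : 0 < ρ)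
    (h : ∀ m : ℕ, ∃ N' k' : ℕ, 1 ≤ N' ∧ m ≤ k' ∧ ρ * (N':ℝ) ^ d ≤ k' ∧
      1 / 2 ≤ Pr (pb J β) (Q 0 N').sym2 (fun ω => ∃ x, k' ≤ cs (Q (0 : V d) N') ω x)) :
    0 < P β {ω | ∃ x, (cluster ω x).Infinite} := by
  have hfin : IsFiniteMeasure (P β) := ⟨by rw [P_univ hP]; exact ENNReal.one_lt_top⟩
  set S : ℕ → Set (Config d) := fun k => ⋃ M : ℕ, {ω | k ≤ cs (ball 0 M) (FF M ω) 0} with hS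
  have hmeas : ∀ k, MeasurableSet (S k) := fun k =>
    MeasurableSet.iUnion fun M => fil_meas _ (fun ω => k ≤ cs (ball 0 M) ω 0)
  have hanti : Antitone S := by
    intro k l hkl ω hω
    obtain ⟨M, hM⟩ := Set.mem_iUnion.1 hω
    exact Set.mem_iUnion.2 ⟨M, hkl.trans hM⟩
  have hlow : ∀ k, ENNReal.ofReal (ρ / 2) ≤ P β (S k) := by
    intro k
    obtain ⟨N, k', hN, hk, hd, hp⟩ := h k
    have hb := big_zero H hN hd hp
    calc ENNReal.ofReal (ρ / 2) ≤ _ := ENNReal.ofReal_le_ofReal hb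
      _ = P β {ω | k' ≤ cs (ball 0 N) (FF N ω) 0} :=
          (link hP H.pp _ (fun ω => k' ≤ cs (ball 0 N) ω 0)).symm
      _ ≤ P β (S k) := measure_mono fun ω hω => Set.mem_iUnion.2 ⟨N, hk.trans hω⟩
  have hI : P β (⋂ k, S k) = ⨅ k, P β (S k) :=
    hanti.measure_iInter (fun k => (hmeas k).nullMeasurableSet) ⟨0, measure_ne_top _ _⟩
  have h1 : ENNReal.ofReal (ρ / 2) ≤ P β (⋂ k, S k) := by rw [hI]; exact le_iInf hlow
  have h2 : (⋂ k, S k) ⊆ {ω | ∃ x, (cluster ω x).Infinite} := by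
    intro ω hω
    exact ⟨0, inf_of fun k => Set.mem_iUnion.1 (Set.mem_iInter.1 hω k)⟩
  exact (ENNReal.ofReal_pos.2 (by linarith)).trans_le (h1.trans (measure_mono h2))

lemma perc_zero (hP : IsLRP J P) (hp : PP (pb J β))
    (h : ∀ (x : V d) (A : Finset (V d)), x ∉ A → ∑ v ∈ A, pb J β s(x, v) ≤ 1 / 2) :
    P β {ω | ∃ x, (cluster ω x).Infinite} = 0 := by
  classical
  have hsum : ∀ (D : Finset (V d)), ∀ x ∈ D, ∑ y ∈ D, tau (pb J β) D x y ≤ 2 := by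
    intro D x hx
    have := chi_bound hp (D := D) (fun x => {x}) (fun x => by simp) (M := 1) (fun x => by simp)
      (fun x hx => by
        rw [Finset.inter_singleton_of_mem hx, Finset.sum_singleton, tau_self]
        simp only [one_mul]
        exact h x _ (by simp)) x hx
    simpa using this
  have hx : ∀ x : V d, P β {ω | (cluster ω x).Infinite} = 0 := by
    intro x
    have hk : ∀ k : ℕ, P β {ω | (cluster ω x).Infinite} ≤ ENNReal.ofReal (2 / ((k:ℝ) + 1)) := by
      intro k
      have hsub : {ω : Config d | (cluster ω x).Infinite} ⊆
          ⋃ M : ℕ, {ω | normInf x ≤ M ∧ k + 1 ≤ cs (ball 0 M) (FF M ω) x} := fun ω hω =>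
        Set.mem_iUnion.2 (of_inf hω (k + 1))
      refine (measure_mono hsub).trans ?_
      rw [Monotone.measure_iUnion]
      · refine iSup_le fun M => ?_
        by_cases hxM : normInf x ≤ M
        · have e := link hP hp (ball 0 M).sym2 (fun ω => k + 1 ≤ cs (ball 0 M) ω x)
          refine (measure_mono fun ω hω => hω.2).trans (e.trans_le ?_)
          refine ENNReal.ofReal_le_ofReal ?_
          rw [le_div_iff₀ (by positivity)]
          refine le_trans ?_ (hsum (ball 0 M) x (mem_ball.2 (by simpa using hxM)))
          rw [← Ex_cs, mul_comm]
          unfold Pr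
          rw [← Ex_mul]
          refine Ex_mono hp fun ω _ => ?_
          by_cases hk : k + 1 ≤ cs (ball 0 M) ω x
          · rw [ind_true hk, mul_one]; exact_mod_cast hk
          · rw [ind_false hk, mul_zero]; positivity
        · have : {ω : Config d | normInf x ≤ M ∧ k + 1 ≤ cs (ball 0 M) (FF M ω) x} = ∅ := by
            ext ω; simp [hxM]
          rw [this]; simp
      · intro M N hMN ω hω
        exact ⟨hω.1.trans hMN, hω.2.trans ((cs_mono (FF_mono hMN ω) x).trans
          (cs_mono_dom (ball_mono 0 hMN) x))⟩
    have ht : Filter.Tendsto (fun k : ℕ => ENNReal.ofReal (2 / ((k:ℝ) + 1))) Filter.atTop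
        (nhds (ENNReal.ofReal 0)) := by
      refine ENNReal.tendsto_ofReal ?_
      have := (tendsto_one_div_add_atTop_nhds_zero_nat (𝕜 := ℝ)).const_mul 2
      simpa [div_eq_mul_inv] using this
    rw [ENNReal.ofReal_zero] at ht
    exact le_antisymm (ge_of_tendsto' ht hk) (zero_le)
  have : {ω : Config d | ∃ x, (cluster ω x).Infinite} = ⋃ x, {ω | (cluster ω x).Infinite} := by
    ext ω; simp
  rw [this]
  exact measure_iUnion_null hx

lemma crit_ne (hJ : KernelHyp d J α c C) (hα : α < 1) (hP : IsLRP J P) :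
    {β : ℝ | 0 ≤ β ∧ 0 < P β {ω | ∃ x, (cluster ω x).Infinite}}.Nonempty := by
  obtain ⟨ε, K, hε, -, hK, hr⟩ := renorm (d := d) (α := α) hJ.alpha_lt_d
  have hc := hJ.c_pos
  have hβ : 0 < K / c := by positivity
  have H : Hyp d α K (C * (K / c)) (pb J (K / c)) :=
    pb_Hyp hJ hα hβ hK (by rw [mul_div_cancel₀ _ hc.ne']) le_rfl
  obtain ⟨ρ, hρ, h⟩ := hr _ _ _ H 1 1 le_rfl le_rfl (by simp) (by
    have : Pr (pb J (K / c)) (Q 0 1).sym2 (fun ω => ∃ x, 1 ≤ cs (Q (0 : V d) 1) ω x) = 1 := by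
      unfold Pr
      rw [Ex_congr (g := fun _ => 1), Ex_const]
      intro ω _
      refine ind_true ⟨0, Finset.card_pos.2 ⟨0, mem_cl.2 ⟨mem_Q.2 fun i => by simp, Cn.refl _ _⟩⟩⟩
    rw [this]; linarith)
  exact ⟨K / c, hβ.le, perc_pos hP H hρ h⟩

lemma crit_pos (hJ : KernelHyp d J α c C) (hα : α < 1) (hP : IsLRP J P) : 0 < betaC P := by
  have hc := hJ.c_pos
  have hC : 0 < C := hc.trans_le hJ.c_le_C
  have hKd : 0 < Kd d α := Kd_pos hJ.d_pos hJ.alpha_pos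
  have h0 : 0 < 1 / (2 * C * Kd d α) := by positivity
  refine h0.trans_le (le_csInf (crit_ne hJ hα hP) ?_)
  rintro β ⟨hβ, hpos⟩
  by_contra hlt
  push Not at hlt
  refine hpos.ne' (perc_zero hP (pb_PP hJ.nonneg hβ) fun x A hA => ?_)
  rcases hβ.eq_or_lt with rfl | hβ
  · simp [pb]
  · have H : Hyp d α (c * β) (C * β) (pb J β) := pb_Hyp hJ hα hβ (by positivity) le_rfl le_rfl
    refine (psum H x (m := 1) le_rfl A fun v hv => ?_).trans ?_
    · exact normInf_pos (sub_ne_zero.2 fun h => hA (h ▸ hv))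
    · rw [Nat.cast_one, Real.one_rpow, mul_one]
      rw [lt_div_iff₀ (by positivity)] at hlt
      nlinarith

lemma sub_zero_perc (h0 : 0 ≤ β) (hβ : β < betaC P) :
    ¬ 0 < P β {ω | ∃ x, (cluster ω x).Infinite} := by
  intro h
  exact notMem_of_lt_csInf hβ ⟨0, fun _ hx => hx.1⟩ ⟨h0, h⟩

lemma Pr_cont (s : Finset (Sym2 (V d))) (A : Finset (Sym2 (V d)) → Prop) :
    Continuous fun β => Pr (pb J β) s A := by
  unfold Pr Ex pb
  fun_prop

lemma NB_crit (hJ : KernelHyp d J α c C) (hα : α < 1) (hP : IsLRP J P) :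
    ∃ A ε : ℝ, Par d α (c * (betaC P / 2)) (C * betaC P) A ε ∧
      ∀ β, betaC P / 2 ≤ β → β ≤ betaC P →
        Hyp d α (c * (betaC P / 2)) (C * betaC P) (pb J β) ∧ NB d α A ε (pb J β) := by
  have hc := hJ.c_pos
  have hC : 0 < C := hc.trans_le hJ.c_le_C
  have hb := crit_pos hJ hα hP
  obtain ⟨ε, K, hε, hε1, hK, hr⟩ := renorm (d := d) (α := α) hJ.alpha_lt_d
  set a := c * (betaC P / 2) with ha
  have ha0 : 0 < a := by positivity
  set A := √(K / a) with hA
  have hA0 : 0 < A := Real.sqrt_pos.2 (by positivity)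
  have hH : ∀ β, betaC P / 2 ≤ β → β ≤ betaC P → Hyp d α a (C * betaC P) (pb J β) := by
    intro β h1 h2
    exact pb_Hyp hJ hα (by linarith) ha0 (by rw [ha]; gcongr) (by gcongr)
  have hNB : ∀ β, betaC P / 2 ≤ β → β < betaC P → NB d α A ε (pb J β) := by
    intro β h1 h2 N hN
    by_contra hcon
    push Not at hcon
    have H := hH β h1 h2.le
    have hN0 : (0:ℝ) < N := by exact_mod_cast hN
    have hbig : K * (N:ℝ) ^ ((d:ℝ) + α) ≤ a * (mm d α A N : ℝ) ^ 2 := by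
      have e : A * (N:ℝ) ^ (((d:ℝ) + α) / 2) ≤ (mm d α A N : ℝ) := Nat.le_ceil _
      calc K * (N:ℝ) ^ ((d:ℝ) + α) = a * (A * (N:ℝ) ^ (((d:ℝ) + α) / 2)) ^ 2 := by
            rw [mul_pow, hA, Real.sq_sqrt (by positivity), ← Real.rpow_natCast, ← Real.rpow_mul hN0.le]
            have : ((d:ℝ) + α) / 2 * ((2:ℕ):ℝ) = d + α := by push_cast; ring
            rw [this]; field_simp
        _ ≤ _ := by gcongr
    obtain ⟨ρ, hρ, h⟩ := hr _ _ _ H N (mm d α A N) hN (mm_pos hA0 hN) hbig hcon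
    exact sub_zero_perc (by linarith) h2 (perc_pos hP H hρ h)
  refine ⟨A, ε, ⟨hJ.d_pos, hJ.alpha_pos, hα, hJ.alpha_lt_d, ha0, by positivity, hA0, hε⟩, ?_⟩
  intro β h1 h2
  refine ⟨hH β h1 h2, ?_⟩
  rcases h2.eq_or_lt with h2 | h2
  · intro N hN
    have ht := ((Pr_cont (J := J) (Q 0 N).sym2
      (fun ω => ∃ x, mm d α A N ≤ cs (Q (0 : V d) N) ω x)).tendsto (betaC P)).mono_left
      (nhdsWithin_le_nhds (s := Set.Iio (betaC P)))
    rw [h2]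
    refine le_of_tendsto ht ?_
    filter_upwards [Ioo_mem_nhdsLT (show betaC P / 2 < betaC P by linarith)] with β hβ
    exact hNB β hβ.1.le hβ.2 N hN
  · exact hNB β h1 h2

end Crit

section Fin
variable {d : ℕ} {J : V d → V d → ℝ} {β α a b : ℝ} {P : ℝ → Measure (Config d)}

lemma boxSum_eq (n : ℕ) : boxSum P β n = ∑ x ∈ ball (0 : V d) n, twoPoint P β 0 x := by
  unfold boxSum
  rw [tsum_eq_sum (s := ball (0 : V d) n)]
  · refine Finset.sum_congr rfl fun x hx => ?_
    rw [mem_ball, sub_zero] at hx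
    rw [if_pos hx]
  · intro x hx
    rw [mem_ball, sub_zero] at hx
    rw [if_neg hx]

lemma boxSum_le (n : ℕ) : boxSum P β n ≤ chi P β := by
  rw [boxSum_eq]; exact ENNReal.sum_le_tsum _

lemma two_le (hP : IsLRP J P) (hp : PP (pb J β)) {x : V d} {B : ℝ}
    (h : ∀ M, tau (pb J β) (ball 0 M) 0 x ≤ B) : twoPoint P β 0 x ≤ ENNReal.ofReal B := by
  rw [two_sup hP hp]
  exact iSup_le fun M => ENNReal.ofReal_le_ofReal (h M)

lemma sum_le_chi (hP : IsLRP J P) (H : Hyp d α a b (pb J β)) (D : Finset (V d)) (x : V d) :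
    ENNReal.ofReal (∑ y ∈ D, tau (pb J β) D x y) ≤ chi P β := by
  have hp := H.pp
  rw [ENNReal.ofReal_sum_of_nonneg fun y _ => tau_nonneg hp _ _ _]
  calc ∑ y ∈ D, ENNReal.ofReal (tau (pb J β) D x y) ≤ ∑ y ∈ D, twoPoint P β 0 (y + -x) := by
        refine Finset.sum_le_sum fun y _ => ?_
        rw [← tau_trans H D x y (-x), add_neg_cancel]
        exact tau_le_two hP hp _ _ _
    _ = ∑ y ∈ D.map (Equiv.addRight (-x)).toEmbedding, twoPoint P β 0 y := by
        rw [Finset.sum_map]; rfl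
    _ ≤ _ := ENNReal.sum_le_tsum _

lemma chi_le (hP : IsLRP J P) (hp : PP (pb J β)) {G : ℝ}
    (h : ∀ M0 : ℕ, ∃ M ≥ M0, ∑ y ∈ ball 0 M, tau (pb J β) (ball 0 M) 0 y ≤ G) :
    chi P β ≤ ENNReal.ofReal G := by
  unfold chi
  rw [ENNReal.tsum_eq_iSup_sum]
  refine iSup_le fun s => ?_
  simp_rw [two_sup hP hp]
  rw [ENNReal.finsetSum_iSup_of_monotone]
  · refine iSup_le fun M => ?_
    obtain ⟨n, hn⟩ := exists_ball s 0
    obtain ⟨N, hN, hG⟩ := h (max M n)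
    rw [← ENNReal.ofReal_sum_of_nonneg fun y _ => tau_nonneg hp _ _ _]
    refine ENNReal.ofReal_le_ofReal (le_trans ?_ hG)
    calc ∑ y ∈ s, tau (pb J β) (ball 0 M) 0 y ≤ ∑ y ∈ s, tau (pb J β) (ball 0 N) 0 y :=
          Finset.sum_le_sum fun y _ => tau_mono hp (ball_mono 0 (by omega)) _ _
      _ ≤ _ := Finset.sum_le_sum_of_subset_of_nonneg (hn.trans (ball_mono 0 (by omega)))
          fun _ _ _ => tau_nonneg hp _ _ _
  · intro y M N hMN
    exact ENNReal.ofReal_le_ofReal (tau_mono hp (ball_mono 0 hMN) _ _)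

lemma xi_le {n : ℕ} (hn : 1 ≤ n) (h : chi P β ≤ 2 * boxSum P β n) : xi P β ≤ n :=
  sInf_le ⟨n, rfl, hn, h⟩

lemma xi_cases : xi P β = ⊤ ∨ ∃ n : ℕ, 1 ≤ n ∧ xi P β = n ∧ chi P β ≤ 2 * boxSum P β n := by
  classical
  by_cases h : ∃ n : ℕ, 1 ≤ n ∧ chi P β ≤ 2 * boxSum P β n
  · right
    obtain ⟨h1, h2⟩ := Nat.find_spec h
    refine ⟨Nat.find h, h1, le_antisymm (xi_le h1 h2) ?_, h2⟩
    refine le_sInf ?_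
    rintro r ⟨n, rfl, hn, hc⟩
    exact_mod_cast Nat.find_min' h ⟨hn, hc⟩
  · left
    unfold xi
    rw [sInf_eq_top]
    rintro r ⟨n, rfl, hn, hc⟩
    exact absurd ⟨n, hn, hc⟩ h

lemma xi_low (hP : IsLRP J P) (H : Hyp d α a b (pb J β)) {n : ℕ} (hn : 1 ≤ n)
    (hE : b * (Kd d (1 - α) + Kd d α) * (n:ℝ) ^ (-α) *
      ∑ u ∈ ball (0 : V d) (2 * n), tau (pb J β) (ball 0 (2 * n)) 0 u ≤ 1 / 2) :
    xi P β ≤ ((2 * n : ℕ) : ℝ≥0∞) := by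
  have hp := H.pp
  have hfin : chi P β ≠ ⊤ := by
    have := chi_le (P := P) hP hp (G := 2 * ((4 * n + 1) ^ d : ℕ)) fun M0 =>
      ⟨M0, le_rfl, chi_fin H hn hE _ 0 (self_mem_ball _ _)⟩
    exact ne_top_of_le_ne_top ENNReal.ofReal_ne_top this
  have hbf : boxSum P β (2 * n) ≠ ⊤ := ne_top_of_le_ne_top hfin (boxSum_le _)
  refine xi_le (by omega) ?_
  have key := chi_le (P := P) hP hp (G := (boxSum P β (2 * n)).toReal + (chi P β).toReal / 2)
    fun M0 => by
      refine ⟨max M0 (2 * n), le_max_left _ _, ?_⟩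
      set D := ball (0 : V d) (max M0 (2 * n)) with hD
      have hsub : ball (0 : V d) (2 * n) ⊆ D := ball_mono 0 (le_max_right _ _)
      have h1 := chi_half H hn hE D (self_mem_ball _ _) (G := (chi P β).toReal)
        ENNReal.toReal_nonneg fun v _ => by
          have := sum_le_chi hP H D v
          exact (ENNReal.ofReal_le_iff_le_toReal hfin).1 this
      have h2 : ∑ y ∈ ball (0 : V d) (2 * n), tau (pb J β) D 0 y ≤ (boxSum P β (2 * n)).toReal := by
        rw [← ENNReal.ofReal_le_iff_le_toReal hbf, boxSum_eq,
          ENNReal.ofReal_sum_of_nonneg fun y _ => tau_nonneg hp _ _ _]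
        exact Finset.sum_le_sum fun y _ => tau_le_two hP hp _ _ _
      rw [← Finset.sum_sdiff hsub]
      linarith
  have h3 := ENNReal.toReal_le_of_le_ofReal (by positivity) key
  rw [← ENNReal.toReal_le_toReal hfin (ENNReal.mul_ne_top (by simp) hbf), ENNReal.toReal_mul]
  simp only [ENNReal.toReal_ofNat]
  linarith

/-- Conversion of the scaling factor. -/
lemma fac (hα : 0 < α) {k : ℝ} (hk : 0 ≤ k) {r X : ℕ} (hr : 1 ≤ r) (hX : 1 ≤ X) :
    ENNReal.ofReal (k * (r:ℝ) ^ (α - (d:ℝ))) * (max 1 ((r : ℝ≥0∞) / (X : ℝ≥0∞))) ^ (-(2 * α)) =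
      ENNReal.ofReal (k * ((r:ℝ) ^ (-(d:ℝ) - α) * ((min r X : ℕ) : ℝ) ^ (2 * α))) := by
  have hr0 : (0:ℝ) < r := by exact_mod_cast hr
  have hX0 : (0:ℝ) < X := by exact_mod_cast hX
  rcases le_total r X with h | h
  · have h1 : (r : ℝ≥0∞) / X ≤ 1 := ENNReal.div_le_of_le_mul (by rw [one_mul]; exact_mod_cast h)
    rw [max_eq_left h1, ENNReal.one_rpow, mul_one, min_eq_left h, ← Real.rpow_add hr0]
    congr 3; ring
  · have h1 : (r : ℝ≥0∞) / X = ENNReal.ofReal ((r:ℝ) / X) := by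
      rw [ENNReal.ofReal_div_of_pos hX0, ENNReal.ofReal_natCast, ENNReal.ofReal_natCast]
    have h2 : (1:ℝ≥0∞) ≤ ENNReal.ofReal ((r:ℝ) / X) := by
      rw [ENNReal.one_le_ofReal, one_le_div hX0]; exact_mod_cast h
    rw [h1, max_eq_right h2, ENNReal.ofReal_rpow_of_pos (by positivity),
      ← ENNReal.ofReal_mul (by positivity), min_eq_right h, mul_assoc]
    congr 2
    rw [Real.div_rpow hr0.le hX0.le, Real.rpow_neg hX0.le, div_inv_eq_mul, ← mul_assoc,
      ← Real.rpow_add hr0]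
    congr 2; ring

lemma fac_top {r : ℕ} (k : ℝ≥0∞) : k * (max 1 ((r : ℝ≥0∞) / ⊤)) ^ (-(2 * α)) = k := by
  rw [ENNReal.div_top, max_eq_left (zero_le), ENNReal.one_rpow, mul_one]

lemma chi_g (hα : 0 < α) (hα1 : α < 1) (hd : 1 ≤ d) {C2 : ℝ} (hC2 : 0 < C2)
    (hPb : ∀ x : V d, x ≠ 0 → twoPoint P β 0 x ≤ ENNReal.ofReal (C2 * (normInf x : ℝ) ^ (α - (d:ℝ))))
    (h0 : twoPoint P β (0 : V d) 0 ≤ 1)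
    {X : ℕ} (hX : 1 ≤ X) (h : chi P β ≤ 2 * boxSum P β X) :
    chi P β ≤ ENNReal.ofReal (2 * (1 + C2 * Kd d α) * (X:ℝ) ^ α) := by
  classical
  have hX0 : (1:ℝ) ≤ X := by exact_mod_cast hX
  have hKd := Kd_pos hd hα
  have hb : boxSum P β X ≤ ENNReal.ofReal (1 + C2 * (Kd d α * (X:ℝ) ^ α)) := by
    rw [boxSum_eq, ← Finset.add_sum_erase _ _ (self_mem_ball 0 X),
      ENNReal.ofReal_add (by norm_num) (by positivity), ENNReal.ofReal_one]
    refine add_le_add h0 ?_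
    calc ∑ x ∈ (ball (0 : V d) X).erase 0, twoPoint P β 0 x ≤
        ∑ x ∈ (ball (0 : V d) X).erase 0, ENNReal.ofReal (C2 * (normInf x : ℝ) ^ (α - (d:ℝ))) :=
          Finset.sum_le_sum fun x hx => hPb x (Finset.ne_of_mem_erase hx)
      _ = ENNReal.ofReal (∑ x ∈ (ball (0 : V d) X).erase 0, C2 * (normInf x : ℝ) ^ (α - (d:ℝ))) :=
          (ENNReal.ofReal_sum_of_nonneg fun x _ => by positivity).symm
      _ ≤ _ := by
          refine ENNReal.ofReal_le_ofReal ?_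
          rw [← Finset.mul_sum]
          refine mul_le_mul_of_nonneg_left ?_ hC2.le
          have := K1 hd hα hα1.le (t := X) (by positivity) ((ball (0 : V d) X).erase 0) fun w hw => by
            refine ⟨Finset.ne_of_mem_erase hw, ?_⟩
            have := mem_ball.1 (Finset.mem_of_mem_erase hw)
            rw [sub_zero] at this
            exact_mod_cast this
          rw [show α - (d:ℝ) = -(d:ℝ) + α by ring]
          exact this
  calc chi P β ≤ 2 * ENNReal.ofReal (1 + C2 * (Kd d α * (X:ℝ) ^ α)) := h.trans (by gcongr)
    _ = ENNReal.ofReal (2 * (1 + C2 * (Kd d α * (X:ℝ) ^ α))) := by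
        rw [ENNReal.ofReal_mul (by norm_num), ENNReal.ofReal_ofNat]
    _ ≤ _ := by
        refine ENNReal.ofReal_le_ofReal ?_
        have : 1 ≤ (X:ℝ) ^ α := Real.one_le_rpow hX0 hα.le
        nlinarith

end Fin

theorem main_tp {d : ℕ} {J : V d → V d → ℝ} {α c C : ℝ}
    (hJ : KernelHyp d J α c C)
    (P : ℝ → Measure (Config d)) (hP : IsLRP J P)
    (hα : α < 1) :
    ∃ c₁ C₁ : ℝ, 0 < c₁ ∧ c₁ ≤ C₁ ∧ ∀ β : ℝ, betaC P / 2 ≤ β → β ≤ betaC P →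
      ∀ x : V d, x ≠ 0 →
      ENNReal.ofReal (c₁ * (normInf x : ℝ) ^ (α - (d : ℝ))) *
          (max 1 ((normInf x : ℝ≥0∞) / xi P β)) ^ (-(2 * α)) ≤ twoPoint P β 0 x ∧
      twoPoint P β 0 x ≤ ENNReal.ofReal (C₁ * (normInf x : ℝ) ^ (α - (d : ℝ))) *
          (max 1 ((normInf x : ℝ≥0∞) / xi P β)) ^ (-(2 * α)) := by
  obtain ⟨A, ε, R, hR⟩ := NB_crit hJ hα hP
  have hα0 := hJ.alpha_pos
  have hd := hJ.d_pos
  obtain ⟨c1, hc1, hLB⟩ := LB R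
  obtain ⟨C2, hC2, hP2⟩ := P2 R
  have hKd := Kd_pos hd hα0
  obtain ⟨C3, hC3, hP3⟩ := P3 R (g := 2 * (1 + C2 * Kd d α)) (by positivity)
  refine ⟨c1, c1 + C2 + C3, hc1, by linarith, fun β hβ1 hβ2 x hx => ?_⟩
  obtain ⟨H, hNB⟩ := hR β hβ1 hβ2
  have hp := H.pp
  set r := normInf x with hr
  have hr1 : 1 ≤ r := normInf_pos hx
  have hr0 : (0:ℝ) < r := by exact_mod_cast hr1
  have hup : ∀ y : V d, y ≠ 0 →
      twoPoint P β 0 y ≤ ENNReal.ofReal (C2 * (normInf y : ℝ) ^ (α - (d:ℝ))) := fun y hy =>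
    two_le hP hp fun M => by
      have := hP2 _ H hNB (ball 0 M) 0 y (self_mem_ball _ _) hy.symm
      rwa [normInf_comm, sub_zero] at this
  have h00 : twoPoint P β (0 : V d) 0 ≤ 1 := by
    have := two_le (x := (0 : V d)) (B := 1) hP hp fun M => tau_le_one hp _ _ _
    simpa using this
  have hlow : ∀ M : ℕ, 1 ≤ M → M ≤ r → ((M : ℝ≥0∞) ≤ xi P β) →
      ENNReal.ofReal (c1 * ((r:ℝ) ^ (-(d:ℝ) - α) * (M:ℝ) ^ (2 * α))) ≤ twoPoint P β 0 x := by
    intro M hM hMr hMx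
    have := hLB _ H hNB x hx M hM hMr fun n hn hnM => by
      by_contra hcon
      have h1 := hMx.trans (xi_low hP H hn (not_lt.1 hcon))
      have h2 : M ≤ 2 * n := by exact_mod_cast h1
      omega
    rw [mul_assoc] at this
    exact (ENNReal.ofReal_le_ofReal this).trans (tau_le_two hP hp _ _ _)
  rcases xi_cases (P := P) (β := β) with hxi | ⟨X, hX, hxi, hchi⟩
  · rw [hxi, fac_top, fac_top]
    constructor
    · refine le_trans (le_of_eq ?_) (hlow r hr1 le_rfl (by rw [hxi]; exact le_top))
      rw [← Real.rpow_add hr0]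
      congr 3; ring
    · refine (hup x hx).trans (ENNReal.ofReal_le_ofReal ?_)
      rw [← hr]
      gcongr
      linarith
  · rw [hxi, fac hα0 hc1.le hr1 hX, fac hα0 (by positivity) hr1 hX]
    constructor
    · refine hlow (min r X) (le_min hr1 hX) (min_le_left _ _) ?_
      rw [hxi]; exact_mod_cast min_le_right r X
    · rcases le_total r X with h | h
      · refine (hup x hx).trans (ENNReal.ofReal_le_ofReal ?_)
        rw [← hr, min_eq_left h, ← Real.rpow_add hr0,
          show -(d:ℝ) - α + 2 * α = α - d by ring]
        gcongr
        linarith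
      · rw [min_eq_right h]
        have hg := chi_g hα0 hα hd hC2 hup h00 hX hchi
        have hs : ∀ D : Finset (V d), ∀ y ∈ D, ∑ z ∈ D, tau (pb J β) D y z ≤
            2 * (1 + C2 * Kd d α) * (X:ℝ) ^ α := fun D y _ =>
          (ENNReal.ofReal_le_ofReal_iff (by positivity)).1 ((sum_le_chi hP H D y).trans hg)
        have ht := fun M => hP3 _ H hNB X hX hs r (ball 0 M) 0 x (self_mem_ball _ _) hx.symm
          (by rw [normInf_comm, sub_zero])
        refine (two_le hP hp ht).trans (ENNReal.ofReal_le_ofReal ?_)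
        rw [mul_assoc, mul_comm ((X:ℝ) ^ (2 * α))]
        gcongr
        linarith

/-- The slightly subcritical two-point function: if `0 < α < d` and `α < 1` then for
`β_c/2 ≤ β ≤ β_c`, `ℙ_β(0 ↔ x) ≍ ‖x‖^{-d+α} (1 ∨ ‖x‖/ξ(β))^{-2α}`. -/
theorem subcritical_two_point_function {d : ℕ} {J : V d → V d → ℝ} {α c C : ℝ}
    (hJ : KernelHyp d J α c C)
    (P : ℝ → Measure (Config d)) (hP : IsLRP J P)
    (hα : α < 1) :
    ∃ c₁ C₁ : ℝ, 0 < c₁ ∧ c₁ ≤ C₁ ∧ ∀ β : ℝ, betaC P / 2 ≤ β → β ≤ betaC P →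
      ∀ x : V d, x ≠ 0 →
      ENNReal.ofReal (c₁ * (normInf x : ℝ) ^ (α - (d : ℝ))) *
          (max 1 ((normInf x : ℝ≥0∞) / xi P β)) ^ (-(2 * α)) ≤ twoPoint P β 0 x ∧
      twoPoint P β 0 x ≤ ENNReal.ofReal (C₁ * (normInf x : ℝ) ^ (α - (d : ℝ))) *
          (max 1 ((normInf x : ℝ≥0∞) / xi P β)) ^ (-(2 * α)) := by
  exact main_tp hJ P hP hα

end LRP
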